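/- Let 0 < a ≤ 1, 0 < λ < 1 and 1/2 < σ < 1. Then, as T → ∞, ∫_1^T |ζ_L(σ+it, a, λ)|² dt = ζ_H(2σ, a) · T + ((2π)^{2σ−1}/(2−2σ)) · ζ_H(2−2σ, λ) · T^{2−2σ} + O(T^{1−σ} log T); in particular the error term O(T^{σ/2}) occurring in the literature can be removed. -/

import Mathlib

open Complex Filter Finset MeasureTheory

/-- The Hurwitz zeta function `ζ_H(s,a)` (meromorphic continuation of
`∑ m, (m+a)^{-s}`). -/
noncomputable def hzeta (a : ℝ) (s : ℂ) : ℂ := HurwitzZeta.hurwitzZeta (a : UnitAddCircle) s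

/-- The Lerch zeta function `ζ_L(s,a,λ)`, defined as the limit of the partial sums
`∑_{m<N} e^{2πimλ} (m+a)^{-s}` (which converge for `Re s > 0` when `0 < λ < 1`). -/
noncomputable def zetaL (a lam : ℝ) (s : ℂ) : ℂ :=
  limUnder atTop
    (fun N : ℕ => ∑ m ∈ Finset.range N,
      Complex.exp (2 * Real.pi * I * lam * m) * ((m : ℂ) + a) ^ (-s))

namespace LerchMeanSquare

/-! ### Stirling's formula for the complex Gamma function -/

/-- The terms of Gudermann's series. -/
noncomputable def gudermannTerm (z : ℂ) : ℂ := (z + 1 / 2) * (log (z + 1) - log z) - 1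

lemma norm_le_norm_add_of_re_pos {z : ℂ} (hz : 0 < z.re) {u : ℝ} (hu : 0 ≤ u) :
    ‖z‖ ≤ ‖z + u‖ := by
  rw [Complex.norm_def, Complex.norm_def]
  apply Real.sqrt_le_sqrt
  simp only [normSq_apply, add_re, ofReal_re, add_im, ofReal_im, add_zero]
  nlinarith

lemma re_add_nat_pos {s : ℂ} (hs : 1 / 8 < s.re) (k : ℕ) : 0 < (s + k).re := by
  have : (0 : ℝ) ≤ k := k.cast_nonneg
  simp only [add_re, natCast_re]
  linarith

lemma norm_gudermannTerm_le {z : ℂ} (hz : 0 < z.re) :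
    ‖gudermannTerm z‖ ≤ 1 / (4 * ‖z‖ ^ 2) := by
  have hz0 : 0 < ‖z‖ := norm_pos_iff.2 (by rintro rfl; simp at hz)
  have hzu : ∀ u : ℝ, 0 ≤ u → z + u ∈ slitPlane := fun u hu => Or.inl (by simp; positivity)
  have hh : z + 1 / 2 ≠ 0 := by
    have := slitPlane_ne_zero (hzu (1 / 2) (by norm_num)); push_cast at this; exact this
  let f : ℝ → ℂ := fun u => (z + 1 / 2) * log (z + u) - u - (u - u ^ 2) / 2 / (z + 1 / 2)
  have hf : ∀ u ∈ Set.Icc (0 : ℝ) 1, HasDerivWithinAt f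
      ((1 / 2 - u) ^ 2 / ((z + u) * (z + 1 / 2))) (Set.Icc 0 1) u := by
    intro u hu
    have hu0 := slitPlane_ne_zero (hzu u hu.1)
    have h1 : HasDerivAt (fun u : ℝ => (u : ℂ)) 1 u := Complex.ofRealCLM.hasDerivAt
    have h2 : HasDerivAt (fun u : ℝ => log (z + u)) (1 / (z + u)) u :=
      (h1.const_add z).clog_real (hzu u hu.1)
    have h3 := (((h2.const_mul (z + 1 / 2)).sub h1).sub
      (((h1.sub (h1.pow 2)).div_const 2).div_const (z + 1 / 2))).hasDerivWithinAt
        (s := Set.Icc 0 1)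
    refine h3.congr_deriv ?_
    obtain ⟨w, hw⟩ : ∃ w, w = z + 1 / 2 := ⟨_, rfl⟩
    have hz' : z = w - 1 / 2 := by rw [hw]; ring
    rw [← hw] at hh ⊢
    rw [hz'] at hu0 ⊢
    have hu1 : w - 1 / 2 + u ≠ 0 := hu0
    have hu2 : w * 2 - 1 + 2 * u ≠ 0 := by
      intro h; apply hu1; linear_combination h / 2
    field_simp
    push_cast
    ring
  have hb : ∀ u ∈ Set.Ico (0 : ℝ) 1,
      ‖((1 / 2 - u) ^ 2 / ((z + u) * (z + 1 / 2)) : ℂ)‖ ≤ 1 / (4 * ‖z‖ ^ 2) := by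
    intro u hu
    rw [norm_div, norm_mul, norm_pow]
    have a1 : ‖(1 / 2 - u : ℂ)‖ ≤ 1 / 2 := by
      have : (1 / 2 - u : ℂ) = ((1 / 2 - u : ℝ) : ℂ) := by push_cast; ring
      rw [this, Complex.norm_real, Real.norm_eq_abs, abs_le]
      constructor <;> linarith [hu.1, hu.2]
    have a2 := norm_le_norm_add_of_re_pos hz hu.1
    have a3 := norm_le_norm_add_of_re_pos hz (u := 1 / 2) (by norm_num)
    push_cast at a3
    have a4 := hz0.trans_le a2
    have a5 := hz0.trans_le a3
    rw [div_le_div_iff₀ (by positivity) (by positivity)]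
    have : ‖z‖ * ‖z‖ ≤ ‖z + u‖ * ‖z + 1 / 2‖ := by gcongr
    have : ‖(1 / 2 - u : ℂ)‖ ^ 2 ≤ (1 / 2) ^ 2 := by gcongr
    nlinarith [sq_nonneg ‖z‖]
  have := norm_image_sub_le_of_norm_deriv_le_segment' hf hb 1 (by simp)
  have e : f 1 - f 0 = gudermannTerm z := by
    simp only [f, gudermannTerm]; push_cast; ring_nf
  rw [e] at this
  simpa using this

/-- The remainder in Stirling's formula, as Gudermann's series. -/
noncomputable def stirlingRemainder (s : ℂ) : ℂ := ∑' k : ℕ, gudermannTerm (s + k)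

lemma norm_gudermannTerm_add_nat_le {s : ℂ} (hs : 1 / 8 < s.re) (k : ℕ) :
    ‖gudermannTerm (s + k)‖ ≤ 16 * (1 / ((k : ℝ) + 1) ^ 2) := by
  have h := norm_gudermannTerm_le (re_add_nat_pos hs k)
  have h2 : ((k : ℝ) + 1) / 8 ≤ ‖s + k‖ := by
    refine le_trans ?_ (Complex.re_le_norm _)
    simp
    have : (0 : ℝ) ≤ k := k.cast_nonneg
    linarith
  have h3 : 0 < ‖s + k‖ := lt_of_lt_of_le (by positivity) h2
  refine h.trans ?_
  rw [mul_one_div, div_le_div_iff₀ (by positivity) (by positivity)]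
  have : (((k : ℝ) + 1) / 8) ^ 2 ≤ ‖s + k‖ ^ 2 := by gcongr
  nlinarith

lemma summable_gudermann_bound : Summable fun k : ℕ => 16 * (1 / ((k : ℝ) + 1) ^ 2) := by
  apply Summable.mul_left
  exact_mod_cast (summable_nat_add_iff 1).2 (Real.summable_one_div_nat_pow.2 one_lt_two)

lemma isOpen_re_gt (c : ℝ) : IsOpen {s : ℂ | c < s.re} := isOpen_lt continuous_const continuous_re

lemma differentiableOn_stirlingRemainder :
    DifferentiableOn ℂ stirlingRemainder {s : ℂ | 1 / 8 < s.re} := by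
  refine differentiableOn_tsum_of_summable_norm summable_gudermann_bound (fun k => ?_)
    (isOpen_re_gt _) (fun k s hs => norm_gudermannTerm_add_nat_le hs k)
  intro s hs
  have hs' : 1 / 8 < s.re := hs
  have h1 : s + k ∈ slitPlane := Or.inl (re_add_nat_pos hs' k)
  have h2 : s + k + 1 ∈ slitPlane := Or.inl (by
    have := re_add_nat_pos hs' k
    rw [add_re, one_re]
    linarith)
  unfold gudermannTerm
  have e1 : DifferentiableAt ℂ (fun s : ℂ => s + k) s := by fun_prop
  exact (((e1.add_const _).mul (((e1.add_const 1).clog h2).sub (e1.clog h1))).sub_const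
    1).differentiableWithinAt

lemma summable_gudermannTerm {s : ℂ} (hs : 1 / 8 < s.re) :
    Summable fun k : ℕ => gudermannTerm (s + k) :=
  Summable.of_norm_bounded summable_gudermann_bound (norm_gudermannTerm_add_nat_le hs)

lemma norm_stirlingRemainder_le {s : ℂ} (hs : 1 / 8 < s.re) (h2 : 2 ≤ ‖s‖) :
    ‖stirlingRemainder s‖ ≤ 1 / ‖s‖ := by
  have hpart : ∀ n : ℕ, ∑ k ∈ range n, ‖gudermannTerm (s + k)‖ ≤
      1 / 2 * (1 / (‖s‖ - 1) - 1 / (‖s‖ + n - 1)) := by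
    intro n
    induction n with
    | zero => simp
    | succ n ih =>
      rw [sum_range_succ]
      have h := norm_gudermannTerm_le (re_add_nat_pos hs n)
      have hn : (0 : ℝ) ≤ n := n.cast_nonneg
      have hge : (‖s‖ + n) ^ 2 / 2 ≤ ‖s + n‖ ^ 2 := by
        rw [← normSq_eq_norm_sq, normSq_apply]
        have : ‖s‖ ^ 2 = s.re * s.re + s.im * s.im := by
          rw [← normSq_eq_norm_sq, normSq_apply]
        simp only [add_re, natCast_re, add_im, natCast_im, add_zero]
        nlinarith [sq_nonneg (‖s‖ - n), mul_nonneg hn (by linarith : (0 : ℝ) ≤ s.re)]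
      have h3 : ‖gudermannTerm (s + n)‖ ≤
          1 / 2 * (1 / (‖s‖ + n - 1) - 1 / (‖s‖ + (n + 1 : ℕ) - 1)) := by
        refine h.trans ?_
        have e : 1 / (‖s‖ + n - 1) - 1 / (‖s‖ + (n + 1 : ℕ) - 1) =
            1 / ((‖s‖ + n - 1) * (‖s‖ + n)) := by
          push_cast
          have : ‖s‖ + n - 1 ≠ 0 := by linarith
          have : ‖s‖ + n ≠ 0 := by linarith
          have e' : ‖s‖ + (n + 1) - 1 = ‖s‖ + n := by ring
          rw [e']
          field_simp
          ring
        rw [e, ← one_div_mul_one_div, one_div_mul_one_div, one_div_mul_one_div]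
        apply one_div_le_one_div_of_le
        · have : 0 < ‖s‖ + n - 1 := by linarith
          positivity
        · nlinarith
      linarith
  have hsum := (summable_gudermannTerm hs).norm
  calc ‖stirlingRemainder s‖ ≤ ∑' k : ℕ, ‖gudermannTerm (s + k)‖ := norm_tsum_le_tsum_norm hsum
    _ ≤ 1 / 2 * (1 / (‖s‖ - 1)) := by
      refine hsum.tsum_le_of_sum_range_le fun n => (hpart n).trans ?_
      have : 0 ≤ 1 / (‖s‖ + n - 1) := by
        have hn : (0 : ℝ) ≤ n := n.cast_nonneg
        apply one_div_nonneg.2; linarith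
      linarith
    _ ≤ 1 / ‖s‖ := by
      rw [one_div_mul_one_div]
      apply one_div_le_one_div_of_le <;> linarith

lemma exp_stirling_step {z : ℂ} (hz : 0 < z.re) :
    exp ((z + 1 - 1 / 2) * log (z + 1) - (z + 1) - ((z - 1 / 2) * log z - z) - gudermannTerm z)
      = z := by
  have hz0 : z ≠ 0 := by rintro rfl; simp at hz
  have : (z + 1 - 1 / 2) * log (z + 1) - (z + 1) - ((z - 1 / 2) * log z - z) - gudermannTerm z
      = log z := by
    unfold gudermannTerm; ring
  rw [this, exp_log hz0]

lemma prod_add_nat_eq_exp {s : ℂ} (hs : 1 / 8 < s.re) (n : ℕ) :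
    ∏ j ∈ range n, (s + j) = exp ((s + n - 1 / 2) * log (s + n) - (s + n)
      - ((s - 1 / 2) * log s - s) - ∑ k ∈ range n, gudermannTerm (s + k)) := by
  induction n with
  | zero => simp
  | succ n ih =>
    rw [prod_range_succ, ih, sum_range_succ]
    refine (congrArg (_ * ·) (exp_stirling_step (re_add_nat_pos hs n)).symm).trans ?_
    rw [← exp_add]
    push_cast
    congr 1
    ring_nf

lemma factorial_eq_stirlingSeq_mul {n : ℕ} (hn : n ≠ 0) :
    (n.factorial : ℝ) = Stirling.stirlingSeq n * √2 * Real.exp ((n + 1 / 2) * Real.log n - n) := by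
  have hn' : (0 : ℝ) < n := by positivity
  have e : Real.exp ((n + 1 / 2) * Real.log n - n) = √n * (n / Real.exp 1) ^ n := by
    rw [div_pow, ← Real.exp_nat_mul, mul_one, Real.exp_sub, add_mul, Real.exp_add,
      mul_comm (n : ℝ) (Real.log n), Real.exp_mul, Real.exp_log hn', Real.rpow_natCast,
      mul_comm (1 / 2 : ℝ), Real.exp_mul, Real.exp_log hn', Real.sqrt_eq_rpow]
    ring
  rw [e, Stirling.stirlingSeq, Real.sqrt_mul (by norm_num)]
  have h1 : √(2 : ℝ) ≠ 0 := by positivity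
  have h2 : √(n : ℝ) ≠ 0 := by positivity
  have h3 : ((n : ℝ) / Real.exp 1) ^ n ≠ 0 := by positivity
  generalize ((n : ℝ) / Real.exp 1) ^ n = x at *
  field_simp

lemma tendsto_stirling_constant {s : ℂ} (hs : 1 / 8 < s.re) :
    Tendsto (fun n : ℕ => (n : ℂ) ^ s * n.factorial *
      exp (-((s + (n + 1 : ℕ) - 1 / 2) * log (s + (n + 1 : ℕ)) - (s + (n + 1 : ℕ)))))
      atTop (nhds (√(2 * Real.pi) : ℝ)) := by
  let g : ℕ → ℂ := fun n => (s + 1) / n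
  have hg : Tendsto (fun n : ℕ => n * g n) atTop (nhds (s + 1)) := by
    apply tendsto_const_nhds.congr'
    filter_upwards [eventually_ne_atTop 0] with n hn
    simp only [g]; field_simp
  have h1 := tendsto_nat_mul_log_one_add_of_tendsto hg
  have h2 : Tendsto (fun n => log (1 + g n)) atTop (nhds 0) := by
    have := h1.mul (tendsto_inv_atTop_nhds_zero_nat (𝕜 := ℂ))
    rw [mul_zero] at this
    refine this.congr' ?_
    filter_upwards [eventually_ne_atTop 0] with n hn
    field_simp
  have h3 : Tendsto (fun n : ℕ => -(n * log (1 + g n) + (s + 1 / 2) * log (1 + g n)) + (s + 1))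
      atTop (nhds (-((s + 1) + (s + 1 / 2) * 0) + (s + 1))) :=
    ((h1.add (h2.const_mul _)).neg).add_const _
  have h4 := (((continuous_exp.tendsto _).comp h3)).const_mul ((√2 : ℝ) : ℂ)
  have h5 : Tendsto (fun n => ((Stirling.stirlingSeq n : ℝ) : ℂ)) atTop
      (nhds ((√Real.pi : ℝ) : ℂ)) :=
    (continuous_ofReal.tendsto _).comp Stirling.tendsto_stirlingSeq_sqrt_pi
  have h6 := h5.mul h4
  have e : ((√Real.pi : ℝ) : ℂ) * (((√2 : ℝ) : ℂ) *
      exp (-((s + 1) + (s + 1 / 2) * 0) + (s + 1))) = (√(2 * Real.pi) : ℝ) := by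
    rw [mul_zero, add_zero, neg_add_cancel, exp_zero, mul_one, Real.sqrt_mul (by norm_num)]
    push_cast; ring
  rw [e] at h6
  refine h6.congr' ?_
  filter_upwards [eventually_ne_atTop 0] with n hn
  have hnr : (0 : ℝ) < n := by positivity
  have hnc : (n : ℂ) ≠ 0 := by exact_mod_cast hn
  have hne : s + (n + 1 : ℕ) ≠ 0 := by
    intro h
    have := re_add_nat_pos hs (n + 1)
    rw [h] at this; simp at this
  have hlog : log (s + (n + 1 : ℕ)) = log n + log (1 + g n) := by
    have e1 : s + (n + 1 : ℕ) = ((n : ℝ) : ℂ) * (1 + g n) := by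
      simp only [g]; push_cast; field_simp; ring
    have e2 : 1 + g n ≠ 0 := by
      intro h; rw [h, mul_zero] at e1; exact hne e1
    rw [e1, log_ofReal_mul hnr e2, natCast_log]
  have hfac : ((n.factorial : ℕ) : ℂ) =
      (Stirling.stirlingSeq n : ℝ) * (√2 : ℝ) * exp ((n + 1 / 2) * log n - n) := by
    have := congrArg (fun x : ℝ => (x : ℂ)) (factorial_eq_stirlingSeq_mul hn)
    push_cast at this
    exact this
  rw [hlog, hfac, cpow_def_of_ne_zero hnc]
  simp only [Function.comp_apply]
  have : ∀ a b c d e : ℂ, exp a * (b * c * exp d) * exp e = b * (c * exp (a + d + e)) := by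
    intro a b c d e; rw [exp_add, exp_add]; ring
  rw [this]
  congr 3
  push_cast
  ring

/-- Stirling's formula. -/
lemma Gamma_eq_exp_stirling {s : ℂ} (hs : 1 / 8 < s.re) :
    Gamma s = (√(2 * Real.pi) : ℝ) * exp ((s - 1 / 2) * log s - s + stirlingRemainder s) := by
  refine tendsto_nhds_unique (GammaSeq_tendsto_Gamma s) ?_
  have h1 := (summable_gudermannTerm hs).hasSum.tendsto_sum_nat.comp (tendsto_add_atTop_nat 1)
  have h2 := (tendsto_stirling_constant hs).mul
    ((continuous_exp.tendsto _).comp (h1.const_add ((s - 1 / 2) * log s - s)))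
  refine h2.congr fun n => ?_
  simp only [GammaSeq, Function.comp_apply]
  rw [prod_add_nat_eq_exp hs (n + 1), eq_div_iff (exp_ne_zero _), mul_assoc, mul_assoc, ← exp_add,
    ← exp_add]
  refine (congrArg ((n : ℂ) ^ s * n.factorial * ·) ?_).trans (mul_one _)
  refine Eq.trans ?_ exp_zero
  congr 1
  ring

/-! ### Incomplete Gamma integrals along vertical rays -/

/-- The integrand `r ^ j e⁻ʳ (x + ir)⁻ˢ`. -/
noncomputable def rayIntegrand (j : ℕ) (s : ℂ) (x r : ℝ) : ℂ :=
  ((r ^ j * Real.exp (-r) : ℝ) : ℂ) * ((x : ℂ) + r * I) ^ (-s)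

/-- The moments `∫₀^∞ r ^ j e⁻ʳ (x + ir)⁻ˢ dr`. -/
noncomputable def rayIntegral (j : ℕ) (s : ℂ) (x : ℝ) : ℂ :=
  ∫ r in Set.Ioi (0 : ℝ), rayIntegrand j s x r

lemma ray_ne_zero {x r : ℝ} (h : x ≠ 0 ∨ r ≠ 0) : (x : ℂ) + r * I ≠ 0 := by
  intro h0
  have h1 := congrArg re h0
  have h2 := congrArg im h0
  simp at h1 h2
  tauto

lemma norm_ray_cpow (s : ℂ) {x r : ℝ} (h : x ≠ 0 ∨ r ≠ 0) :
    ‖((x : ℂ) + r * I) ^ (-s)‖ =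
      ‖(x : ℂ) + r * I‖ ^ (-s.re) * Real.exp (arg ((x : ℂ) + r * I) * s.im) := by
  rw [norm_cpow_of_ne_zero (ray_ne_zero h), neg_re, neg_im, mul_neg, Real.exp_neg, div_inv_eq_mul]

lemma norm_ray_cpow_le {s : ℂ} (hs : 0 ≤ s.re) {x r : ℝ} {y : ℝ} (hy : 0 < y)
    (h : y ≤ |x| ∨ y ≤ |r|) :
    ‖((x : ℂ) + r * I) ^ (-s)‖ ≤ y ^ (-s.re) * Real.exp (Real.pi * |s.im|) := by
  have h0 : x ≠ 0 ∨ r ≠ 0 := by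
    rcases h with h | h
    · exact Or.inl (abs_pos.1 (hy.trans_le h))
    · exact Or.inr (abs_pos.1 (hy.trans_le h))
  have hle : y ≤ ‖(x : ℂ) + r * I‖ := by
    rcases h with h | h
    · exact h.trans (by simpa using abs_re_le_norm ((x : ℂ) + r * I))
    · exact h.trans (by simpa using abs_im_le_norm ((x : ℂ) + r * I))
  rw [norm_ray_cpow s h0]
  gcongr ?_ * ?_
  · exact Real.rpow_le_rpow_of_nonpos hy hle (by linarith)
  · apply Real.exp_le_exp.2
    refine (le_abs_self _).trans ?_
    rw [abs_mul]
    gcongr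
    exact abs_arg_le_pi _

lemma arg_ray_le {x r : ℝ} (hx : 0 < x) (hr : 0 ≤ r) :
    0 ≤ arg ((x : ℂ) + r * I) ∧ arg ((x : ℂ) + r * I) ≤ r / x := by
  have h1 : 0 ≤ arg ((x : ℂ) + r * I) := by rw [arg_nonneg_iff]; simpa
  refine ⟨h1, ?_⟩
  have h2 : arg ((x : ℂ) + r * I) < Real.pi / 2 := by
    have := abs_arg_lt_pi_div_two_iff (z := (x : ℂ) + r * I) |>.2 (Or.inl (by simpa))
    exact (le_abs_self _).trans_lt this
  refine (Real.le_tan h1 h2).trans ?_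
  rw [tan_arg]; simp

lemma norm_ray_cpow_le_exp {s : ℂ} (hs : 0 ≤ s.re) {x r : ℝ} (hx : 0 < x) (hr : 0 ≤ r) :
    ‖((x : ℂ) + r * I) ^ (-s)‖ ≤ x ^ (-s.re) * Real.exp (max s.im 0 * (r / x)) := by
  rw [norm_ray_cpow s (Or.inl hx.ne')]
  obtain ⟨h1, h2⟩ := arg_ray_le hx hr
  gcongr ?_ * ?_
  · refine Real.rpow_le_rpow_of_nonpos hx ?_ (by linarith)
    exact (le_abs_self x).trans (by simpa using abs_re_le_norm ((x : ℂ) + r * I))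
  · apply Real.exp_le_exp.2
    calc arg ((x : ℂ) + r * I) * s.im ≤ arg ((x : ℂ) + r * I) * max s.im 0 := by
          gcongr; exact le_max_left _ _
      _ ≤ r / x * max s.im 0 := by gcongr
      _ = _ := mul_comm _ _

lemma integrableOn_pow_mul_exp_neg (j : ℕ) :
    IntegrableOn (fun r : ℝ => r ^ j * Real.exp (-r)) (Set.Ioi 0) := by
  refine (Real.GammaIntegral_convergent (s := j + 1) (by positivity)).congr_fun (fun r hr => ?_)
    measurableSet_Ioi
  simp only [add_sub_cancel_right, Real.rpow_natCast]
  ring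

lemma integrableOn_rpow_mul_exp_neg (j : ℕ) {p : ℝ} (hp : p < 1) :
    IntegrableOn (fun r : ℝ => r ^ j * Real.exp (-r) * r ^ (-p)) (Set.Ioi 0) := by
  refine (Real.GammaIntegral_convergent (s := j + 1 - p) ?_).congr_fun (fun r hr => ?_)
    measurableSet_Ioi
  · have : (0 : ℝ) ≤ j := j.cast_nonneg
    linarith
  · have hr' : (0 : ℝ) < r := hr
    have e : (j : ℝ) + 1 - p - 1 = j + -p := by ring
    simp only [e, Real.rpow_add hr', Real.rpow_natCast]
    ring

lemma continuousOn_rayIntegrand (j : ℕ) (s : ℂ) (x : ℝ) :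
    ContinuousOn (rayIntegrand j s x) (Set.Ioi 0) := by
  unfold rayIntegrand
  refine ContinuousOn.mul (by fun_prop) (ContinuousOn.cpow_const (by fun_prop) ?_)
  intro r hr
  have hr' : (0 : ℝ) < r := hr
  exact Or.inr (by simpa using hr'.ne')

lemma norm_rayIntegrand (j : ℕ) (s : ℂ) (x : ℝ) {r : ℝ} (hr : 0 ≤ r) :
    ‖rayIntegrand j s x r‖ = r ^ j * Real.exp (-r) * ‖((x : ℂ) + r * I) ^ (-s)‖ := by
  rw [rayIntegrand, norm_mul, Complex.norm_real, Real.norm_of_nonneg (by positivity)]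

lemma integrableOn_rayIntegrand (j : ℕ) {s : ℂ} (hs : 0 ≤ s.re) {x : ℝ} (hx : 0 < x) :
    IntegrableOn (rayIntegrand j s x) (Set.Ioi 0) := by
  refine Integrable.mono' ((integrableOn_pow_mul_exp_neg j).mul_const
    (x ^ (-s.re) * Real.exp (Real.pi * |s.im|)))
    ((continuousOn_rayIntegrand j s x).aestronglyMeasurable measurableSet_Ioi) ?_
  filter_upwards [ae_restrict_mem measurableSet_Ioi] with r hr
  have hr' : (0 : ℝ) < r := hr
  rw [norm_rayIntegrand j s x hr'.le]
  gcongr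
  exact norm_ray_cpow_le hs hx (Or.inl (le_abs_self x))

lemma hasDerivAt_ray_cpow_left (s : ℂ) {x r : ℝ} (hx : 0 < x) :
    HasDerivAt (fun x : ℝ => ((x : ℂ) + r * I) ^ (-s)) (-s * ((x : ℂ) + r * I) ^ (-(s + 1))) x := by
  have h1 : HasDerivAt (fun z : ℂ => z + r * I) 1 (x : ℂ) := (hasDerivAt_id _).add_const _
  have h2 := (h1.cpow_const (c := -s) (Or.inl (by simpa))).comp_ofReal
  refine h2.congr_deriv ?_
  rw [neg_add, ← sub_eq_add_neg, mul_one]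

lemma hasDerivAt_ray_cpow_right (s : ℂ) {x r : ℝ} (hx : 0 < x) :
    HasDerivAt (fun r : ℝ => ((x : ℂ) + r * I) ^ (-s))
      (-s * I * ((x : ℂ) + r * I) ^ (-(s + 1))) r := by
  have h1 : HasDerivAt (fun z : ℂ => (x : ℂ) + z * I) (1 * I) (r : ℂ) :=
    ((hasDerivAt_id _).mul_const I).const_add _
  have h2 := (h1.cpow_const (c := -s) (Or.inl (by simpa))).comp_ofReal
  refine h2.congr_deriv ?_
  rw [neg_add, ← sub_eq_add_neg]; ring

lemma hasDerivAt_rayIntegral (j : ℕ) {s : ℂ} (hs : 0 ≤ s.re) {x : ℝ} (hx : 0 < x) :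
    HasDerivAt (rayIntegral j s) (-s * rayIntegral j (s + 1) x) x := by
  have hs1 : 0 ≤ (s + 1).re := by rw [add_re, one_re]; linarith
  have key := hasDerivAt_integral_of_dominated_loc_of_deriv_le
    (μ := volume.restrict (Set.Ioi (0 : ℝ))) (F := fun x r => rayIntegrand j s x r)
    (F' := fun x r => -s * rayIntegrand j (s + 1) x r) (x₀ := x) (s := Set.Ioi (x / 2))
    (bound := fun r => ‖s‖ * (r ^ j * Real.exp (-r) *
      ((x / 2) ^ (-(s + 1).re) * Real.exp (Real.pi * |(s + 1).im|))))
    (Ioi_mem_nhds (by linarith)) ?_ (integrableOn_rayIntegrand j hs hx)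
    ((integrableOn_rayIntegrand j hs1 hx).const_mul _).aestronglyMeasurable ?_
    (((integrableOn_pow_mul_exp_neg j).mul_const _).const_mul _) ?_
  · refine key.2.congr_deriv ?_
    rw [rayIntegral, ← integral_const_mul]
  · filter_upwards [Ioi_mem_nhds hx] with y hy
    exact (integrableOn_rayIntegrand j hs hy).aestronglyMeasurable
  · filter_upwards [ae_restrict_mem measurableSet_Ioi] with r hr y hy
    have hr' : (0 : ℝ) < r := hr
    have hy' : x / 2 < y := hy
    rw [norm_mul, norm_neg, norm_rayIntegrand j _ y hr'.le]
    gcongr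
    exact norm_ray_cpow_le hs1 (by linarith) (Or.inl (hy'.le.trans (le_abs_self y)))
  · refine Eventually.of_forall fun r y hy => ?_
    have hy' : 0 < y := by have : x / 2 < y := hy; linarith
    refine ((hasDerivAt_ray_cpow_left s hy').const_mul
      ((r ^ j * Real.exp (-r) : ℝ) : ℂ)).congr_deriv ?_
    simp only [rayIntegrand]; ring

lemma tendsto_rayIntegrand_atTop (j : ℕ) {s : ℂ} (hs : 0 ≤ s.re) {x : ℝ} (hx : 0 < x) :
    Tendsto (rayIntegrand j s x) atTop (nhds 0) := by
  rw [tendsto_zero_iff_norm_tendsto_zero]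
  have h := (Real.tendsto_pow_mul_exp_neg_atTop_nhds_zero j).mul_const
    (x ^ (-s.re) * Real.exp (Real.pi * |s.im|))
  rw [zero_mul] at h
  refine squeeze_zero' (Eventually.of_forall fun _ => norm_nonneg _) ?_ h
  filter_upwards [eventually_ge_atTop 0] with r hr
  rw [norm_rayIntegrand j _ _ hr]
  gcongr
  exact norm_ray_cpow_le hs hx (Or.inl (le_abs_self x))

lemma rayIntegral_zero_by_parts {s : ℂ} (hs : 0 ≤ s.re) {x : ℝ} (hx : 0 < x) :
    s * I * rayIntegral 0 (s + 1) x = (x : ℂ) ^ (-s) - rayIntegral 0 s x := by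
  have hs1 : 0 ≤ (s + 1).re := by rw [add_re, one_re]; linarith
  have hd : ∀ r ∈ Set.Ici (0 : ℝ), HasDerivAt (rayIntegrand 0 s x)
      (-rayIntegrand 0 s x r - s * I * rayIntegrand 0 (s + 1) x r) r := by
    intro r _
    have h1 : HasDerivAt (fun r : ℝ => ((r ^ 0 * Real.exp (-r) : ℝ) : ℂ))
        ((-Real.exp (-r) : ℝ) : ℂ) r := by
      refine HasDerivAt.ofReal_comp ?_
      simpa using (hasDerivAt_neg r).exp
    refine (h1.mul (hasDerivAt_ray_cpow_right s hx)).congr_deriv ?_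
    simp only [rayIntegrand, pow_zero, one_mul]
    push_cast
    ring
  have i1 := integrableOn_rayIntegrand 0 hs hx
  have i2 := integrableOn_rayIntegrand 0 hs1 hx
  have h := integral_Ioi_of_hasDerivAt_of_tendsto' hd (i1.neg.sub (i2.const_mul (s * I)))
    (tendsto_rayIntegrand_atTop 0 hs hx)
  rw [integral_sub (Integrable.fun_neg i1) (i2.const_mul (s * I)), integral_neg,
    integral_const_mul] at h
  simp only [rayIntegrand, pow_zero, neg_zero, Real.exp_zero, ofReal_zero, zero_mul, add_zero,
    one_mul, ofReal_one] at h
  simp only [rayIntegral, rayIntegrand, pow_zero, one_mul]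
  linear_combination -h

lemma rayIntegral_one_by_parts {s : ℂ} (hs : 0 ≤ s.re) {x : ℝ} (hx : 0 < x) :
    s * I * rayIntegral 1 (s + 1) x = rayIntegral 0 s x - rayIntegral 1 s x := by
  have hs1 : 0 ≤ (s + 1).re := by rw [add_re, one_re]; linarith
  have hd : ∀ r ∈ Set.Ici (0 : ℝ), HasDerivAt (rayIntegrand 1 s x)
      (rayIntegrand 0 s x r - rayIntegrand 1 s x r - s * I * rayIntegrand 1 (s + 1) x r) r := by
    intro r _
    have h1 : HasDerivAt (fun r : ℝ => ((r ^ 1 * Real.exp (-r) : ℝ) : ℂ))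
        ((Real.exp (-r) - r * Real.exp (-r) : ℝ) : ℂ) r := by
      refine HasDerivAt.ofReal_comp ?_
      have h2 : HasDerivAt (fun r => Real.exp (-r)) (-Real.exp (-r)) r := by
        simpa using (hasDerivAt_neg r).exp
      have := (hasDerivAt_id r).mul h2
      simp only [pow_one]
      exact this.congr_deriv (by simp; ring)
    refine (h1.mul (hasDerivAt_ray_cpow_right s hx)).congr_deriv ?_
    simp only [rayIntegrand, pow_zero, one_mul, pow_one]
    push_cast
    ring
  have i0 := integrableOn_rayIntegrand 0 hs hx
  have i1 := integrableOn_rayIntegrand 1 hs hx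
  have i2 := integrableOn_rayIntegrand 1 hs1 hx
  have h := integral_Ioi_of_hasDerivAt_of_tendsto' hd ((i0.sub i1).sub (i2.const_mul (s * I)))
    (tendsto_rayIntegrand_atTop 1 hs hx)
  rw [integral_sub (Integrable.sub' i0 i1) (i2.const_mul (s * I)), integral_sub i0 i1,
    integral_const_mul] at h
  have e : rayIntegrand 1 s x 0 = 0 := by simp [rayIntegrand]
  rw [e] at h
  simp only [rayIntegral]
  linear_combination -h

/-- A second antiderivative of `eⁱˣ x⁻ˢ`, decaying at infinity. -/
noncomputable def oscPrim (s : ℂ) (x : ℝ) : ℂ := -(exp (x * I) * rayIntegral 1 s x)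

/-- The derivative of `oscPrim`. -/
noncomputable def oscPrimDeriv (s : ℂ) (x : ℝ) : ℂ := -(I * exp (x * I) * rayIntegral 0 s x)

lemma hasDerivAt_exp_mul_I (x : ℝ) :
    HasDerivAt (fun x : ℝ => exp (x * I)) (I * exp (x * I)) x := by
  refine (((Complex.ofRealCLM.hasDerivAt (x := x)).mul_const I).cexp).congr_deriv ?_
  simp; ring

lemma hasDerivAt_oscPrim {s : ℂ} (hs : 0 ≤ s.re) {x : ℝ} (hx : 0 < x) :
    HasDerivAt (oscPrim s) (oscPrimDeriv s x) x := by
  refine ((hasDerivAt_exp_mul_I x).mul (hasDerivAt_rayIntegral 1 hs hx)).neg.congr_deriv ?_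
  have h := rayIntegral_one_by_parts hs hx
  have h2 : s * rayIntegral 1 (s + 1) x = -I * (rayIntegral 0 s x - rayIntegral 1 s x) := by
    rw [← h]; linear_combination s * rayIntegral 1 (s + 1) x * I_mul_I
  rw [oscPrimDeriv, neg_mul, h2]
  ring

lemma hasDerivAt_oscPrimDeriv {s : ℂ} (hs : 0 ≤ s.re) {x : ℝ} (hx : 0 < x) :
    HasDerivAt (oscPrimDeriv s) (exp (x * I) * (x : ℂ) ^ (-s)) x := by
  refine (((hasDerivAt_exp_mul_I x).const_mul I).mul
    (hasDerivAt_rayIntegral 0 hs hx)).neg.congr_deriv ?_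
  have h := rayIntegral_zero_by_parts hs hx
  have h2 : s * rayIntegral 0 (s + 1) x = -I * ((x : ℂ) ^ (-s) - rayIntegral 0 s x) := by
    rw [← h]; linear_combination s * rayIntegral 0 (s + 1) x * I_mul_I
  rw [neg_mul, h2]
  linear_combination (-exp (x * I) * (x : ℂ) ^ (-s)) * I_mul_I

lemma norm_rayIntegral_le (j : ℕ) {s : ℂ} (hs : 0 ≤ s.re) {x : ℝ} (hx : max s.im 0 < x) :
    ‖rayIntegral j s x‖ ≤ x ^ (-s.re) * (j.factorial * (x / (x - max s.im 0)) ^ (j + 1)) := by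
  have hx0 : 0 < x := (le_max_right _ _).trans_lt hx
  set τ := max s.im 0 with hτ
  have hc : 0 < (x - τ) / x := div_pos (by linarith) hx0
  have h1 := Real.integral_rpow_mul_exp_neg_mul_Ioi (a := j + 1) (r := (x - τ) / x)
    (by positivity) hc
  have h_int : IntegrableOn (fun r : ℝ => r ^ ((j : ℝ) + 1 - 1) * Real.exp (-((x - τ) / x * r)))
      (Set.Ioi 0) := by
    by_contra hcon
    rw [integral_undef hcon] at h1
    have : 0 < (1 / ((x - τ) / x)) ^ ((j : ℝ) + 1) * Real.Gamma ((j : ℝ) + 1) :=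
      mul_pos (by positivity) (Real.Gamma_pos_of_pos (by positivity))
    linarith
  have h2 : ‖rayIntegral j s x‖ ≤ ∫ r in Set.Ioi (0 : ℝ),
      x ^ (-s.re) * (r ^ ((j : ℝ) + 1 - 1) * Real.exp (-((x - τ) / x * r))) := by
    refine norm_integral_le_of_norm_le (h_int.const_mul _) ?_
    filter_upwards [ae_restrict_mem measurableSet_Ioi] with r hr
    have hr' : (0 : ℝ) < r := hr
    rw [norm_rayIntegrand j s x hr'.le, add_sub_cancel_right, Real.rpow_natCast]
    have h3 := norm_ray_cpow_le_exp hs hx0 hr'.le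
    calc r ^ j * Real.exp (-r) * ‖((x : ℂ) + r * I) ^ (-s)‖
        ≤ r ^ j * Real.exp (-r) * (x ^ (-s.re) * Real.exp (τ * (r / x))) := by gcongr
      _ = x ^ (-s.re) * (r ^ j * (Real.exp (-r) * Real.exp (τ * (r / x)))) := by ring
      _ = _ := by
        rw [← Real.exp_add]
        congr 4
        field_simp
        ring
  rw [integral_const_mul, h1, Real.Gamma_nat_eq_factorial] at h2
  refine h2.trans (le_of_eq ?_)
  have e : ((j : ℝ) + 1) = ((j + 1 : ℕ) : ℝ) := by push_cast; ring
  rw [e, Real.rpow_natCast, one_div_div]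
  ring

lemma norm_oscPrim_le {s : ℂ} (hs : 0 ≤ s.re) {x : ℝ} (hx : max s.im 0 < x) :
    ‖oscPrim s x‖ ≤ x ^ (-s.re) * (x / (x - max s.im 0)) ^ 2 := by
  have := norm_rayIntegral_le 1 hs hx
  rw [oscPrim, norm_neg, norm_mul, norm_exp_ofReal_mul_I, one_mul]
  simpa using this

lemma norm_oscPrimDeriv_le {s : ℂ} (hs : 0 ≤ s.re) {x : ℝ} (hx : max s.im 0 < x) :
    ‖oscPrimDeriv s x‖ ≤ x ^ (-s.re) * (x / (x - max s.im 0)) := by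
  have := norm_rayIntegral_le 0 hs hx
  rw [oscPrimDeriv, norm_neg, norm_mul, norm_mul, norm_exp_ofReal_mul_I, norm_I, one_mul, one_mul]
  simpa using this

lemma tendsto_rayIntegral_zero (j : ℕ) {s : ℂ} (hs : 0 ≤ s.re) (hs1 : s.re < 1) :
    Tendsto (rayIntegral j s) (nhdsWithin 0 (Set.Ioi 0)) (nhds (I ^ (-s) * Gamma (j + 1 - s))) := by
  have e : I ^ (-s) * Gamma (j + 1 - s) = rayIntegral j s 0 := by
    rw [Gamma_eq_integral (by simp; linarith [(j.cast_nonneg : (0 : ℝ) ≤ j)]), GammaIntegral,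
      rayIntegral, ← integral_const_mul]
    refine setIntegral_congr_fun measurableSet_Ioi fun r hr => ?_
    have hr' : (0 : ℝ) < r := hr
    have hrc : (r : ℂ) ≠ 0 := ofReal_ne_zero.2 hr'.ne'
    simp only [rayIntegrand, ofReal_zero, zero_add]
    rw [cpow_def_of_ne_zero I_ne_zero, cpow_def_of_ne_zero hrc,
      cpow_def_of_ne_zero (mul_ne_zero hrc I_ne_zero), log_ofReal_mul hr' I_ne_zero,
      ofReal_log hr'.le]
    have e2 : (r : ℂ) ^ j = exp (log r * j) := by
      rw [mul_comm, exp_nat_mul, exp_log hrc]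
    push_cast
    rw [e2]
    simp only [← exp_add]
    congr 1
    ring
  rw [e]
  refine tendsto_integral_filter_of_dominated_convergence
    (fun r => r ^ j * Real.exp (-r) * r ^ (-s.re) * Real.exp (Real.pi * |s.im|)) ?_ ?_
    ((integrableOn_rpow_mul_exp_neg j hs1).mul_const _) ?_
  · exact Eventually.of_forall fun x =>
      (continuousOn_rayIntegrand j s x).aestronglyMeasurable measurableSet_Ioi
  · refine Eventually.of_forall fun x => ?_
    filter_upwards [ae_restrict_mem measurableSet_Ioi] with r hr
    have hr' : (0 : ℝ) < r := hr
    rw [norm_rayIntegrand j s x hr'.le, mul_assoc _ (r ^ (-s.re))]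
    gcongr
    exact norm_ray_cpow_le hs hr' (Or.inr (le_abs_self r))
  · filter_upwards [ae_restrict_mem measurableSet_Ioi] with r hr
    have hr' : (0 : ℝ) < r := hr
    have hc : ContinuousAt (fun x : ℝ => rayIntegrand j s x r) 0 := by
      unfold rayIntegrand
      refine ContinuousAt.mul (by fun_prop) (ContinuousAt.cpow (by fun_prop) (by fun_prop) ?_)
      exact Or.inr (by simpa using hr'.ne')
    exact hc.tendsto.mono_left nhdsWithin_le_nhds

/-- The contribution of the stationary point to `oscPrim`. -/
noncomputable def oscMain (s : ℂ) (x : ℝ) : ℂ := -(I ^ (-s) * Gamma (1 - s) * (1 - s + x * I))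

lemma tendsto_oscPrim_add_mul {s : ℂ} (hs : 0 ≤ s.re) (hs1 : s.re < 1) (x : ℝ) :
    Tendsto (fun y : ℝ => oscPrim s y + (x - y) * oscPrimDeriv s y) (nhdsWithin 0 (Set.Ioi 0))
      (nhds (oscMain s x)) := by
  have h0 := tendsto_rayIntegral_zero 0 hs hs1
  have h1 := tendsto_rayIntegral_zero 1 hs hs1
  have h2 : Tendsto (fun y : ℝ => exp (y * I)) (nhdsWithin 0 (Set.Ioi 0)) (nhds 1) := by
    have : ContinuousAt (fun y : ℝ => exp (y * I)) 0 := by fun_prop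
    simpa [ContinuousAt] using this.tendsto.mono_left nhdsWithin_le_nhds
  have h3 : Tendsto (fun y : ℝ => (x : ℂ) - y) (nhdsWithin 0 (Set.Ioi 0)) (nhds x) := by
    have : ContinuousAt (fun y : ℝ => (x : ℂ) - y) 0 := by fun_prop
    simpa [ContinuousAt] using this.tendsto.mono_left nhdsWithin_le_nhds
  have h := (h2.mul h1).neg.add (h3.mul ((h2.const_mul I).mul h0).neg)
  refine h.congr' (Eventually.of_forall fun y => rfl) |>.trans (le_of_eq ?_)
  congr 1
  have e : Gamma ((1 : ℕ) + 1 - s) = (1 - s) * Gamma (1 - s) := by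
    rw [← Gamma_add_one]
    · push_cast; congr 1; ring
    · intro h
      have := congrArg re h
      simp at this
      linarith
  rw [e, oscMain]
  push_cast
  rw [zero_add]
  ring

lemma norm_sub_le_of_hasDerivAt {E : Type*} [NormedAddCommGroup E] [NormedSpace ℝ E]
    {f f' : ℝ → E} {B B' : ℝ → ℝ} {a b : ℝ} (hab : a ≤ b)
    (hf : ∀ y ∈ Set.Icc a b, HasDerivAt f (f' y) y)
    (hB : ∀ y ∈ Set.Icc a b, HasDerivAt B (B' y) y)
    (hle : ∀ y ∈ Set.Icc a b, ‖f' y‖ ≤ B' y) : ‖f b - f a‖ ≤ B b - B a := by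
  refine image_norm_le_of_norm_deriv_right_le_deriv_boundary' (f := fun y => f y - f a)
    (f' := f') (a := a) (b := b) (B := fun y => B y - B a) (B' := B') ?_ ?_ (by simp) ?_ ?_
    (fun y hy => hle y (Set.Ico_subset_Icc_self hy)) (Set.right_mem_Icc.2 hab)
  · exact fun y hy => ((hf y hy).sub_const _).continuousAt.continuousWithinAt
  · exact fun y hy => ((hf y (Set.Ico_subset_Icc_self hy)).sub_const _).hasDerivWithinAt
  · exact fun y hy => ((hB y hy).sub_const _).continuousAt.continuousWithinAt
  · exact fun y hy => ((hB y (Set.Ico_subset_Icc_self hy)).sub_const _).hasDerivWithinAt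

section remainder

variable {s : ℂ} {x y : ℝ}

lemma sub_mul_I_ne_zero (hs : 0 < s.re) (y : ℝ) : s - y * I ≠ 0 := by
  intro h
  have := congrArg re h
  simp at this
  linarith

lemma norm_osc (hy : 0 < y) : ‖exp (y * I) * (y : ℂ) ^ (-s)‖ = y ^ (-s.re) := by
  rw [norm_mul, norm_exp_ofReal_mul_I, one_mul, norm_cpow_eq_rpow_re_of_pos hy, neg_re]

lemma hasDerivAt_osc (hy : 0 < y) :
    HasDerivAt (fun y : ℝ => exp (y * I) * (y : ℂ) ^ (-s))
      (-((s - y * I) / y * (exp (y * I) * (y : ℂ) ^ (-s)))) y := by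
  have hy0 : (y : ℂ) ≠ 0 := ofReal_ne_zero.2 hy.ne'
  have h1 := hasDerivAt_exp_mul_I y
  have h2 : HasDerivAt (fun y : ℝ => (y : ℂ) ^ (-s)) (-s * (y : ℂ) ^ (-s - 1)) y := by
    have := ((hasDerivAt_id (y : ℂ)).cpow_const (c := -s) (Or.inl (by simpa))).comp_ofReal
    simpa using this
  refine (h1.mul h2).congr_deriv ?_
  rw [cpow_sub _ _ hy0, cpow_one]
  field_simp
  ring

lemma hasDerivAt_weight_one (hs : 0 < s.re) :
    HasDerivAt (fun y : ℝ => ((x : ℂ) - y) * y / (s - y * I))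
      (((x : ℂ) - y) / (s - y * I) - y * (s - x * I) / (s - y * I) ^ 2) y := by
  have h0 := sub_mul_I_ne_zero hs y
  have hid := hasDerivAt_id (y : ℂ)
  have := ((((hid.const_sub (x : ℂ)).mul hid).div ((hid.mul_const I).const_sub s) h0)).comp_ofReal
  refine this.congr_deriv ?_
  simp only [id, Pi.mul_apply]
  field_simp
  ring

lemma hasDerivAt_weight_two (hs : 0 < s.re) :
    HasDerivAt (fun y : ℝ => (((x : ℂ) - y) / (s - y * I) - y * (s - x * I) / (s - y * I) ^ 2) *
        (y / (s - y * I)))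
      ((x - 2 * y) / (s - y * I) ^ 2 + 2 * I * (x - y) * y / (s - y * I) ^ 3
        - 2 * y * (s - x * I) / (s - y * I) ^ 3
        - 3 * I * y ^ 2 * (s - x * I) / (s - y * I) ^ 4) y := by
  have h0 := sub_mul_I_ne_zero hs y
  have hid := hasDerivAt_id (y : ℂ)
  have hD := (hid.mul_const I).const_sub s
  have := ((((hid.const_sub (x : ℂ)).div hD h0).sub
    ((hid.mul_const (s - x * I)).div (hD.pow 2) (pow_ne_zero 2 h0))).mul
    (hid.div hD h0)).comp_ofReal
  refine this.congr_deriv ?_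
  simp only [id, Pi.div_apply, Pi.sub_apply, Pi.pow_apply]
  field_simp
  ring

lemma norm_sub_mul_I_bounds (hs : 1 / 2 ≤ s.re) (hs1 : s.re < 1) (hy : y ≤ s.im) :
    (1 / 2 + (s.im - y)) / 2 ≤ ‖s - y * I‖ ∧ s.im - y ≤ ‖s - y * I‖ ∧
      ‖s - y * I‖ ≤ 2 * (1 / 2 + (s.im - y)) := by
  have h1 : s.re ≤ ‖s - y * I‖ := by
    refine (le_abs_self _).trans ?_
    simpa using abs_re_le_norm (s - y * I)
  have h2 : s.im - y ≤ ‖s - y * I‖ := by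
    refine (le_abs_self _).trans ?_
    simpa using abs_im_le_norm (s - y * I)
  refine ⟨by linarith, h2, ?_⟩
  have h3 := norm_le_abs_re_add_abs_im (s - y * I)
  simp only [sub_re, mul_re, ofReal_re, I_re, mul_zero, ofReal_im, I_im, mul_one, sub_self,
    sub_zero, sub_im, mul_im, add_zero] at h3
  rw [abs_of_nonneg (by linarith), abs_of_nonneg (by linarith)] at h3
  linarith

lemma norm_sub_mul_I_mono (hyx : y ≤ x) (hx : x ≤ s.im) : ‖s - x * I‖ ≤ ‖s - y * I‖ := by
  rw [Complex.norm_def, Complex.norm_def]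
  apply Real.sqrt_le_sqrt
  simp only [normSq_apply, sub_re, mul_re, ofReal_re, I_re, mul_zero, ofReal_im, I_im, mul_one,
    sub_self, sub_zero, sub_im, mul_im, add_zero]
  nlinarith

/-- Partial integration of `∫ (x - y) eⁱʸ y⁻ˢ dy`, carried out once. -/
noncomputable def oscParts (s : ℂ) (x y : ℝ) : ℂ :=
  oscPrim s y + (x - y) * oscPrimDeriv s y +
    ((x : ℂ) - y) * y / (s - y * I) * (exp (y * I) * (y : ℂ) ^ (-s))

lemma hasDerivAt_oscParts (hs : 0 < s.re) (hy : 0 < y) :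
    HasDerivAt (oscParts s x)
      ((((x : ℂ) - y) / (s - y * I) - y * (s - x * I) / (s - y * I) ^ 2) *
        (exp (y * I) * (y : ℂ) ^ (-s))) y := by
  have h0 := sub_mul_I_ne_zero hs y
  have hy0 : (y : ℂ) ≠ 0 := ofReal_ne_zero.2 hy.ne'
  have hl : HasDerivAt (fun y : ℝ => (x : ℂ) - y) (-1) y := by
    simpa using ((hasDerivAt_id (y : ℂ)).const_sub (x : ℂ)).comp_ofReal
  refine (((hasDerivAt_oscPrim hs.le hy).add (hl.mul (hasDerivAt_oscPrimDeriv hs.le hy))).add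
    ((hasDerivAt_weight_one (x := x) hs).mul (hasDerivAt_osc hy))).congr_deriv ?_
  generalize exp (y * I) * (y : ℂ) ^ (-s) = f
  field_simp
  ring

lemma hasDerivAt_oscParts_two (hs : 0 < s.re) (hy : 0 < y) :
    HasDerivAt (fun y : ℝ => oscParts s x y +
        (((x : ℂ) - y) / (s - y * I) - y * (s - x * I) / (s - y * I) ^ 2) *
        (y / (s - y * I)) * (exp (y * I) * (y : ℂ) ^ (-s)))
      (((x - 2 * y) / (s - y * I) ^ 2 + 2 * I * (x - y) * y / (s - y * I) ^ 3
        - 2 * y * (s - x * I) / (s - y * I) ^ 3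
        - 3 * I * y ^ 2 * (s - x * I) / (s - y * I) ^ 4) * (exp (y * I) * (y : ℂ) ^ (-s))) y := by
  have h0 := sub_mul_I_ne_zero hs y
  have hy0 : (y : ℂ) ≠ 0 := ofReal_ne_zero.2 hy.ne'
  refine ((hasDerivAt_oscParts (x := x) hs hy).add
    ((hasDerivAt_weight_two (x := x) hs).mul (hasDerivAt_osc hy))).congr_deriv ?_
  generalize exp (y * I) * (y : ℂ) ^ (-s) = f
  field_simp
  ring

lemma tendsto_oscParts (hs : 0 < s.re) (hs1 : s.re < 1) (x : ℝ) :
    Tendsto (oscParts s x) (nhdsWithin 0 (Set.Ioi 0)) (nhds (oscMain s x)) := by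
  have h1 := tendsto_oscPrim_add_mul (s := s) hs.le hs1 x
  have h2 : Tendsto (fun y : ℝ => ((x : ℂ) - y) * y / (s - y * I) *
      (exp (y * I) * (y : ℂ) ^ (-s))) (nhdsWithin 0 (Set.Ioi 0)) (nhds 0) := by
    have h3 : Tendsto (fun y : ℝ => ‖((x : ℂ) - y) / (s - y * I)‖ * y ^ (1 - s.re))
        (nhdsWithin 0 (Set.Ioi 0)) (nhds (‖((x : ℂ) - (0 : ℝ)) / (s - (0 : ℝ) * I)‖ * 0)) := by
      refine Tendsto.mul (ContinuousAt.tendsto ?_ |>.mono_left nhdsWithin_le_nhds) ?_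
      · refine ContinuousAt.norm (ContinuousAt.div (by fun_prop) (by fun_prop) ?_)
        exact sub_mul_I_ne_zero hs 0
      · have := (Real.continuousAt_rpow_const 0 (1 - s.re) (Or.inr (by linarith))).tendsto
        rw [Real.zero_rpow (by linarith)] at this
        exact this.mono_left nhdsWithin_le_nhds
    rw [mul_zero] at h3
    refine squeeze_zero_norm' ?_ h3
    filter_upwards [self_mem_nhdsWithin] with y hy
    have hy : 0 < y := hy
    rw [norm_mul, norm_osc hy, mul_div_right_comm, norm_mul, Complex.norm_real,
      Real.norm_of_nonneg hy.le, mul_assoc, Real.rpow_sub hy, Real.rpow_one, Real.rpow_neg hy.le,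
      div_eq_mul_inv y]
  have h := h1.add h2
  rw [add_zero] at h
  exact h

lemma hasDerivAt_rpow_primitive {p : ℝ} (hp : p ≠ 1) (hy : 0 < y) :
    HasDerivAt (fun y : ℝ => y ^ (1 - p) / (1 - p)) (y ^ (-p)) y := by
  have h := (Real.hasDerivAt_rpow_const (x := y) (p := 1 - p) (Or.inl hy.ne')).div_const (1 - p)
  refine h.congr_deriv ?_
  have : 1 - p ≠ 0 := sub_ne_zero.2 hp.symm
  rw [show 1 - p - 1 = -p by ring]
  field_simp

lemma hasDerivAt_inv_sub {c : ℝ} (h : 0 < c - y) :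
    HasDerivAt (fun y : ℝ => 1 / (c - y)) (1 / (c - y) ^ 2) y := by
  have := ((hasDerivAt_id y).const_sub c).fun_inv h.ne'
  simpa using this

lemma hasDerivAt_inv_sub_sq {c : ℝ} (h : 0 < c - y) :
    HasDerivAt (fun y : ℝ => 1 / (2 * (c - y) ^ 2)) (1 / (c - y) ^ 3) y := by
  have := ((((hasDerivAt_id y).const_sub c).fun_pow 2).const_mul 2).fun_inv
    (by simp; exact h.ne')
  simp only [id, one_div] at this ⊢
  refine this.congr_deriv ?_
  have := h.ne'
  field_simp
  ring

/-- Comparison of the limit at `0+` with the value at the right end point. -/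
lemma norm_sub_le_of_tendsto_zero {f f' : ℝ → ℂ} {B B' : ℝ → ℝ} {l : ℂ} (hx : 0 < x)
    (hf : ∀ y ∈ Set.Ioc 0 x, HasDerivAt f (f' y) y)
    (hB : ∀ y ∈ Set.Ioc 0 x, HasDerivAt B (B' y) y)
    (hle : ∀ y ∈ Set.Ioc 0 x, ‖f' y‖ ≤ B' y) (hB0 : ∀ y ∈ Set.Ioc 0 x, 0 ≤ B y)
    (hl : Tendsto f (nhdsWithin 0 (Set.Ioi 0)) (nhds l)) : ‖f x - l‖ ≤ B x := by
  refine le_of_tendsto (hl.const_sub (f x)).norm ?_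
  filter_upwards [Ioo_mem_nhdsGT hx] with y hy
  have := norm_sub_le_of_hasDerivAt (f := f) (f' := f') (B := B) (B' := B') hy.2.le
    (fun z hz => hf z ⟨hy.1.trans_le hz.1, hz.2⟩) (fun z hz => hB z ⟨hy.1.trans_le hz.1, hz.2⟩)
    (fun z hz => hle z ⟨hy.1.trans_le hz.1, hz.2⟩)
  linarith [hB0 y ⟨hy.1, hy.2.le⟩]

lemma norm_oscPrim_sub_le_once (hs : 1 / 2 ≤ s.re) (hs1 : s.re < 1) (hx : 0 < x) (hxt : x ≤ s.im) :
    ‖oscPrim s x - oscMain s x‖ ≤ (1 / (1 - s.re) + 8) * x ^ (1 - s.re) := by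
  have hs0 : 0 < s.re := by linarith
  set t := s.im with ht
  have key := norm_sub_le_of_tendsto_zero (x := x) (f := oscParts s x)
    (f' := fun y => (((x : ℂ) - y) / (s - y * I) - y * (s - x * I) / (s - y * I) ^ 2) *
        (exp (y * I) * (y : ℂ) ^ (-s)))
    (B := fun y => y ^ (1 - s.re) / (1 - s.re) +
      4 * x ^ (1 - s.re) * ‖s - x * I‖ * (1 / (1 / 2 + t - y)))
    (B' := fun y => y ^ (-s.re) + 4 * x ^ (1 - s.re) * ‖s - x * I‖ * (1 / (1 / 2 + t - y) ^ 2))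
    (l := oscMain s x) hx
    (fun y hy => hasDerivAt_oscParts hs0 hy.1)
    (fun y hy => (hasDerivAt_rpow_primitive hs1.ne hy.1).add
      ((hasDerivAt_inv_sub (by linarith [hy.2])).const_mul _)) ?_ ?_ (tendsto_oscParts hs0 hs1 x)
  · have e1 : oscParts s x x = oscPrim s x := by simp [oscParts]
    rw [e1] at key
    refine key.trans ?_
    obtain ⟨-, -, h3⟩ := norm_sub_mul_I_bounds hs hs1 hxt
    rw [← ht] at h3
    have hE : 0 < 1 / 2 + t - x := by linarith
    have : ‖s - x * I‖ * (1 / (1 / 2 + t - x)) ≤ 2 := by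
      rw [mul_one_div, div_le_iff₀ hE]; linarith
    have h4 : 0 < x ^ (1 - s.re) := Real.rpow_pos_of_pos hx _
    calc _ = x ^ (1 - s.re) / (1 - s.re) + 4 * x ^ (1 - s.re) *
        (‖s - x * I‖ * (1 / (1 / 2 + t - x))) := by ring
      _ ≤ x ^ (1 - s.re) / (1 - s.re) + 4 * x ^ (1 - s.re) * 2 := by gcongr
      _ = _ := by ring
  · intro y hy
    have hyt : y ≤ t := hy.2.trans hxt
    obtain ⟨h1, h2, h3⟩ := norm_sub_mul_I_bounds hs hs1 hyt
    rw [← ht] at h1 h2 h3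
    have hE : 0 < 1 / 2 + t - y := by linarith
    have hD : 0 < ‖s - y * I‖ := by linarith
    rw [norm_mul, norm_osc hy.1]
    have h4 : 0 < y ^ (-s.re) := Real.rpow_pos_of_pos hy.1 _
    have hb1 : ‖((x : ℂ) - y) / (s - y * I)‖ ≤ 1 := by
      rw [norm_div, div_le_one hD, ← ofReal_sub, Complex.norm_real,
        Real.norm_of_nonneg (by linarith [hy.2])]
      linarith
    have hb2 : ‖(y : ℂ) * (s - x * I) / (s - y * I) ^ 2‖ ≤
        y * (4 * ‖s - x * I‖ * (1 / (1 / 2 + t - y) ^ 2)) := by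
      rw [norm_div, norm_mul, norm_pow, Complex.norm_real, Real.norm_of_nonneg hy.1.le,
        div_le_iff₀ (by positivity)]
      have : 1 ≤ 4 * (1 / (1 / 2 + t - y) ^ 2) * ‖s - y * I‖ ^ 2 := by
        rw [mul_one_div, div_mul_eq_mul_div, le_div_iff₀ (by positivity)]
        nlinarith
      have h5 : 0 ≤ y * ‖s - x * I‖ := mul_nonneg hy.1.le (norm_nonneg _)
      nlinarith
    have hyx : y * y ^ (-s.re) ≤ x ^ (1 - s.re) := by
      rw [← Real.rpow_one_add' hy.1.le (by linarith), ← sub_eq_add_neg]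
      exact Real.rpow_le_rpow hy.1.le hy.2 (by linarith)
    calc _ ≤ (1 + y * (4 * ‖s - x * I‖ * (1 / (1 / 2 + t - y) ^ 2))) * y ^ (-s.re) := by
          gcongr
          exact (norm_sub_le _ _).trans (add_le_add hb1 hb2)
      _ = y ^ (-s.re) + (y * y ^ (-s.re)) * (4 * ‖s - x * I‖ * (1 / (1 / 2 + t - y) ^ 2)) := by ring
      _ ≤ y ^ (-s.re) + x ^ (1 - s.re) * (4 * ‖s - x * I‖ * (1 / (1 / 2 + t - y) ^ 2)) := by gcongr
      _ = _ := by ring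
  · intro y hy
    have hyt : y ≤ t := hy.2.trans hxt
    have hE : 0 < 1 / 2 + t - y := by linarith
    have : 0 < 1 - s.re := by linarith
    have := Real.rpow_nonneg hy.1.le (1 - s.re)
    have := Real.rpow_nonneg hx.le (1 - s.re)
    positivity

lemma inv_pow_le {t E : ℝ} (k : ℕ) (hx : 0 < x) (hxt : x ≤ t) (hy : 0 < y)
    (hyx : y ≤ x) (hE : E = 1 / 2 + t - y) :
    1 / E ^ k ≤ (2 / t) ^ k + 2 * y / x * (1 / E ^ k) := by
  have hE0 : 0 < E := by linarith
  have ht0 : 0 < t := by linarith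
  rcases le_total (2 * y) x with h | h
  · have h1 : 1 / E ^ k ≤ (2 / t) ^ k := by
      rw [← one_div_pow]
      refine pow_le_pow_left₀ (by positivity) ?_ k
      rw [div_le_div_iff₀ hE0 ht0]; linarith
    have : 0 ≤ 2 * y / x * (1 / E ^ k) := by positivity
    linarith
  · have h1 : 1 ≤ 2 * y / x := by rwa [le_div_iff₀ hx, one_mul]
    have h2 : 0 ≤ 1 / E ^ k := by positivity
    have h3 : 0 ≤ (2 / t) ^ k := by positivity
    nlinarith

lemma norm_deriv_weight_two_le (hs : 1 / 2 ≤ s.re) (hs1 : s.re < 1) (hy : 0 < y) (hyx : y ≤ x)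
    (hxt : x ≤ s.im) :
    ‖(x - 2 * y) / (s - y * I) ^ 2 + 2 * I * (x - y) * y / (s - y * I) ^ 3
        - 2 * y * (s - x * I) / (s - y * I) ^ 3
        - 3 * I * y ^ 2 * (s - x * I) / (s - y * I) ^ 4‖ ≤
      20 * x * (1 / (1 / 2 + s.im - y) ^ 2) + 24 * x ^ 2 * (1 / (1 / 2 + s.im - y) ^ 3) := by
  obtain ⟨h1, h2, h3⟩ := norm_sub_mul_I_bounds hs hs1 (hyx.trans hxt)
  have h4 := norm_sub_mul_I_mono (s := s) hyx hxt
  set t := s.im with ht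
  have hx : 0 < x := by linarith
  set d := ‖s - y * I‖ with hd
  have hE : 0 < 1 / 2 + t - y := by linarith
  have hd0 : 0 < d := by linarith
  have n1 : ‖((x : ℂ) - 2 * y) / (s - y * I) ^ 2‖ ≤ x * (1 / d ^ 2) := by
    rw [norm_div, norm_pow, ← hd, mul_one_div]
    gcongr
    rw [show (x : ℂ) - 2 * y = ((x - 2 * y : ℝ) : ℂ) by push_cast; ring, Complex.norm_real,
      Real.norm_eq_abs, abs_le]
    constructor <;> linarith
  have n2 : ‖2 * I * ((x : ℂ) - y) * y / (s - y * I) ^ 3‖ ≤ 2 * x * (1 / d ^ 2) := by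
    rw [norm_div, norm_pow, ← hd, norm_mul, norm_mul, norm_mul, norm_I, ← ofReal_sub,
      Complex.norm_real, Complex.norm_real, Real.norm_of_nonneg hy.le,
      Real.norm_of_nonneg (by linarith), Complex.norm_ofNat, mul_one_div,
      div_le_div_iff₀ (by positivity) (by positivity)]
    have : (x - y) * y ≤ x * d := by nlinarith
    calc _ = 2 * d ^ 2 * ((x - y) * y) := by ring
      _ ≤ 2 * d ^ 2 * (x * d) := by gcongr
      _ = _ := by ring
  have n3 : ‖2 * (y : ℂ) * (s - x * I) / (s - y * I) ^ 3‖ ≤ 2 * x * (1 / d ^ 2) := by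
    rw [norm_div, norm_pow, ← hd, norm_mul, norm_mul,
      Complex.norm_real, Real.norm_of_nonneg hy.le,
      Complex.norm_ofNat, mul_one_div,
      div_le_div_iff₀ (by positivity) (by positivity)]
    calc 2 * y * ‖s - x * I‖ * d ^ 2 ≤ 2 * x * d * d ^ 2 := by gcongr
      _ = _ := by ring
  have n4 : ‖3 * I * (y : ℂ) ^ 2 * (s - x * I) / (s - y * I) ^ 4‖ ≤ 3 * x ^ 2 * (1 / d ^ 3) := by
    rw [norm_div, norm_pow, ← hd, norm_mul, norm_mul, norm_mul, norm_I, norm_pow,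
      Complex.norm_real, Real.norm_of_nonneg hy.le,
      Complex.norm_ofNat, mul_one_div, mul_one,
      div_le_div_iff₀ (by positivity) (by positivity)]
    calc 3 * y ^ 2 * ‖s - x * I‖ * d ^ 3 ≤ 3 * x ^ 2 * d * d ^ 3 := by gcongr
      _ = _ := by ring
  have b2 : 1 / d ^ 2 ≤ 4 * (1 / (1 / 2 + t - y) ^ 2) := by
    rw [mul_one_div, div_le_div_iff₀ (by positivity) (by positivity)]
    have := pow_le_pow_left₀ hE.le (show 1 / 2 + t - y ≤ 2 * d by linarith) 2
    nlinarith
  have b3 : 1 / d ^ 3 ≤ 8 * (1 / (1 / 2 + t - y) ^ 3) := by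
    rw [mul_one_div, div_le_div_iff₀ (by positivity) (by positivity)]
    have := pow_le_pow_left₀ hE.le (show 1 / 2 + t - y ≤ 2 * d by linarith) 3
    nlinarith
  calc _ ≤ x * (1 / d ^ 2) + 2 * x * (1 / d ^ 2) + 2 * x * (1 / d ^ 2) + 3 * x ^ 2 * (1 / d ^ 3) :=
        (norm_sub_le _ _).trans (add_le_add ((norm_sub_le _ _).trans (add_le_add
          ((norm_add_le _ _).trans (add_le_add n1 n2)) n3)) n4)
    _ = 5 * x * (1 / d ^ 2) + 3 * x ^ 2 * (1 / d ^ 3) := by ring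
    _ ≤ 5 * x * (4 * (1 / (1 / 2 + t - y) ^ 2)) + 3 * x ^ 2 * (8 * (1 / (1 / 2 + t - y) ^ 3)) := by
        gcongr
    _ = _ := by ring

lemma norm_oscPrim_sub_le_twice (hs : 1 / 2 ≤ s.re) (hs1 : s.re < 1) (hx : 0 < x)
    (hxt : x ≤ s.im) (ht1 : 1 ≤ s.im) :
    ‖oscPrim s x - oscMain s x‖ ≤
      (700 / (1 - s.re)) * x ^ (-s.re) * (s.im / (1 / 2 + s.im - x)) ^ 2 := by
  have hs0 : 0 < s.re := by linarith
  have hr : 0 < 1 - s.re := by linarith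
  set t := s.im with ht
  have hxr : 0 < x ^ (-s.re) := Real.rpow_pos_of_pos hx _
  set W : ℝ → ℂ := fun y => (((x : ℂ) - y) / (s - y * I) - y * (s - x * I) / (s - y * I) ^ 2) *
        (y / (s - y * I)) * (exp (y * I) * (y : ℂ) ^ (-s)) with hW
  have hW0 : Tendsto W (nhdsWithin 0 (Set.Ioi 0)) (nhds 0) := by
    have h3 : Tendsto (fun y : ℝ => ‖(((x : ℂ) - y) / (s - y * I) -
        y * (s - x * I) / (s - y * I) ^ 2) / (s - y * I)‖ * y ^ (1 - s.re))
        (nhdsWithin 0 (Set.Ioi 0)) (nhds (‖(((x : ℂ) - (0 : ℝ)) / (s - (0 : ℝ) * I) -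
        (0 : ℝ) * (s - x * I) / (s - (0 : ℝ) * I) ^ 2) / (s - (0 : ℝ) * I)‖ * 0)) := by
      have h0 : s - (0 : ℝ) * I ≠ 0 := sub_mul_I_ne_zero hs0 0
      refine Tendsto.mul (ContinuousAt.tendsto ?_ |>.mono_left nhdsWithin_le_nhds) ?_
      · refine ContinuousAt.norm (ContinuousAt.div (ContinuousAt.sub (ContinuousAt.div
          (by fun_prop) (by fun_prop) h0) (ContinuousAt.div (by fun_prop) (by fun_prop)
          (pow_ne_zero 2 h0))) (by fun_prop) h0)
      · have := (Real.continuousAt_rpow_const 0 (1 - s.re) (Or.inr (by linarith))).tendsto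
        rw [Real.zero_rpow (by linarith)] at this
        exact this.mono_left nhdsWithin_le_nhds
    rw [mul_zero] at h3
    refine squeeze_zero_norm' ?_ h3
    filter_upwards [self_mem_nhdsWithin] with y hy
    have hy : 0 < y := hy
    rw [hW, norm_mul, norm_osc hy, norm_mul, norm_div (y : ℂ), norm_div _ (s - y * I),
      Complex.norm_real, Real.norm_of_nonneg hy.le, Real.rpow_sub hy, Real.rpow_one,
      Real.rpow_neg hy.le]
    refine le_of_eq ?_
    ring
  have key := norm_sub_le_of_tendsto_zero (x := x) (f := fun y => oscParts s x y + W y)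
    (B := fun y => 20 * x * (4 / t ^ 2 * (y ^ (1 - s.re) / (1 - s.re)) +
        2 * x ^ (-s.re) * (1 / (1 / 2 + t - y))) +
        24 * x ^ 2 * (8 / t ^ 3 * (y ^ (1 - s.re) / (1 - s.re)) +
        2 * x ^ (-s.re) * (1 / (2 * (1 / 2 + t - y) ^ 2))))
    (B' := fun y => 20 * x * (4 / t ^ 2 * y ^ (-s.re) +
        2 * x ^ (-s.re) * (1 / (1 / 2 + t - y) ^ 2)) +
        24 * x ^ 2 * (8 / t ^ 3 * y ^ (-s.re) +
        2 * x ^ (-s.re) * (1 / (1 / 2 + t - y) ^ 3)))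
    (l := oscMain s x) hx
    (fun y hy => hasDerivAt_oscParts_two hs0 hy.1)
    (fun y hy => ?_) ?_ ?_ (by simpa using (tendsto_oscParts hs0 hs1 x).add hW0)
  · have e1 : oscParts s x x = oscPrim s x := by simp [oscParts]
    have e2 : ‖W x‖ ≤ 4 * (x ^ (-s.re) * (x / (1 / 2 + t - x)) ^ 2) := by
      obtain ⟨h1, -, -⟩ := norm_sub_mul_I_bounds hs hs1 hxt
      rw [← ht] at h1
      have hE : 0 < 1 / 2 + t - x := by linarith
      have h0 := sub_mul_I_ne_zero hs0 x
      have hd : 0 < ‖s - x * I‖ := by linarith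
      have e3 : W x = -(x / (s - x * I)) ^ 2 * (exp (x * I) * (x : ℂ) ^ (-s)) := by
        simp only [hW]
        field_simp
        ring
      rw [e3, norm_mul, norm_osc hx, norm_neg, norm_pow, norm_div, Complex.norm_real,
        Real.norm_of_nonneg hx.le]
      have : x / ‖s - x * I‖ ≤ 2 * (x / (1 / 2 + t - x)) := by
        rw [← mul_div_assoc, div_le_div_iff₀ hd hE]; nlinarith
      have := pow_le_pow_left₀ (by positivity) this 2
      nlinarith
    simp only [e1] at key
    have e3 : oscPrim s x - oscMain s x = (oscPrim s x + W x - oscMain s x) - W x := by ring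
    rw [e3]
    refine (norm_sub_le _ _).trans ((add_le_add key e2).trans ?_)
    have hE : 0 < 1 / 2 + t - x := by linarith
    set E := 1 / 2 + t - x with hEd
    have hE1 : E ≤ 3 / 2 * t := by linarith
    have hu : 2 / 3 ≤ t / E := by rw [le_div_iff₀ hE]; linarith
    have hxE : x / E ≤ t / E := by gcongr
    have hxE0 : 0 ≤ x / E := by positivity
    have hxt1 : x / t ≤ 1 := (div_le_one (by linarith)).2 hxt
    have hxt0 : 0 ≤ x / t := by positivity
    have hsplit : x ^ (1 - s.re) = x * x ^ (-s.re) := by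
      rw [sub_eq_add_neg, Real.rpow_add hx, Real.rpow_one]
    have hp2 : (x / t) ^ 2 ≤ 1 := pow_le_one₀ hxt0 hxt1
    have hp3 : (x / t) ^ 3 ≤ 1 := pow_le_one₀ hxt0 hxt1
    have hr1 : 1 ≤ 1 / (1 - s.re) := by rw [le_div_iff₀ hr]; linarith
    have hu2 : 1 ≤ 9 / 4 * (t / E) ^ 2 := by nlinarith
    have hxu : x / E ≤ 3 / 2 * (t / E) ^ 2 := by nlinarith
    have hxu2 : (x / E) ^ 2 ≤ (t / E) ^ 2 := pow_le_pow_left₀ hxE0 hxE 2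
    rw [hsplit]
    calc _ = x ^ (-s.re) * (1 / (1 - s.re) * (80 * (x / t) ^ 2 + 192 * (x / t) ^ 3)
            + 40 * (x / E) + 28 * (x / E) ^ 2) := by
          have : t ≠ 0 := by linarith
          field_simp
          ring
      _ ≤ x ^ (-s.re) * (1 / (1 - s.re) * (80 * 1 + 192 * 1)
            + 40 * (3 / 2 * (t / E) ^ 2) + 28 * (t / E) ^ 2) := by gcongr
      _ ≤ x ^ (-s.re) * (1 / (1 - s.re) * (272 * (9 / 4 * (t / E) ^ 2))
            + 1 / (1 - s.re) * (88 * (t / E) ^ 2)) := by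
          refine mul_le_mul_of_nonneg_left ?_ hxr.le
          have h5 : 0 ≤ (t / E) ^ 2 := by positivity
          have h6 : 88 * (t / E) ^ 2 ≤ 1 / (1 - s.re) * (88 * (t / E) ^ 2) := by nlinarith
          have h7 : 1 / (1 - s.re) * (272 * 1) ≤
              1 / (1 - s.re) * (272 * (9 / 4 * (t / E) ^ 2)) := by
            gcongr
          nlinarith
      _ = _ := by ring
  · exact ((((hasDerivAt_rpow_primitive hs1.ne hy.1).const_mul _).add
      ((hasDerivAt_inv_sub (by linarith [hy.2])).const_mul _)).const_mul _).add
      ((((hasDerivAt_rpow_primitive hs1.ne hy.1).const_mul _).add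
      ((hasDerivAt_inv_sub_sq (by linarith [hy.2])).const_mul _)).const_mul _)
  · intro y hy
    rw [norm_mul, norm_osc hy.1]
    have h1 := norm_deriv_weight_two_le hs hs1 hy.1 hy.2 hxt
    rw [← ht] at h1
    have hyr : 0 < y ^ (-s.re) := Real.rpow_pos_of_pos hy.1 _
    have hE : 0 < 1 / 2 + t - y := by linarith [hy.2]
    have hyx : y / x * y ^ (-s.re) ≤ x ^ (-s.re) := by
      rw [div_mul_eq_mul_div, div_le_iff₀ hx, mul_comm y, mul_comm _ x, mul_comm _ y,
        ← Real.rpow_one_add' hy.1.le (by linarith), ← Real.rpow_one_add' hx.le (by linarith)]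
      exact Real.rpow_le_rpow hy.1.le hy.2 (by linarith)
    have h2 := inv_pow_le 2 hx hxt hy.1 hy.2 (rfl : 1 / 2 + t - y = _)
    have h3 := inv_pow_le 3 hx hxt hy.1 hy.2 (rfl : 1 / 2 + t - y = _)
    calc _ ≤ (20 * x * ((2 / t) ^ 2 + 2 * y / x * (1 / (1 / 2 + t - y) ^ 2)) +
          24 * x ^ 2 * ((2 / t) ^ 3 + 2 * y / x * (1 / (1 / 2 + t - y) ^ 3))) * y ^ (-s.re) := by
          refine mul_le_mul_of_nonneg_right (h1.trans ?_) hyr.le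
          gcongr
      _ = 20 * x * (4 / t ^ 2 * y ^ (-s.re) +
            2 * (y / x * y ^ (-s.re)) * (1 / (1 / 2 + t - y) ^ 2)) +
          24 * x ^ 2 * (8 / t ^ 3 * y ^ (-s.re) +
            2 * (y / x * y ^ (-s.re)) * (1 / (1 / 2 + t - y) ^ 3)) := by ring
      _ ≤ _ := by gcongr
  · intro y hy
    have hE : 0 < 1 / 2 + t - y := by linarith [hy.2]
    have := Real.rpow_nonneg hy.1.le (1 - s.re)
    positivity

lemma norm_oscPrim_le_of_im_le (hs : 0 ≤ s.re) (ht1 : 1 ≤ s.im) (hx : s.im ≤ x)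
    (hxt : x ≤ s.im + √s.im) :
    ‖oscPrim s x‖ ≤ 7 * s.im * x ^ (-s.re) := by
  set t := s.im with ht
  have ht0 : 0 < t := by linarith
  have hsq : √t ^ 2 = t := Real.sq_sqrt ht0.le
  have hsq0 : 0 < √t := Real.sqrt_pos.2 ht0
  have hsq1 : √t ≤ t := by rw [Real.sqrt_le_left ht0.le]; nlinarith
  have hx0 : 0 < x := by linarith
  have hxr : 0 < x ^ (-s.re) := Real.rpow_pos_of_pos hx0 _
  set z := t + √t with hz
  have hz0 : 0 < z := by positivity
  have hm : max s.im 0 = t := max_eq_left ht0.le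
  have hzr : z ^ (-s.re) ≤ x ^ (-s.re) := Real.rpow_le_rpow_of_nonpos hx0 hxt (by linarith)
  have hb1 := norm_oscPrim_le hs (x := z) (by rw [hm]; linarith)
  have hb2 := norm_oscPrimDeriv_le hs (x := z) (by rw [hm]; linarith)
  rw [hm, show z - t = √t by rw [hz]; ring] at hb1 hb2
  have hq : z / √t = √t + 1 := by
    rw [hz, div_eq_iff hsq0.ne']; nlinarith
  have hst1 : 1 ≤ √t := by rw [Real.one_le_sqrt]; exact ht1
  rw [hq] at hb1 hb2
  have key := norm_sub_le_of_hasDerivAt (f := fun y => oscPrim s y + (x - y) * oscPrimDeriv s y)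
    (f' := fun y => ((x : ℂ) - y) * (exp (y * I) * (y : ℂ) ^ (-s)))
    (B := fun y => (√t * x ^ (-s.re)) * y) (B' := fun y => √t * x ^ (-s.re)) hxt ?_ ?_ ?_
  · simp only [sub_self, zero_mul, add_zero] at key
    have e : oscPrim s x = oscPrim s z + (x - z) * oscPrimDeriv s z -
        (oscPrim s z + (x - z) * oscPrimDeriv s z - oscPrim s x) := by ring
    rw [e]
    have h3 : ‖((x : ℂ) - z) * oscPrimDeriv s z‖ ≤ √t * (x ^ (-s.re) * (√t + 1)) := by
      rw [norm_mul, ← ofReal_sub, Complex.norm_real, Real.norm_eq_abs,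
        abs_of_nonpos (by linarith)]
      gcongr
      · linarith
      · exact hb2.trans (by gcongr)
    have h4 : ‖oscPrim s z‖ ≤ x ^ (-s.re) * (√t + 1) ^ 2 := hb1.trans (by gcongr)
    have h5 : √t * x ^ (-s.re) * z - √t * x ^ (-s.re) * x ≤ √t * x ^ (-s.re) * √t := by
      rw [← mul_sub]
      gcongr
      linarith
    calc _ ≤ x ^ (-s.re) * (√t + 1) ^ 2 + √t * (x ^ (-s.re) * (√t + 1)) +
        √t * x ^ (-s.re) * √t :=
          (norm_sub_le _ _).trans (add_le_add ((norm_add_le _ _).trans (add_le_add h4 h3))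
            (key.trans h5))
      _ = x ^ (-s.re) * (3 * √t ^ 2 + 3 * √t + 1) := by ring
      _ ≤ x ^ (-s.re) * (7 * t) := by gcongr; rw [hsq]; linarith
      _ = _ := by ring
  · intro y hy
    have hy0 : 0 < y := hx0.trans_le hy.1
    have hl : HasDerivAt (fun y : ℝ => (x : ℂ) - y) (-1) y := by
      simpa using ((hasDerivAt_id (y : ℂ)).const_sub (x : ℂ)).comp_ofReal
    refine ((hasDerivAt_oscPrim hs hy0).add
      (hl.mul (hasDerivAt_oscPrimDeriv hs hy0))).congr_deriv ?_
    ring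
  · intro y hy
    simpa using (hasDerivAt_id y).const_mul (√t * x ^ (-s.re))
  · intro y hy
    have hy0 : 0 < y := hx0.trans_le hy.1
    rw [norm_mul, norm_osc hy0, ← ofReal_sub, Complex.norm_real, Real.norm_eq_abs,
      abs_of_nonpos (by linarith [hy.1])]
    exact mul_le_mul (by linarith [hy.2])
      (Real.rpow_le_rpow_of_nonpos hx0 hy.1 (by linarith)) (by positivity) hsq0.le

/-- The stationary contribution, present to the left of the stationary point `Im s`. -/
noncomputable def oscStat (s : ℂ) (x : ℝ) : ℂ := if x < s.im then oscMain s x else 0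

lemma norm_oscPrim_sub_oscStat_le (hs : 1 / 2 ≤ s.re) (hs1 : s.re < 1) (ht1 : 1 ≤ s.im)
    (hx : 0 < x) :
    ‖oscPrim s x - oscStat s x‖ ≤
      (1500 / (1 - s.re)) * x ^ (-s.re) * ((x + s.im) ^ 2 / (s.im + (x - s.im) ^ 2)) := by
  have hr : 0 < 1 - s.re := by linarith
  have hr1 : 1 ≤ 1 / (1 - s.re) := by rw [le_div_iff₀ hr]; linarith
  have hxr : 0 < x ^ (-s.re) := Real.rpow_pos_of_pos hx _
  set t := s.im with ht
  have ht0 : 0 < t := by linarith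
  have hsq : √t ^ 2 = t := Real.sq_sqrt ht0.le
  have hsq0 : 0 < √t := Real.sqrt_pos.2 ht0
  have hsuff : ∀ A : ℝ, ‖oscPrim s x - oscStat s x‖ ≤ 1 / (1 - s.re) * x ^ (-s.re) * A →
      A ≤ 1500 * ((x + t) ^ 2 / (t + (x - t) ^ 2)) → ‖oscPrim s x - oscStat s x‖ ≤
      (1500 / (1 - s.re)) * x ^ (-s.re) * ((x + t) ^ 2 / (t + (x - t) ^ 2)) := by
    intro A h1 h2
    refine h1.trans ?_
    calc _ ≤ 1 / (1 - s.re) * x ^ (-s.re) * (1500 * ((x + t) ^ 2 / (t + (x - t) ^ 2))) := by gcongr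
      _ = _ := by ring
  have hden : 0 < t + (x - t) ^ 2 := by positivity
  rcases lt_or_ge x t with h | h
  · have hst : oscStat s x = oscMain s x := if_pos h
    rw [hst] at hsuff ⊢
    rcases le_or_gt ((x - t) ^ 2) t with h' | h'
    · refine hsuff (9 * x) ((norm_oscPrim_sub_le_once hs hs1 hx h.le).trans ?_) ?_
      · rw [sub_eq_add_neg 1 s.re, Real.rpow_add hx, Real.rpow_one, ← sub_eq_add_neg]
        have : 0 < x * x ^ (-s.re) := by positivity
        nlinarith
      · rw [← mul_div_assoc, le_div_iff₀ hden]
        nlinarith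
    · refine hsuff (700 * (t / (1 / 2 + t - x)) ^ 2)
        ((norm_oscPrim_sub_le_twice hs hs1 hx h.le ht1).trans (le_of_eq (by ring))) ?_
      rw [div_pow, ← mul_div_assoc, ← mul_div_assoc, div_le_div_iff₀ (by
        have : 0 < 1 / 2 + t - x := by linarith
        positivity) hden]
      have h5 : t + (x - t) ^ 2 ≤ 2 * (1 / 2 + t - x) ^ 2 := by nlinarith
      have h6 : t ^ 2 ≤ (x + t) ^ 2 := by nlinarith
      calc 700 * t ^ 2 * (t + (x - t) ^ 2) ≤ 700 * (x + t) ^ 2 * (2 * (1 / 2 + t - x) ^ 2) := by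
            gcongr
        _ ≤ _ := by nlinarith [sq_nonneg ((x + t) * (1 / 2 + t - x))]
  · have hst : oscStat s x = 0 := if_neg h.not_gt
    rw [hst, sub_zero] at hsuff ⊢
    rcases le_or_gt x (t + √t) with h' | h'
    · refine hsuff (7 * t) ((norm_oscPrim_le_of_im_le (by linarith) ht1 h h').trans ?_) ?_
      · rw [← ht]
        have : 0 < t * x ^ (-s.re) := by positivity
        nlinarith
      · rw [← mul_div_assoc, le_div_iff₀ hden]
        have : (x - t) ^ 2 ≤ √t ^ 2 := pow_le_pow_left₀ (by linarith) (by linarith) 2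
        nlinarith
    · have hm : max s.im 0 = t := max_eq_left ht0.le
      refine hsuff ((x / (x - t)) ^ 2) ((norm_oscPrim_le (by linarith) (x := x)
        (by rw [hm]; linarith)).trans ?_) ?_
      · rw [hm]
        have : 0 ≤ x ^ (-s.re) * (x / (x - t)) ^ 2 := by positivity
        nlinarith
      · have : √t ^ 2 ≤ (x - t) ^ 2 := pow_le_pow_left₀ hsq0.le (by linarith) 2
        have hxt : 0 < x - t := by linarith
        rw [div_pow, ← mul_div_assoc, div_le_div_iff₀ (by positivity) hden]
        calc x ^ 2 * (t + (x - t) ^ 2) ≤ (x + t) ^ 2 * (2 * (x - t) ^ 2) := by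
              gcongr
              · linarith
              · linarith
          _ ≤ _ := by nlinarith [sq_nonneg ((x + t) * (x - t))]

end remainder

section lerch

variable {a lam : ℝ} {s : ℂ}

/-- The general term of the Lerch zeta function. -/
noncomputable def lerchTerm (a lam : ℝ) (s : ℂ) (m : ℕ) : ℂ :=
  exp (2 * Real.pi * I * lam * m) * ((m : ℂ) + a) ^ (-s)

lemma norm_exp_two_pi_mul (x : ℝ) : ‖exp (2 * Real.pi * I * x)‖ = 1 := by
  rw [show 2 * (Real.pi : ℂ) * I * x = ((2 * Real.pi * x : ℝ) : ℂ) * I by push_cast; ring]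
  exact norm_exp_ofReal_mul_I _

lemma norm_lerchTerm (ha : 0 < a) (m : ℕ) : ‖lerchTerm a lam s m‖ = (m + a) ^ (-s.re) := by
  have h : 0 < (m : ℝ) + a := by positivity
  rw [lerchTerm, norm_mul, show 2 * (Real.pi : ℂ) * I * lam * m =
    2 * Real.pi * I * ((lam * m : ℝ) : ℂ) by push_cast; ring, norm_exp_two_pi_mul, one_mul,
    show (m : ℂ) + a = ((m + a : ℝ) : ℂ) by push_cast; ring, norm_cpow_eq_rpow_re_of_pos h, neg_re]

lemma norm_cpow_sub_cpow_le (hs : 0 < s.re) {x : ℝ} (hx : 0 < x) :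
    ‖(x : ℂ) ^ (-s) - ((x + 1 : ℝ) : ℂ) ^ (-s)‖ ≤ ‖s‖ * x ^ (-s.re - 1) := by
  have := norm_sub_le_of_hasDerivAt (f := fun y : ℝ => (y : ℂ) ^ (-s))
    (f' := fun y : ℝ => -s * (y : ℂ) ^ (-s - 1)) (B := fun y => (‖s‖ * x ^ (-s.re - 1)) * y)
    (B' := fun _ => ‖s‖ * x ^ (-s.re - 1)) (a := x) (b := x + 1) (by linarith) ?_ ?_ ?_
  · rw [norm_sub_rev]
    simpa [mul_add] using this
  · intro y hy
    have hy0 : 0 < y := hx.trans_le hy.1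
    have := ((hasDerivAt_id (y : ℂ)).cpow_const (c := -s) (Or.inl (by simpa))).comp_ofReal
    simpa using this
  · intro y _
    simpa using (hasDerivAt_id y).const_mul (‖s‖ * x ^ (-s.re - 1))
  · intro y hy
    have hy0 : 0 < y := hx.trans_le hy.1
    rw [norm_mul, norm_neg, norm_cpow_eq_rpow_re_of_pos hy0]
    gcongr
    simp only [sub_re, neg_re, one_re]
    exact Real.rpow_le_rpow_of_nonpos hx hy.1 (by linarith)

/-- The differences produced by summation by parts. -/
noncomputable def lerchDiff (a lam : ℝ) (s : ℂ) (m : ℕ) : ℂ :=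
  exp (2 * Real.pi * I * lam * (m + 1)) * (((m : ℂ) + a) ^ (-s) - ((m : ℂ) + a + 1) ^ (-s))

lemma norm_lerchDiff_le (ha : 0 < a) (hs : 0 < s.re) (m : ℕ) :
    ‖lerchDiff a lam s m‖ ≤ ‖s‖ * (m + a) ^ (-s.re - 1) := by
  have h : 0 < (m : ℝ) + a := by positivity
  rw [lerchDiff, norm_mul, show 2 * (Real.pi : ℂ) * I * lam * (m + 1) =
    2 * Real.pi * I * ((lam * (m + 1) : ℝ) : ℂ) by push_cast; ring, norm_exp_two_pi_mul, one_mul]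
  simpa using norm_cpow_sub_cpow_le hs h

lemma summable_add_rpow (ha : 0 < a) {p : ℝ} (hp : p < -1) :
    Summable fun m : ℕ => ((m : ℝ) + a) ^ p := by
  have h := (Real.summable_one_div_nat_add_rpow a (-p)).2 (by linarith)
  refine h.congr fun m => ?_
  have : 0 < (m : ℝ) + a := by positivity
  rw [abs_of_pos this, Real.rpow_neg this.le, one_div, inv_inv]

lemma summable_lerchDiff (ha : 0 < a) (hs : 0 < s.re) : Summable (lerchDiff a lam s) :=
  Summable.of_norm_bounded ((summable_add_rpow ha (by linarith)).mul_left ‖s‖)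
    (norm_lerchDiff_le ha hs)

lemma exp_sub_one_ne_zero (h0 : 0 < lam) (h1 : lam < 1) :
    exp (2 * Real.pi * I * lam) - 1 ≠ 0 := by
  intro h
  obtain ⟨n, hn⟩ := Complex.exp_eq_one_iff.1 (sub_eq_zero.1 h)
  have h2 : (2 * Real.pi * I : ℂ) ≠ 0 := Complex.two_pi_I_ne_zero
  have : (lam : ℂ) = n := by
    rw [mul_comm (n : ℂ)] at hn
    exact mul_left_cancel₀ h2 hn
  have h3 : lam = n := by exact_mod_cast this
  rw [h3] at h0 h1
  have h4 : (0 : ℤ) < n := by exact_mod_cast h0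
  have h5 : n < 1 := by exact_mod_cast h1
  omega

lemma sum_lerchTerm (N : ℕ) :
    (exp (2 * Real.pi * I * lam) - 1) * ∑ m ∈ range N, lerchTerm a lam s m =
      lerchTerm a lam s N - (a : ℂ) ^ (-s) + ∑ m ∈ range N, lerchDiff a lam s m := by
  induction N with
  | zero => simp [lerchTerm]
  | succ N ih =>
    rw [sum_range_succ, sum_range_succ, mul_add, ih]
    have h1 : exp (2 * Real.pi * I * lam * (N + 1)) =
        exp (2 * Real.pi * I * lam) * exp (2 * Real.pi * I * lam * N) := by
      rw [← exp_add]; congr 1; ring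
    simp only [lerchTerm, lerchDiff]
    push_cast
    rw [h1, show (N : ℂ) + 1 + a = N + a + 1 by ring]
    ring

lemma tendsto_lerchTerm (ha : 0 < a) (hs : 0 < s.re) :
    Tendsto (lerchTerm a lam s) atTop (nhds 0) := by
  rw [tendsto_zero_iff_norm_tendsto_zero]
  simp only [norm_lerchTerm ha]
  exact (tendsto_rpow_neg_atTop hs).comp
    (tendsto_atTop_add_const_right _ _ tendsto_natCast_atTop_atTop)

lemma tendsto_zetaL_aux (ha : 0 < a) (h0 : 0 < lam) (h1 : lam < 1) (hs : 0 < s.re) :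
    Tendsto (fun N => ∑ m ∈ range N, lerchTerm a lam s m) atTop
      (nhds ((-(a : ℂ) ^ (-s) + ∑' m, lerchDiff a lam s m) /
        (exp (2 * Real.pi * I * lam) - 1))) := by
  have hne := exp_sub_one_ne_zero h0 h1
  have h := ((((tendsto_lerchTerm (lam := lam) ha hs).sub_const ((a : ℂ) ^ (-s))).add
    (summable_lerchDiff (lam := lam) ha hs).hasSum.tendsto_sum_nat)).div_const
    (exp (2 * Real.pi * I * lam) - 1)
  rw [zero_sub] at h
  refine h.congr fun N => ?_
  rw [← sum_lerchTerm, mul_div_cancel_left₀ _ hne]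

lemma zetaL_eq (ha : 0 < a) (h0 : 0 < lam) (h1 : lam < 1) (hs : 0 < s.re) :
    zetaL a lam s = (-(a : ℂ) ^ (-s) + ∑' m, lerchDiff a lam s m) /
        (exp (2 * Real.pi * I * lam) - 1) :=
  (tendsto_zetaL_aux ha h0 h1 hs).limUnder_eq

lemma tendsto_zetaL (ha : 0 < a) (h0 : 0 < lam) (h1 : lam < 1) (hs : 0 < s.re) :
    Tendsto (fun N => ∑ m ∈ range N, lerchTerm a lam s m) atTop (nhds (zetaL a lam s)) := by
  rw [zetaL_eq ha h0 h1 hs]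
  exact tendsto_zetaL_aux ha h0 h1 hs

lemma continuous_zetaL (ha : 0 < a) (h0 : 0 < lam) (h1 : lam < 1) {σ : ℝ} (hσ : 0 < σ) :
    Continuous fun t : ℝ => zetaL a lam (σ + t * I) := by
  have hre : ∀ t : ℝ, ((σ : ℂ) + t * I).re = σ := fun t => by simp
  have e : (fun t : ℝ => zetaL a lam (σ + t * I)) = fun t : ℝ =>
      (-(a : ℂ) ^ (-((σ : ℂ) + t * I)) + ∑' m, lerchDiff a lam (σ + t * I) m) /
        (exp (2 * Real.pi * I * lam) - 1) := by
    funext t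
    exact zetaL_eq ha h0 h1 (by rw [hre]; exact hσ)
  rw [e]
  have hc : ∀ b : ℂ, b ≠ 0 → Continuous fun t : ℝ => b ^ (-((σ : ℂ) + t * I)) := by
    intro b hb
    exact Continuous.const_cpow (by fun_prop) (Or.inl hb)
  refine Continuous.div_const (Continuous.add (hc _ (ofReal_ne_zero.2 ha.ne')).neg ?_) _
  rw [continuous_iff_continuousAt]
  intro t0
  have hco : ContinuousOn (fun t : ℝ => ∑' m, lerchDiff a lam (σ + t * I) m)
      (Metric.ball t0 1) := by
    refine continuousOn_tsum (u := fun m : ℕ => (σ + (|t0| + 1)) * ((m : ℝ) + a) ^ (-σ - 1)) ?_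
      ((summable_add_rpow ha (by linarith)).mul_left _) ?_
    · intro m
      have hm : (m : ℂ) + a ≠ 0 := by
        have : (0 : ℝ) < m + a := by positivity
        exact_mod_cast this.ne'
      have hm1 : (m : ℂ) + a + 1 ≠ 0 := by
        have : (0 : ℝ) < m + a + 1 := by positivity
        exact_mod_cast this.ne'
      exact (continuous_const.mul ((hc _ hm).sub (hc _ hm1))).continuousOn
    · intro m t ht
      have := norm_lerchDiff_le (a := a) (lam := lam) (s := σ + t * I) ha (by rwa [hre]) m
      rw [hre] at this
      refine this.trans ?_
      gcongr
      refine (norm_add_le _ _).trans ?_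
      rw [norm_mul, norm_I, Complex.norm_real, Complex.norm_real, Real.norm_of_nonneg hσ.le,
        Real.norm_eq_abs, mul_one]
      rw [Metric.mem_ball, Real.dist_eq] at ht
      have := abs_sub_abs_le_abs_sub t t0
      linarith
  exact hco.continuousAt (Metric.ball_mem_nhds _ one_pos)

end lerch

/-- The piecewise linear cutoff, equal to `1` up to `c` and to `0` from `2 * c` on. -/
noncomputable def cut (c x : ℝ) : ℝ := max 0 (min 1 (2 - x / c))

lemma continuous_cut (c : ℝ) : Continuous (cut c) := by unfold cut; fun_prop

lemma cut_nonneg (c x : ℝ) : 0 ≤ cut c x := le_max_left _ _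

lemma cut_le_one (c x : ℝ) : cut c x ≤ 1 := max_le zero_le_one (min_le_left _ _)

lemma cut_eq_one {c x : ℝ} (hc : 0 < c) (h : x ≤ c) : cut c x = 1 := by
  have : x / c ≤ 1 := (div_le_one hc).2 h
  rw [cut, min_eq_left (by linarith), max_eq_right zero_le_one]

lemma cut_eq_zero {c x : ℝ} (hc : 0 < c) (h : 2 * c ≤ x) : cut c x = 0 := by
  have : 2 ≤ x / c := by rwa [le_div_iff₀ hc]
  rw [cut, max_eq_left]
  exact (min_le_right _ _).trans (by linarith)

lemma cut_eq_sub {c x : ℝ} (hc : 0 < c) (h : c ≤ x) (h2 : x ≤ 2 * c) : cut c x = 2 - x / c := by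
  have h3 : 1 ≤ x / c := by rwa [le_div_iff₀ hc, one_mul]
  have h4 : x / c ≤ 2 := by rwa [div_le_iff₀ hc]
  rw [cut, min_eq_right (by linarith), max_eq_right (by linarith)]

section phase

variable {s : ℂ} {ν x : ℝ}

/-- The second primitive of `e^{2πiνx} x⁻ˢ` for `ν > 0`. -/
noncomputable def posPrim (s : ℂ) (ν x : ℝ) : ℂ :=
  ((2 * Real.pi * ν : ℝ) : ℂ) ^ (s - 2) * oscPrim s (2 * Real.pi * ν * x)

/-- The derivative of `posPrim`. -/
noncomputable def posPrimDeriv (s : ℂ) (ν x : ℝ) : ℂ :=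
  ((2 * Real.pi * ν : ℝ) : ℂ) ^ (s - 1) * oscPrimDeriv s (2 * Real.pi * ν * x)

lemma hasDerivAt_posPrim (hs : 0 ≤ s.re) (hν : 0 < ν) (hx : 0 < x) :
    HasDerivAt (posPrim s ν) (posPrimDeriv s ν x) x := by
  have hp : 0 < 2 * Real.pi * ν := by positivity
  have hp0 : ((2 * Real.pi * ν : ℝ) : ℂ) ≠ 0 := ofReal_ne_zero.2 hp.ne'
  have h := ((hasDerivAt_oscPrim hs (x := 2 * Real.pi * ν * x) (by positivity)).scomp x
    ((hasDerivAt_id x).const_mul (2 * Real.pi * ν))).const_mul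
    (((2 * Real.pi * ν : ℝ) : ℂ) ^ (s - 2))
  refine h.congr_deriv ?_
  rw [posPrimDeriv, show s - 1 = s - 2 + 1 by ring, cpow_add _ _ hp0, cpow_one, mul_one, real_smul]
  ring

lemma hasDerivAt_posPrimDeriv (hs : 0 ≤ s.re) (hν : 0 < ν) (hx : 0 < x) :
    HasDerivAt (posPrimDeriv s ν) (exp (2 * Real.pi * I * ν * x) * (x : ℂ) ^ (-s)) x := by
  have hp : 0 < 2 * Real.pi * ν := by positivity
  have hp0 : ((2 * Real.pi * ν : ℝ) : ℂ) ≠ 0 := ofReal_ne_zero.2 hp.ne'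
  have h := ((hasDerivAt_oscPrimDeriv hs (x := 2 * Real.pi * ν * x) (by positivity)).scomp x
    ((hasDerivAt_id x).const_mul (2 * Real.pi * ν))).const_mul
    (((2 * Real.pi * ν : ℝ) : ℂ) ^ (s - 1))
  refine h.congr_deriv ?_
  rw [mul_one, real_smul, ofReal_mul (2 * Real.pi * ν) x, mul_cpow_ofReal_nonneg hp.le hx.le,
    cpow_neg _ s, cpow_sub _ _ hp0, cpow_one,
    show ((2 * Real.pi * ν : ℝ) : ℂ) * (x : ℂ) * I = 2 * Real.pi * I * ν * x by push_cast; ring]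
  have : ((2 * Real.pi * ν : ℝ) : ℂ) ^ s ≠ 0 := fun h0 => hp0 ((cpow_eq_zero_iff _ _).1 h0).1
  field_simp

/-- The second primitive of `e^{2πiνx} x⁻ˢ` for `ν ≠ 0`. -/
noncomputable def phasePrim (s : ℂ) (ν x : ℝ) : ℂ :=
  if 0 < ν then posPrim s ν x else (starRingEnd ℂ) (posPrim ((starRingEnd ℂ) s) (-ν) x)

/-- The derivative of `phasePrim`. -/
noncomputable def phasePrimDeriv (s : ℂ) (ν x : ℝ) : ℂ :=
  if 0 < ν then posPrimDeriv s ν x else (starRingEnd ℂ) (posPrimDeriv ((starRingEnd ℂ) s) (-ν) x)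

lemma hasDerivAt_phasePrim (hs : 0 ≤ s.re) (hν : ν ≠ 0) (hx : 0 < x) :
    HasDerivAt (phasePrim s ν) (phasePrimDeriv s ν x) x := by
  rcases lt_or_gt_of_ne hν with h | h
  · have e : phasePrim s ν = fun x => (starRingEnd ℂ) (posPrim ((starRingEnd ℂ) s) (-ν) x) := by
      funext x; simp [phasePrim, h.not_gt]
    rw [e, phasePrimDeriv, if_neg h.not_gt]
    exact (hasDerivAt_posPrim (s := (starRingEnd ℂ) s) (by simpa) (by linarith) hx).star
  · have e : phasePrim s ν = posPrim s ν := by funext x; simp [phasePrim, h]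
    rw [e, phasePrimDeriv, if_pos h]
    exact hasDerivAt_posPrim hs h hx

lemma hasDerivAt_phasePrimDeriv (hs : 0 ≤ s.re) (hν : ν ≠ 0) (hx : 0 < x) :
    HasDerivAt (phasePrimDeriv s ν) (exp (2 * Real.pi * I * ν * x) * (x : ℂ) ^ (-s)) x := by
  rcases lt_or_gt_of_ne hν with h | h
  · have e : phasePrimDeriv s ν =
        fun x => (starRingEnd ℂ) (posPrimDeriv ((starRingEnd ℂ) s) (-ν) x) := by
      funext x; simp [phasePrimDeriv, h.not_gt]
    rw [e]
    refine (hasDerivAt_posPrimDeriv (s := (starRingEnd ℂ) s) (by simpa) (ν := -ν)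
      (by linarith) hx).star.congr_deriv ?_
    have harg : arg (x : ℂ) ≠ Real.pi := by
      rw [arg_ofReal_of_nonneg hx.le]; exact Real.pi_pos.ne
    rw [star_def, map_mul, ← exp_conj, ← map_neg, cpow_conj _ _ harg, conj_conj, conj_ofReal]
    simp [map_ofNat]
  · have e : phasePrimDeriv s ν = posPrimDeriv s ν := by funext x; simp [phasePrimDeriv, h]
    rw [e]
    exact hasDerivAt_posPrimDeriv hs h hx

lemma continuousOn_phase : ContinuousOn
    (fun x : ℝ => exp (2 * Real.pi * I * ν * x) * (x : ℂ) ^ (-s)) (Set.Ioi 0) := by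
  refine ContinuousOn.mul (by fun_prop) (ContinuousOn.cpow_const (by fun_prop) ?_)
  intro r hr
  have hr' : (0 : ℝ) < r := hr
  exact Or.inl (by simpa using hr')

lemma integral_affine_mul_phase (hs : 0 ≤ s.re) (hν : ν ≠ 0) {p q : ℝ} (hp : 0 < p) (hq : 0 < q)
    (α β : ℝ) :
    ∫ x in p..q, ((α + β * x : ℝ) : ℂ) * (exp (2 * Real.pi * I * ν * x) * (x : ℂ) ^ (-s)) =
      ((α + β * q : ℝ) * phasePrimDeriv s ν q - β * phasePrim s ν q) -
      ((α + β * p : ℝ) * phasePrimDeriv s ν p - β * phasePrim s ν p) := by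
  have hsub : Set.uIcc p q ⊆ Set.Ioi 0 := fun x hx => (lt_min hp hq).trans_le hx.1
  refine intervalIntegral.integral_eq_sub_of_hasDerivAt
    (f := fun x : ℝ => ((α + β * x : ℝ) : ℂ) * phasePrimDeriv s ν x - β * phasePrim s ν x)
    (fun x hx => ?_) ?_
  · have hl : HasDerivAt (fun x : ℝ => ((α + β * x : ℝ) : ℂ)) β x := by
      have : HasDerivAt (fun x : ℝ => α + β * x) β x := by
        simpa using ((hasDerivAt_id x).const_mul β).const_add α
      exact this.ofReal_comp
    refine ((hl.mul (hasDerivAt_phasePrimDeriv hs hν (hsub hx))).sub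
      ((hasDerivAt_phasePrim hs hν (hsub hx)).const_mul (β : ℂ))).congr_deriv ?_
    ring
  · exact (ContinuousOn.mul (by fun_prop) (continuousOn_phase.mono hsub)).intervalIntegrable

lemma integral_cut_mul_phase (hs : 0 ≤ s.re) (hν : ν ≠ 0) {c X : ℝ} (hc : 0 < c)
    (hX : 2 * c ≤ X) :
    ∫ x : ℝ, ((cut X x - cut c x : ℝ) : ℂ) * (exp (2 * Real.pi * I * ν * x) * (x : ℂ) ^ (-s)) =
      (phasePrim s ν c - phasePrim s ν (2 * c)) / c -
      (phasePrim s ν X - phasePrim s ν (2 * X)) / X := by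
  have hX0 : 0 < X := by linarith
  have hsupp : Function.support (fun x : ℝ => ((cut X x - cut c x : ℝ) : ℂ) *
      (exp (2 * Real.pi * I * ν * x) * (x : ℂ) ^ (-s))) ⊆ Set.Ioc c (2 * X) := by
    intro x hx
    by_contra h
    rw [Set.mem_Ioc, not_and_or, not_lt, not_le] at h
    refine hx ?_
    rcases h with h | h
    · simp [cut_eq_one hc h, cut_eq_one hX0 (by linarith : x ≤ X)]
    · simp [cut_eq_zero hX0 h.le, cut_eq_zero hc (by linarith : 2 * c ≤ x)]
  have h_int : ∀ p q : ℝ, 0 < p → 0 < q → IntervalIntegrable (fun x : ℝ =>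
      ((cut X x - cut c x : ℝ) : ℂ) * (exp (2 * Real.pi * I * ν * x) * (x : ℂ) ^ (-s)))
      volume p q := fun p q hp hq => (ContinuousOn.mul
        (continuous_ofReal.comp ((continuous_cut X).sub (continuous_cut c))).continuousOn
        (continuousOn_phase.mono fun x hx => (lt_min hp hq).trans_le hx.1)).intervalIntegrable
  rw [← intervalIntegral.integral_eq_integral_of_support_subset hsupp,
    ← intervalIntegral.integral_add_adjacent_intervals (h_int c X hc hX0)
      (h_int X _ hX0 (by linarith)),
    ← intervalIntegral.integral_add_adjacent_intervals (h_int c (2 * c) hc (by linarith))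
      (h_int _ X (by linarith) hX0)]
  have e1 := integral_affine_mul_phase hs hν hc (by linarith : 0 < 2 * c) (-1) (1 / c)
  have e2 := integral_affine_mul_phase hs hν (by linarith : 0 < 2 * c) hX0 1 0
  have e3 := integral_affine_mul_phase hs hν hX0 (by linarith : 0 < 2 * X) 2 (-1 / X)
  have c1 : ∫ x in c..(2 * c), ((cut X x - cut c x : ℝ) : ℂ) *
      (exp (2 * Real.pi * I * ν * x) * (x : ℂ) ^ (-s)) = ∫ x in c..(2 * c),
      ((-1 + 1 / c * x : ℝ) : ℂ) * (exp (2 * Real.pi * I * ν * x) * (x : ℂ) ^ (-s)) := by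
    refine intervalIntegral.integral_congr fun x hx => ?_
    rw [Set.uIcc_of_le (by linarith)] at hx
    rw [cut_eq_one hX0 (hx.2.trans hX), cut_eq_sub hc hx.1 hx.2]
    congr 2
    ring
  have c2 : ∫ x in (2 * c)..X, ((cut X x - cut c x : ℝ) : ℂ) *
      (exp (2 * Real.pi * I * ν * x) * (x : ℂ) ^ (-s)) = ∫ x in (2 * c)..X,
      ((1 + 0 * x : ℝ) : ℂ) * (exp (2 * Real.pi * I * ν * x) * (x : ℂ) ^ (-s)) := by
    refine intervalIntegral.integral_congr fun x hx => ?_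
    rw [Set.uIcc_of_le (by linarith)] at hx
    rw [cut_eq_one hX0 hx.2, cut_eq_zero hc hx.1]
    congr 2
    ring
  have c3 : ∫ x in X..(2 * X), ((cut X x - cut c x : ℝ) : ℂ) *
      (exp (2 * Real.pi * I * ν * x) * (x : ℂ) ^ (-s)) = ∫ x in X..(2 * X),
      ((2 + -1 / X * x : ℝ) : ℂ) * (exp (2 * Real.pi * I * ν * x) * (x : ℂ) ^ (-s)) := by
    refine intervalIntegral.integral_congr fun x hx => ?_
    rw [Set.uIcc_of_le (by linarith)] at hx
    rw [cut_eq_sub hX0 hx.1 hx.2, cut_eq_zero hc (hX.trans hx.1)]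
    congr 2
    ring
  rw [c1, c2, c3, e1, e2, e3]
  have hc' : (c : ℂ) ≠ 0 := ofReal_ne_zero.2 hc.ne'
  have hX' : (X : ℂ) ≠ 0 := ofReal_ne_zero.2 hX0.ne'
  push_cast
  field_simp
  ring

lemma norm_scale (hν : 0 < ν) : ‖((2 * Real.pi * ν : ℝ) : ℂ) ^ (s - 2)‖ =
    (2 * Real.pi * ν) ^ (s.re - 2) := by
  rw [norm_cpow_eq_rpow_re_of_pos (by positivity)]
  simp

lemma scale_mul (σ : ℝ) (hν : 0 < ν) (hx : 0 < x) :
    (2 * Real.pi * ν) ^ (σ - 2) * (2 * Real.pi * ν * x) ^ (-σ) =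
      x ^ (-σ) * (1 / (2 * Real.pi * ν) ^ 2) := by
  have hp : 0 < 2 * Real.pi * ν := by positivity
  rw [Real.mul_rpow hp.le hx.le, ← mul_assoc, ← Real.rpow_add hp,
    show σ - 2 + -σ = -(2 : ℕ) by push_cast; ring, Real.rpow_neg hp.le, Real.rpow_natCast, one_div]
  ring

lemma one_le_two_pi_sq : 1 ≤ (2 * Real.pi) ^ 2 := by nlinarith [Real.pi_gt_three]

lemma inv_scale_le (hν : 0 < ν) : 1 / (2 * Real.pi * ν) ^ 2 ≤ 1 / ν ^ 2 := by
  apply one_div_le_one_div_of_le (by positivity)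
  rw [mul_pow]
  nlinarith [one_le_two_pi_sq, sq_nonneg ν]

lemma norm_posPrim_le (hs : 0 ≤ s.re) (hν : 0 < ν) (hx : 0 < x)
    (h : 2 * max s.im 0 ≤ 2 * Real.pi * ν * x) :
    ‖posPrim s ν x‖ ≤ 4 * x ^ (-s.re) * (1 / ν ^ 2) := by
  have hz : 0 < 2 * Real.pi * ν * x := by positivity
  have hm : 0 ≤ max s.im 0 := le_max_right _ _
  have h1 := norm_oscPrim_le hs (x := 2 * Real.pi * ν * x) (by linarith)
  set z := 2 * Real.pi * ν * x with hzd
  set τ := max s.im 0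
  have h2 : z / (z - τ) ≤ 2 := by rw [div_le_iff₀ (by linarith)]; linarith
  have h3 : (z / (z - τ)) ^ 2 ≤ 2 ^ 2 :=
    pow_le_pow_left₀ (div_nonneg hz.le (by linarith)) h2 2
  rw [posPrim, norm_mul, norm_scale hν]
  have hzs : 0 ≤ z ^ (-s.re) := Real.rpow_nonneg hz.le _
  have hxs : 0 ≤ x ^ (-s.re) := Real.rpow_nonneg hx.le _
  calc _ ≤ (2 * Real.pi * ν) ^ (s.re - 2) * (z ^ (-s.re) * 2 ^ 2) := by
        gcongr
        exact h1.trans (by gcongr)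
    _ = 4 * ((2 * Real.pi * ν) ^ (s.re - 2) * z ^ (-s.re)) := by ring
    _ = 4 * x ^ (-s.re) * (1 / (2 * Real.pi * ν) ^ 2) := by rw [scale_mul _ hν hx]; ring
    _ ≤ _ := by gcongr ?_ * ?_; exact inv_scale_le hν

lemma norm_phasePrim_le (hs : 0 ≤ s.re) (ht : 0 ≤ s.im) (hν : ν ≠ 0) (hx : 0 < x)
    (h : 2 * s.im ≤ 2 * Real.pi * |ν| * x) :
    ‖phasePrim s ν x‖ ≤ 4 * x ^ (-s.re) * (1 / ν ^ 2) := by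
  rcases lt_or_gt_of_ne hν with h0 | h0
  · rw [phasePrim, if_neg h0.not_gt, RCLike.norm_conj]
    have := norm_posPrim_le (s := (starRingEnd ℂ) s) (by simpa) (neg_pos.2 h0) hx (by
      rw [conj_im, max_eq_right (by linarith)]
      have : 0 < -ν := by linarith
      simp only [mul_zero]
      positivity)
    simpa using this
  · rw [phasePrim, if_pos h0]
    refine norm_posPrim_le hs h0 hx ?_
    rwa [max_eq_left ht, ← abs_of_pos h0]

/-- The stationary part of `phasePrim`. -/
noncomputable def phaseStat (s : ℂ) (ν x : ℝ) : ℂ :=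
  if 0 < ν then ((2 * Real.pi * ν : ℝ) : ℂ) ^ (s - 2) * oscStat s (2 * Real.pi * ν * x) else 0

lemma norm_phasePrim_sub_phaseStat_le (hs : 1 / 2 ≤ s.re) (hs1 : s.re < 1) (ht : 1 ≤ s.im)
    (hν : ν ≠ 0) (hx : 0 < x) :
    ‖phasePrim s ν x - phaseStat s ν x‖ ≤ 12000 / (1 - s.re) * x ^ (-s.re) *
      (1 / (s.im / (2 * Real.pi * x) ^ 2 + (ν - s.im / (2 * Real.pi * x)) ^ 2) + 1 / ν ^ 2) := by
  have hxs : 0 < x ^ (-s.re) := Real.rpow_pos_of_pos hx _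
  have hr : 0 < 1 - s.re := by linarith
  have hr1 : 1 ≤ 1 / (1 - s.re) := by rw [le_div_iff₀ hr]; linarith
  set t := s.im with htd
  have hden : 0 < t / (2 * Real.pi * x) ^ 2 + (ν - t / (2 * Real.pi * x)) ^ 2 := by positivity
  rcases lt_or_gt_of_ne hν with h0 | h0
  · rw [phasePrim, phaseStat, if_neg h0.not_gt, if_neg h0.not_gt, sub_zero, RCLike.norm_conj]
    have h1 := norm_posPrim_le (s := (starRingEnd ℂ) s) (by simp; linarith) (neg_pos.2 h0) hx (by
      rw [conj_im, max_eq_right (by linarith)]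
      have : 0 < -ν := by linarith
      simp only [mul_zero]
      positivity)
    rw [neg_sq, conj_re] at h1
    refine h1.trans ?_
    have h2 : 0 ≤ 1 / ν ^ 2 := by positivity
    have h3 := (one_div_pos.2 hden).le
    calc 4 * x ^ (-s.re) * (1 / ν ^ 2) ≤
          (12000 * (1 / (1 - s.re))) * x ^ (-s.re) * (1 / ν ^ 2) := by
          gcongr; linarith
      _ = 12000 / (1 - s.re) * x ^ (-s.re) * (1 / ν ^ 2) := by ring
      _ ≤ _ := by gcongr; linarith
  · rw [phasePrim, phaseStat, if_pos h0, if_pos h0, posPrim, ← mul_sub, norm_mul, norm_scale h0]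
    have hz : 0 < 2 * Real.pi * ν * x := by positivity
    have h1 := norm_oscPrim_sub_oscStat_le hs hs1 ht hz
    rw [← htd] at h1
    set z := 2 * Real.pi * ν * x with hzd
    have hd : 0 < t + (z - t) ^ 2 := by positivity
    have h2 : (z + t) ^ 2 / (t + (z - t) ^ 2) ≤ 8 * (z ^ 2 / (t + (z - t) ^ 2)) + 2 := by
      rw [← mul_div_assoc, div_add' _ _ _ hd.ne']
      gcongr
      nlinarith [sq_nonneg (3 * z - t)]
    have h3 : 1 / (2 * Real.pi * ν) ^ 2 * (z ^ 2 / (t + (z - t) ^ 2)) =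
        1 / (2 * Real.pi) ^ 2 *
          (1 / (t / (2 * Real.pi * x) ^ 2 + (ν - t / (2 * Real.pi * x)) ^ 2)) := by
      have e : t + (z - t) ^ 2 = (2 * Real.pi * x) ^ 2 *
          (t / (2 * Real.pi * x) ^ 2 + (ν - t / (2 * Real.pi * x)) ^ 2) := by
        rw [hzd]; field_simp
      rw [e]
      generalize t / (2 * Real.pi * x) ^ 2 + (ν - t / (2 * Real.pi * x)) ^ 2 = d at hden
      rw [hzd]
      field_simp
    have h4 : 1 / (2 * Real.pi) ^ 2 ≤ 1 := by
      rw [div_le_one (by positivity)]; exact one_le_two_pi_sq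
    have h5 := (one_div_pos.2 hden).le
    have hz' : 0 < z ^ (-s.re) := Real.rpow_pos_of_pos hz _
    calc _ ≤ (2 * Real.pi * ν) ^ (s.re - 2) * (1500 / (1 - s.re) * z ^ (-s.re) *
          (8 * (z ^ 2 / (t + (z - t) ^ 2)) + 2)) := by
          gcongr
          exact h1.trans (by gcongr)
      _ = 1500 / (1 - s.re) * ((2 * Real.pi * ν) ^ (s.re - 2) * z ^ (-s.re)) *
          (8 * (z ^ 2 / (t + (z - t) ^ 2)) + 2) := by ring
      _ = 1500 / (1 - s.re) * x ^ (-s.re) * (8 * (1 / (2 * Real.pi * ν) ^ 2 *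
          (z ^ 2 / (t + (z - t) ^ 2))) + 2 * (1 / (2 * Real.pi * ν) ^ 2)) := by
          rw [scale_mul _ h0 hx]; ring
      _ ≤ 1500 / (1 - s.re) * x ^ (-s.re) * (8 * (1 *
          (1 / (t / (2 * Real.pi * x) ^ 2 + (ν - t / (2 * Real.pi * x)) ^ 2))) +
          8 * (1 / ν ^ 2)) := by
          rw [h3]
          have h6 : 0 ≤ 1 / ν ^ 2 := by positivity
          have h7 := inv_scale_le h0
          gcongr ?_ * (8 * (?_ * ?_) + ?_)
          linarith
      _ = _ := by ring

end phase

section sums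

lemma summable_one_div_one_add_sq : Summable fun j : ℤ => 1 / (1 + (j : ℝ) ^ 2) := by
  have h := (Real.summable_one_div_int_pow (p := 2)).2 one_lt_two
  refine Summable.of_norm_bounded_eventually (g := fun j : ℤ => 1 / (j : ℝ) ^ 2) h ?_
  have : ({0}ᶜ : Set ℤ) ∈ cofinite := (Set.finite_singleton (0 : ℤ)).compl_mem_cofinite
  filter_upwards [this] with j hj
  have hj0 : (j : ℝ) ≠ 0 := by simpa using hj
  rw [Real.norm_of_nonneg (by positivity)]
  have : 0 < (j : ℝ) ^ 2 := by positivity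
  exact one_div_le_one_div_of_le this (by linarith)

lemma one_div_add_sq_le {τ : ℝ} (hτ : 0 < τ) (β : ℝ) (n : ℤ) :
    1 / (τ + (n + β) ^ 2) ≤ 4 * (1 + 1 / τ) * (1 / (1 + ((n + round β : ℤ) : ℝ) ^ 2)) := by
  have hδ := abs_sub_round β
  push_cast
  set k : ℤ := round β
  rw [mul_one_div, div_le_div_iff₀ (by positivity) (by positivity), one_mul]
  have key : ((n : ℝ) + k) ^ 2 ≤ 4 * (n + β) ^ 2 := by
    rcases eq_or_ne (n + k) 0 with h | h
    · have : (n : ℝ) + k = 0 := by exact_mod_cast h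
      rw [this, zero_pow two_ne_zero]; positivity
    · have h1 : 1 ≤ |(n : ℝ) + k| := by exact_mod_cast Int.one_le_abs h
      have h2 : |(n : ℝ) + k| ≤ 2 * |n + β| := by
        have : |(n : ℝ) + k| ≤ |n + β| + |β - k| := by
          have := abs_sub (n + β) (β - k)
          rwa [show (n : ℝ) + β - (β - k) = n + k by ring] at this
        linarith
      rw [← sq_abs, ← sq_abs (n + β)]
      nlinarith [abs_nonneg ((n : ℝ) + k)]
  have h2 : (1 + 1 / τ) * (τ + (n + β) ^ 2) = τ + 1 + (n + β) ^ 2 + (n + β) ^ 2 / τ := by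
    field_simp; ring
  have h3 : 0 ≤ (n + β) ^ 2 / τ := by positivity
  nlinarith

lemma summable_one_div_add_sq {τ : ℝ} (hτ : 0 < τ) (β : ℝ) :
    Summable fun n : ℤ => 1 / (τ + (n + β) ^ 2) := by
  refine Summable.of_nonneg_of_le (fun n => by positivity) (one_div_add_sq_le hτ β) ?_
  exact (((Equiv.addRight (round β)).summable_iff).2 summable_one_div_one_add_sq).mul_left _

lemma tsum_one_div_add_sq_le {τ : ℝ} (hτ : 0 < τ) (β : ℝ) :
    ∑' n : ℤ, 1 / (τ + (n + β) ^ 2) ≤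
      4 * (1 + 1 / τ) * ∑' j : ℤ, 1 / (1 + (j : ℝ) ^ 2) := by
  have h := ((Equiv.addRight (round β)).summable_iff).2 summable_one_div_one_add_sq
  refine ((summable_one_div_add_sq hτ β).tsum_le_tsum (one_div_add_sq_le hτ β)
    (h.mul_left _)).trans (le_of_eq ?_)
  rw [tsum_mul_left, ← (Equiv.addRight (round β)).tsum_eq (fun j : ℤ => 1 / (1 + (j : ℝ) ^ 2))]
  rfl

lemma summable_one_div_add_int_sq (β : ℝ) : Summable fun n : ℤ => 1 / ((n : ℝ) + β) ^ 2 := by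
  have := (Real.summable_one_div_int_add_rpow β 2).2 one_lt_two
  refine this.congr fun n => ?_
  norm_cast
  rw [sq_abs]

end sums

section average

lemma integral_ite_lt {p q x : ℝ} (hpq : p ≤ q) :
    ∫ u in p..q, (if x < u then (1 : ℝ) else 0) = max 0 (min (q - p) (q - x)) := by
  have e : (fun u : ℝ => if x < u then (1 : ℝ) else 0) = Set.indicator (Set.Ioi x) fun _ => 1 := by
    funext u; simp [Set.indicator_apply]
  rw [e, intervalIntegral.integral_of_le hpq, integral_indicator measurableSet_Ioi,
    Measure.restrict_restrict measurableSet_Ioi, setIntegral_const, smul_eq_mul, mul_one,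
    Set.inter_comm, Set.Ioc_inter_Ioi, measureReal_def, Real.volume_Ioc]
  rcases le_total q (max p x) with h | h
  · rw [ENNReal.ofReal_of_nonpos (by linarith), ENNReal.toReal_zero, max_eq_left]
    rcases le_max_iff.1 h with h | h
    · exact (min_le_left _ _).trans (by linarith)
    · exact (min_le_right _ _).trans (by linarith)
  · have e2 : q - max p x = min (q - p) (q - x) := (min_sub_sub_left q p x).symm
    rw [ENNReal.toReal_ofReal (by linarith), e2, max_eq_right (by rw [← e2]; linarith)]

lemma cut_eq_integral {c : ℝ} (hc : 0 < c) (x : ℝ) :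
    cut c x = (∫ u in c..(2 * c), (if x < u then (1 : ℝ) else 0)) / c := by
  rw [integral_ite_lt (by linarith), eq_div_iff hc.ne', cut, max_mul_of_nonneg _ _ hc.le,
    min_mul_of_nonneg _ _ hc.le, zero_mul, one_mul, sub_mul, div_mul_cancel₀ _ hc.ne',
    show 2 * c - c = c by ring]

lemma intervalIntegrable_ite_lt (x p q : ℝ) :
    IntervalIntegrable (fun u : ℝ => if x < u then (1 : ℝ) else 0) volume p q := by
  rw [intervalIntegrable_iff]
  refine Measure.integrableOn_of_bounded (M := 1) (by simp) ?_ ?_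
  · exact (Measurable.ite measurableSet_Ioi measurable_const measurable_const).aestronglyMeasurable
  · exact Eventually.of_forall fun u => by split_ifs <;> simp

lemma norm_sum_cut_sub_le {ι : Type*} (S : Finset ι) (x : ι → ℝ) (f : ι → ℂ) (Z : ℂ) {B c : ℝ}
    (hc : 0 < c)
    (h : ∀ u ∈ Set.Icc c (2 * c), ‖∑ i ∈ S, (if x i < u then f i else 0) - Z‖ ≤ B) :
    ‖∑ i ∈ S, (cut c (x i) : ℂ) * f i - Z‖ ≤ B := by
  have hI : ∀ i ∈ S, IntervalIntegrable (fun u : ℝ => if x i < u then f i else 0)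
      volume c (2 * c) := by
    intro i _
    have h := intervalIntegrable_ite_lt (x i) c (2 * c)
    have h' : IntervalIntegrable (fun u : ℝ => ((if x i < u then (1 : ℝ) else 0 : ℝ) : ℂ))
      volume c (2 * c) := ⟨h.1.ofReal, h.2.ofReal⟩
    have := h'.mul_const (f i)
    refine this.congr ?_
    exact fun u _ => by split_ifs <;> simp
  have e : ∑ i ∈ S, (cut c (x i) : ℂ) * f i - Z =
      (∫ u in c..(2 * c), (∑ i ∈ S, (if x i < u then f i else 0) - Z)) / c := by
    have hc' : (c : ℂ) ≠ 0 := ofReal_ne_zero.2 hc.ne'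
    rw [intervalIntegral.integral_sub (by
        simpa only [Finset.sum_fn] using IntervalIntegrable.sum S hI) (by simp),
      intervalIntegral.integral_finsetSum hI, intervalIntegral.integral_const, sub_div,
      Finset.sum_div, real_smul, show ((2 * c - c : ℝ) : ℂ) = c by push_cast; ring,
      mul_div_cancel_left₀ _ hc']
    congr 1
    refine Finset.sum_congr rfl fun i _ => ?_
    rw [cut_eq_integral hc, ofReal_div, ← intervalIntegral.integral_ofReal, div_mul_eq_mul_div,
      ← intervalIntegral.integral_mul_const]
    congr 2
    funext u
    split_ifs <;> simp
  rw [e, norm_div, Complex.norm_real, Real.norm_of_nonneg hc.le, div_le_iff₀ hc]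
  have := intervalIntegral.norm_integral_le_of_norm_le_const (a := c) (b := 2 * c) (C := B)
    (f := fun u => ∑ i ∈ S, (if x i < u then f i else 0) - Z) (fun u hu => by
      rw [Set.uIoc_of_le (by linarith)] at hu
      exact h u (Set.Ioc_subset_Icc_self hu))
  rwa [show 2 * c - c = c by ring, abs_of_pos hc] at this

end average

section poisson

variable {a lam : ℝ} {s : ℂ}

lemma cut_mul_eq_zero {c : ℝ} (ha : 0 < a) (hc : 0 < c) {N : ℕ} (hN : 2 * c ≤ N) (f : ℕ → ℂ) :
    ∀ m ∉ range N, (cut c (m + a) : ℂ) * f m = 0 := by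
  intro m hm
  have : (N : ℝ) ≤ m := by exact_mod_cast not_lt.1 (mt mem_range.2 hm)
  rw [cut_eq_zero hc (by linarith), ofReal_zero, zero_mul]

lemma summable_cut_mul {c : ℝ} (ha : 0 < a) (hc : 0 < c) (f : ℕ → ℂ) :
    Summable fun m : ℕ => (cut c (m + a) : ℂ) * f m :=
  summable_of_ne_finset_zero (cut_mul_eq_zero ha hc (Nat.le_ceil (2 * c)) f)

lemma tendsto_tsum_cut (ha : 0 < a) (h0 : 0 < lam) (h1 : lam < 1) (hs : 0 < s.re) :
    Tendsto (fun X : ℝ => ∑' m : ℕ, (cut X (m + a) : ℂ) * lerchTerm a lam s m) atTop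
      (nhds (zetaL a lam s)) := by
  rw [Metric.tendsto_atTop]
  intro ε hε
  obtain ⟨M, hM⟩ := Metric.tendsto_atTop.1 (tendsto_zetaL ha h0 h1 hs) (ε / 2) (by positivity)
  refine ⟨M + a + 1, fun X hX => ?_⟩
  have hX0 : 0 < X := by
    have : (0 : ℝ) ≤ M := M.cast_nonneg
    linarith
  rw [tsum_eq_sum (cut_mul_eq_zero ha hX0 (Nat.le_ceil (2 * X)) _), dist_eq_norm]
  refine lt_of_le_of_lt (norm_sum_cut_sub_le _ (fun m : ℕ => (m : ℝ) + a) _ _ hX0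
    (B := ε / 2) fun u hu => ?_) (by linarith)
  have hle : ⌈u - a⌉₊ ≤ ⌈2 * X⌉₊ := Nat.ceil_mono (by linarith [hu.2])
  have e : ∑ m ∈ range ⌈2 * X⌉₊, (if (m : ℝ) + a < u then lerchTerm a lam s m else 0) =
      ∑ m ∈ range ⌈u - a⌉₊, lerchTerm a lam s m := by
    rw [← Finset.sum_filter]
    congr 1
    ext m
    rw [mem_filter, mem_range, mem_range, Nat.lt_ceil (n := m) (a := u - a), ← lt_sub_iff_add_lt]
    refine and_iff_right_of_imp fun h => ?_
    exact (Nat.lt_ceil.2 h).trans_le hle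
  rw [e, ← dist_eq_norm]
  refine (hM _ ?_).le
  have : (M : ℝ) ≤ ⌈u - a⌉₊ := (by linarith [hu.1] : (M : ℝ) ≤ u - a).trans (Nat.le_ceil _)
  exact_mod_cast this

/-- The summand of the dual side of Poisson summation. -/
noncomputable def dualTerm (a lam : ℝ) (s : ℂ) (c : ℝ) (n : ℤ) : ℂ :=
  exp (-(2 * Real.pi * I * n * a)) *
    ((phasePrim s (n + lam) c - phasePrim s (n + lam) (2 * c)) / c)

/-- The stationary part of `dualTerm`. -/
noncomputable def dualStat (a lam : ℝ) (s : ℂ) (c : ℝ) (n : ℤ) : ℂ :=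
  exp (-(2 * Real.pi * I * n * a)) *
    ((phaseStat s (n + lam) c - phaseStat s (n + lam) (2 * c)) / c)

lemma norm_exp_neg_two_pi (n : ℤ) : ‖exp (-(2 * Real.pi * I * n * a))‖ = 1 := by
  rw [show -(2 * (Real.pi : ℂ) * I * n * a) = 2 * Real.pi * I * ((-(n * a) : ℝ) : ℂ) by
    push_cast; ring, norm_exp_two_pi_mul]

lemma int_add_ne_zero (h0 : 0 < lam) (h1 : lam < 1) (n : ℤ) : (n : ℝ) + lam ≠ 0 := by
  intro h
  have h2 : (-1 : ℝ) < n := by linarith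
  have h3 : (n : ℝ) < 0 := by linarith
  have h4 : (-1 : ℤ) < n := by exact_mod_cast h2
  have h5 : n < 0 := by exact_mod_cast h3
  omega

open FourierTransform in
lemma tsum_cut_sub (ha1 : a ≤ 1) (h0 : 0 < lam) (h1 : lam < 1) (hs : 0 ≤ s.re)
    {c X : ℝ} (hc : 0 < c) (hX : 2 * c ≤ X)
    (hsum : Summable fun n : ℤ => dualTerm a lam s c n - dualTerm a lam s X n) :
    ∑' m : ℕ, ((cut X (m + a) - cut c (m + a) : ℝ) : ℂ) * lerchTerm a lam s m =
      exp (-(2 * Real.pi * I * lam * a)) *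
        ∑' n : ℤ, (dualTerm a lam s c n - dualTerm a lam s X n) := by
  have hX0 : 0 < X := by linarith
  set f : ℝ → ℂ := fun x => ((cut X x - cut c x : ℝ) : ℂ) *
    (exp (2 * Real.pi * I * lam * x) * (x : ℂ) ^ (-s)) with hf
  have hf0 : ∀ x ≤ c, f x = 0 := fun x hx => by
    simp [hf, cut_eq_one hc hx, cut_eq_one hX0 (by linarith : x ≤ X)]
  have hfX : ∀ x, 2 * X ≤ x → f x = 0 := fun x hx => by
    simp [hf, cut_eq_zero hX0 hx, cut_eq_zero hc (by linarith : 2 * c ≤ x)]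
  have hcont : Continuous f := by
    rw [continuous_iff_continuousAt]
    intro x
    rcases lt_or_ge x c with h | h
    · have : f =ᶠ[nhds x] fun _ => 0 := by
        filter_upwards [gt_mem_nhds h] with y hy using hf0 y hy.le
      exact continuousAt_const.congr this.symm
    · refine ContinuousAt.mul (continuous_ofReal.comp
        ((continuous_cut X).sub (continuous_cut c))).continuousAt ?_
      exact continuousOn_phase.continuousAt (Ioi_mem_nhds (hc.trans_le h))
  have hdecay : f =O[cocompact ℝ] fun x : ℝ => |x| ^ (-(2 : ℝ)) := by
    have : f =ᶠ[cocompact ℝ] fun _ => 0 := by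
      filter_upwards [(isCompact_Icc (a := c) (b := 2 * X)).compl_mem_cocompact] with x hx
      rw [Set.mem_compl_iff, Set.mem_Icc, not_and_or, not_le, not_le] at hx
      rcases hx with hx | hx
      exacts [hf0 x hx.le, hfX x hx.le]
    exact this.trans_isBigO (Asymptotics.isBigO_zero _ _)
  have hfour : ∀ n : ℤ, 𝓕 f ((-n : ℤ) : ℝ) * fourier (-n) (a : UnitAddCircle) =
      dualTerm a lam s c n - dualTerm a lam s X n := by
    intro n
    have hi := integral_cut_mul_phase (ν := n + lam) hs (int_add_ne_zero h0 h1 n) hc hX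
    have e : 𝓕 f ((-n : ℤ) : ℝ) = ∫ x : ℝ, ((cut X x - cut c x : ℝ) : ℂ) *
        (exp (2 * Real.pi * I * ((n + lam : ℝ) : ℂ) * x) * (x : ℂ) ^ (-s)) := by
      rw [Real.fourier_real_eq_integral_exp_smul]
      congr 1
      funext x
      simp only [hf, smul_eq_mul]
      rw [mul_left_comm, ← mul_assoc (exp _) (exp _), ← exp_add]
      congr 3
      push_cast
      ring
    rw [e, hi, fourier_coe_apply, dualTerm, dualTerm]
    push_cast
    rw [show 2 * (Real.pi : ℂ) * I * -n * a / 1 = -(2 * Real.pi * I * n * a) by ring]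
    ring
  have hps := Real.tsum_eq_tsum_fourier_of_rpow_decay_of_summable hcont one_lt_two hdecay (by
    rw [← (Equiv.neg ℤ).summable_iff, ← summable_norm_iff]
    refine hsum.norm.congr fun n => ?_
    rw [← hfour n, norm_mul, fourier_coe_apply]
    have : ‖exp (2 * Real.pi * I * ((-n : ℤ) : ℂ) * a / ((1 : ℝ) : ℂ))‖ = 1 := by
      rw [show 2 * (Real.pi : ℂ) * I * ((-n : ℤ) : ℂ) * a / ((1 : ℝ) : ℂ) =
        -(2 * Real.pi * I * n * a) by push_cast; ring, norm_exp_neg_two_pi]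
    rw [this, mul_one]
    rfl) a
  rw [← (Equiv.neg ℤ).tsum_eq (fun n : ℤ => 𝓕 f n * fourier n (a : UnitAddCircle))] at hps
  have hr : ∑' n : ℤ, 𝓕 f (((Equiv.neg ℤ) n : ℤ) : ℝ) * fourier ((Equiv.neg ℤ) n)
      (a : UnitAddCircle) = ∑' n : ℤ, (dualTerm a lam s c n - dualTerm a lam s X n) :=
    tsum_congr hfour
  rw [hr] at hps
  rw [← hps, ← Function.Injective.tsum_eq (g := ((↑) : ℕ → ℤ)) Nat.cast_injective, ← tsum_mul_left]
  · refine tsum_congr fun m => ?_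
    simp only [hf, lerchTerm]
    push_cast
    rw [show (a : ℂ) + m = m + a by ring, show (a : ℝ) + m = m + a by ring,
      show 2 * (Real.pi : ℂ) * I * lam * m =
      -(2 * Real.pi * I * lam * a) + 2 * Real.pi * I * lam * (m + a) by ring, exp_add]
    ring
  · intro n hn
    by_contra h
    refine hn (hf0 _ ?_)
    have : n ≤ -1 := by
      by_contra h2
      exact h ⟨n.toNat, by simp; omega⟩
    have : (n : ℝ) ≤ -1 := by exact_mod_cast this
    linarith

end poisson

section afe

variable {a lam : ℝ} {s : ℂ}

/-- The majorant of the error of the stationary phase approximation. -/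
noncomputable def statMajorant (lam t x : ℝ) (n : ℤ) : ℝ :=
  1 / (t / (2 * Real.pi * x) ^ 2 + (n + (lam - t / (2 * Real.pi * x))) ^ 2) + 1 / (n + lam) ^ 2

lemma summable_statMajorant {t x : ℝ} (ht : 0 < t) (hx : 0 < x) :
    Summable (statMajorant lam t x) :=
  (summable_one_div_add_sq (by positivity) _).add (summable_one_div_add_int_sq lam)

lemma tsum_statMajorant_le {t x : ℝ} (ht : 0 < t) (hx : 0 < x) :
    ∑' n, statMajorant lam t x n ≤ 4 * (1 + (2 * Real.pi * x) ^ 2 / t) *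
      (∑' j : ℤ, 1 / (1 + (j : ℝ) ^ 2)) + ∑' n : ℤ, 1 / ((n : ℝ) + lam) ^ 2 := by
  have h : 0 < t / (2 * Real.pi * x) ^ 2 := by positivity
  unfold statMajorant
  rw [(summable_one_div_add_sq h _).tsum_add (summable_one_div_add_int_sq lam)]
  have := tsum_one_div_add_sq_le h (lam - t / (2 * Real.pi * x))
  rw [one_div_div] at this
  linarith

lemma norm_dualTerm_sub_dualStat_le (h0 : 0 < lam) (h1 : lam < 1) (hs : 1 / 2 ≤ s.re)
    (hs1 : s.re < 1) (ht : 1 ≤ s.im) {c : ℝ} (hc : 0 < c) (n : ℤ) :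
    ‖dualTerm a lam s c n - dualStat a lam s c n‖ ≤ 12000 / (1 - s.re) * c ^ (-s.re - 1) *
      (statMajorant lam s.im c n + statMajorant lam s.im (2 * c) n) := by
  have hν := int_add_ne_zero h0 h1 n
  have hr : 0 < 1 - s.re := by linarith
  have b1 := norm_phasePrim_sub_phaseStat_le hs hs1 ht hν hc
  have b2 := norm_phasePrim_sub_phaseStat_le hs hs1 ht hν (x := 2 * c) (by positivity)
  rw [add_sub_assoc] at b1 b2
  change _ ≤ _ * statMajorant lam s.im c n at b1
  change _ ≤ _ * statMajorant lam s.im (2 * c) n at b2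
  have hM : 0 ≤ statMajorant lam s.im (2 * c) n := by unfold statMajorant; positivity
  have b3 : (2 * c) ^ (-s.re) ≤ c ^ (-s.re) :=
    Real.rpow_le_rpow_of_nonpos hc (by linarith) (by linarith)
  have b4 : 12000 / (1 - s.re) * (2 * c) ^ (-s.re) * statMajorant lam s.im (2 * c) n ≤
      12000 / (1 - s.re) * c ^ (-s.re) * statMajorant lam s.im (2 * c) n :=
    mul_le_mul_of_nonneg_right (mul_le_mul_of_nonneg_left b3 (by positivity)) hM
  rw [dualTerm, dualStat, ← mul_sub, norm_mul, norm_exp_neg_two_pi, one_mul, ← sub_div, norm_div,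
    norm_real, Real.norm_of_nonneg hc.le, div_le_iff₀ hc, Real.rpow_sub hc, Real.rpow_one]
  have e : 12000 / (1 - s.re) * (c ^ (-s.re) / c) * (statMajorant lam s.im c n +
      statMajorant lam s.im (2 * c) n) * c = 12000 / (1 - s.re) * c ^ (-s.re) *
      statMajorant lam s.im c n + 12000 / (1 - s.re) * c ^ (-s.re) *
      statMajorant lam s.im (2 * c) n := by
    field_simp
  rw [e, sub_sub_sub_comm]
  exact (norm_sub_le _ _).trans (add_le_add b1 (b2.trans b4))

lemma dualStat_eq_zero (h1 : lam < 1) {c : ℝ} (hc : 0 < c) {N : ℕ}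
    (hN : s.im / (2 * Real.pi * c) ≤ N) (h0 : 0 < lam) {n : ℤ}
    (hn : ∀ k < N, n ≠ (k : ℕ)) : dualStat a lam s c n = 0 := by
  have key : ∀ x, c ≤ x → phaseStat s (n + lam) x = 0 := by
    intro x hx
    rw [phaseStat]
    split_ifs with hp
    · have h2 : (-1 : ℝ) < n := by linarith
      have h3 : (-1 : ℤ) < n := by exact_mod_cast h2
      lift n to ℕ using by omega
      have h4 : N ≤ n := by
        by_contra h
        exact hn n (not_le.1 h) rfl
      have h5 : (N : ℝ) ≤ n := by exact_mod_cast h4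
      have h6 : s.im / (2 * Real.pi * c) ≤ ((n : ℤ) : ℝ) + lam := by push_cast; linarith
      rw [oscStat, if_neg, mul_zero]
      rw [not_lt]
      rw [div_le_iff₀ (by positivity)] at h6
      calc s.im ≤ (((n : ℤ) : ℝ) + lam) * (2 * Real.pi * c) := h6
        _ = 2 * Real.pi * (((n : ℤ) : ℝ) + lam) * c := by ring
        _ ≤ _ := by gcongr
    · rfl
  rw [dualStat, key c le_rfl, key (2 * c) (by linarith)]
  simp

lemma norm_dualTerm_le (h0 : 0 < lam) (h1 : lam < 1) (hs : 0 ≤ s.re) (ht : 0 ≤ s.im) {X : ℝ}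
    (hX : 0 < X) (h : s.im ≤ Real.pi * min lam (1 - lam) * X) (n : ℤ) :
    ‖dualTerm a lam s X n‖ ≤ 8 * X ^ (-s.re - 1) * (1 / (n + lam) ^ 2) := by
  have hν := int_add_ne_zero h0 h1 n
  have habs : min lam (1 - lam) ≤ |(n : ℝ) + lam| := by
    rcases le_or_gt 0 n with hn | hn
    · have : (0 : ℝ) ≤ n := by exact_mod_cast hn
      exact (min_le_left _ _).trans (le_trans (by linarith) (le_abs_self _))
    · have : (n : ℝ) ≤ -1 := by exact_mod_cast (by omega : n ≤ -1)
      exact (min_le_right _ _).trans (le_trans (by linarith) (neg_le_abs _))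
  have h2 : 2 * s.im ≤ 2 * Real.pi * |(n : ℝ) + lam| * X := by
    have : Real.pi * min lam (1 - lam) * X ≤ Real.pi * |(n : ℝ) + lam| * X := by gcongr
    linarith
  have b1 := norm_phasePrim_le hs ht hν hX h2
  have b2 := norm_phasePrim_le hs ht hν (x := 2 * X) (by positivity) (h2.trans (by
    have : 0 ≤ 2 * Real.pi * |(n : ℝ) + lam| * X := by positivity
    linarith))
  have b3 : (2 * X) ^ (-s.re) ≤ X ^ (-s.re) :=
    Real.rpow_le_rpow_of_nonpos hX (by linarith) (by linarith)
  have b4 : 4 * (2 * X) ^ (-s.re) * (1 / ((n : ℝ) + lam) ^ 2) ≤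
      4 * X ^ (-s.re) * (1 / ((n : ℝ) + lam) ^ 2) :=
    mul_le_mul_of_nonneg_right (by linarith) (by positivity)
  rw [dualTerm, norm_mul, norm_exp_neg_two_pi, one_mul, norm_div,
    norm_real, Real.norm_of_nonneg hX.le, div_le_iff₀ hX, Real.rpow_sub hX, Real.rpow_one]
  have e : 8 * (X ^ (-s.re) / X) * (1 / ((n : ℝ) + lam) ^ 2) * X =
      4 * X ^ (-s.re) * (1 / ((n : ℝ) + lam) ^ 2) +
        4 * X ^ (-s.re) * (1 / ((n : ℝ) + lam) ^ 2) := by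
    field_simp
    ring
  rw [e]
  exact (norm_sub_le _ _).trans (add_le_add b1 (b2.trans b4))

lemma zetaL_sub_tsum_cut (ha : 0 < a) (ha1 : a ≤ 1) (h0 : 0 < lam) (h1 : lam < 1)
    (hs : 0 < s.re) (ht : 0 ≤ s.im) {c : ℝ} (hc : 0 < c) (hsum : Summable (dualTerm a lam s c)) :
    zetaL a lam s - ∑' m : ℕ, (cut c (m + a) : ℂ) * lerchTerm a lam s m =
      exp (-(2 * Real.pi * I * lam * a)) * ∑' n : ℤ, dualTerm a lam s c n := by
  have hl : 0 < min lam (1 - lam) := lt_min h0 (by linarith)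
  have hev : ∀ᶠ X : ℝ in atTop, 2 * c ≤ X ∧ s.im ≤ Real.pi * min lam (1 - lam) * X := by
    refine (eventually_ge_atTop (2 * c)).and ?_
    filter_upwards [eventually_ge_atTop (s.im / (Real.pi * min lam (1 - lam)))] with X hX
    rwa [div_le_iff₀ (by positivity), mul_comm] at hX
  have hsX : ∀ X : ℝ, 0 < X → s.im ≤ Real.pi * min lam (1 - lam) * X →
      Summable (dualTerm a lam s X) := fun X hX0 hX =>
    Summable.of_norm_bounded ((summable_one_div_add_int_sq lam).mul_left _)
      (norm_dualTerm_le h0 h1 hs.le ht hX0 hX)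
  have h2 : Tendsto (fun X : ℝ => ∑' n : ℤ, dualTerm a lam s X n) atTop (nhds 0) := by
    have h3 : Tendsto (fun X : ℝ => 8 * X ^ (-s.re - 1) * ∑' n : ℤ, 1 / ((n : ℝ) + lam) ^ 2)
        atTop (nhds 0) := by
      have := ((tendsto_rpow_neg_atTop (y := s.re + 1) (by linarith)).const_mul 8).mul_const
        (∑' n : ℤ, 1 / ((n : ℝ) + lam) ^ 2)
      simp only [mul_zero, zero_mul] at this
      refine this.congr fun X => ?_
      rw [neg_add']
    refine squeeze_zero_norm' ?_ h3
    filter_upwards [hev] with X hX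
    have hX0 : 0 < X := by linarith [hX.1]
    rw [← tsum_mul_left]
    exact tsum_of_norm_bounded ((summable_one_div_add_int_sq lam).mul_left _).hasSum
      (norm_dualTerm_le h0 h1 hs.le ht hX0 hX.2)
  have hL := (tendsto_tsum_cut (a := a) ha h0 h1 hs).sub_const
    (∑' m : ℕ, (cut c (m + a) : ℂ) * lerchTerm a lam s m)
  have hR := (h2.const_sub (∑' n : ℤ, dualTerm a lam s c n)).const_mul
    (exp (-(2 * Real.pi * I * lam * a)))
  rw [sub_zero] at hR
  refine tendsto_nhds_unique (hL.congr' ?_) hR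
  filter_upwards [hev] with X hX
  have hX0 : 0 < X := by linarith [hX.1]
  have hd := hsX X hX0 hX.2
  rw [← hsum.tsum_sub hd, ← tsum_cut_sub ha1 h0 h1 hs.le hc hX.1 (hsum.sub hd),
    ← (summable_cut_mul ha hX0 _).tsum_sub (summable_cut_mul ha hc _)]
  refine tsum_congr fun m => ?_
  push_cast
  ring

/-- A smoothed approximate functional equation. -/
lemma exists_norm_zetaL_sub_le (ha : 0 < a) (ha1 : a ≤ 1) (h0 : 0 < lam) (h1 : lam < 1) {σ : ℝ}
    (hσ : 1 / 2 ≤ σ) (hσ1 : σ < 1) :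
    ∃ C, 0 < C ∧ ∀ (s : ℂ) (c : ℝ) (N : ℕ), s.re = σ → 1 ≤ s.im → 0 < c → 2 * c ≤ N →
      s.im / (2 * Real.pi * c) ≤ N →
      ‖zetaL a lam s - ∑ m ∈ range N, (cut c (m + a) : ℂ) * lerchTerm a lam s m -
        exp (-(2 * Real.pi * I * lam * a)) * ∑ k ∈ range N, dualStat a lam s c (k : ℕ)‖ ≤
        C * (c ^ (-σ - 1) * (1 + c ^ 2 / s.im)) := by
  set S := ∑' j : ℤ, 1 / (1 + (j : ℝ) ^ 2)
  set L := ∑' n : ℤ, 1 / ((n : ℝ) + lam) ^ 2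
  have hS : 0 ≤ S := tsum_nonneg fun j => by positivity
  have hL : 0 ≤ L := tsum_nonneg fun j => by positivity
  have hr : 0 < 1 - σ := by linarith
  refine ⟨12000 / (1 - σ) * (4000 * S + 2 * L + 1), by positivity, ?_⟩
  intro s c N hre ht hc hN hN2
  have ht0 : 0 < s.im := by linarith
  have hst : ∀ n : ℤ, n ∉ (range N).map Nat.castEmbedding → dualStat a lam s c n = 0 := by
    intro n hn
    refine dualStat_eq_zero h1 hc hN2 h0 fun k hk hkn => hn ?_
    rw [Finset.mem_map]
    exact ⟨k, mem_range.2 hk, hkn.symm⟩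
  have hst2 : ∑' n : ℤ, dualStat a lam s c n = ∑ k ∈ range N, dualStat a lam s c (k : ℕ) := by
    rw [tsum_eq_sum (fun n hn => hst n hn), Finset.sum_map]
    rfl
  have hsst : Summable (dualStat a lam s c) := summable_of_ne_finset_zero hst
  have hb := norm_dualTerm_sub_dualStat_le (a := a) h0 h1 (hre ▸ hσ) (hre ▸ hσ1) ht hc
  have hmaj := ((summable_statMajorant (lam := lam) ht0 hc).add
    (summable_statMajorant (lam := lam) ht0 (x := 2 * c) (by positivity)))
  have hsd := Summable.of_norm_bounded (hmaj.mul_left _) hb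
  have hsum : Summable (dualTerm a lam s c) := by
    refine (hsd.add hsst).congr fun n => ?_
    ring
  have hz := zetaL_sub_tsum_cut ha ha1 h0 h1 (by rw [hre]; linarith) ht0.le hc hsum
  rw [tsum_eq_sum (cut_mul_eq_zero ha hc hN _)] at hz
  rw [hz, ← hst2, ← mul_sub, ← hsum.tsum_sub hsst, norm_mul,
    show -(2 * (Real.pi : ℂ) * I * lam * a) = 2 * Real.pi * I * ((-(lam * a) : ℝ) : ℂ) by
      push_cast; ring, norm_exp_two_pi_mul, one_mul]
  refine (tsum_of_norm_bounded (hmaj.mul_left _).hasSum hb).trans ?_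
  rw [tsum_mul_left, (summable_statMajorant ht0 hc).tsum_add
    (summable_statMajorant ht0 (by positivity)), hre]
  have b1 := tsum_statMajorant_le (lam := lam) ht0 hc
  have b2 := tsum_statMajorant_le (lam := lam) ht0 (x := 2 * c) (by positivity)
  have hπ : Real.pi ^ 2 ≤ 16 := by nlinarith [Real.pi_pos, Real.pi_le_four]
  set q := c ^ 2 / s.im with hq
  have hq0 : 0 ≤ q := by positivity
  have e1 : (2 * Real.pi * c) ^ 2 / s.im ≤ 64 * q := by
    rw [show (2 * Real.pi * c) ^ 2 / s.im = 4 * Real.pi ^ 2 * q by rw [hq]; ring]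
    nlinarith
  have e2 : (2 * Real.pi * (2 * c)) ^ 2 / s.im ≤ 256 * q := by
    rw [show (2 * Real.pi * (2 * c)) ^ 2 / s.im = 16 * Real.pi ^ 2 * q by rw [hq]; ring]
    nlinarith
  rw [mul_assoc, mul_assoc]
  refine mul_le_mul_of_nonneg_left ?_ (by positivity)
  rw [mul_left_comm]
  refine mul_le_mul_of_nonneg_left ?_ (by positivity)
  have e1' := mul_le_mul_of_nonneg_right e1 hS
  have e2' := mul_le_mul_of_nonneg_right e2 hS
  have : 0 ≤ S * q := by positivity
  have : 0 ≤ L * q := by positivity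
  nlinarith

end afe

section stirling

lemma norm_deriv_stirlingRemainder_le {z : ℂ} (hz : 1 ≤ z.re) (h2 : 4 ≤ ‖z‖) :
    ‖deriv stirlingRemainder z‖ ≤ 4 / ‖z‖ := by
  have hsub : Metric.closedBall z (1 / 2) ⊆ {s : ℂ | 1 / 8 < s.re} := by
    intro w hw
    have h := (abs_re_le_norm (w - z)).trans (mem_closedBall_iff_norm.1 hw)
    rw [sub_re, abs_le] at h
    change 1 / 8 < w.re
    linarith [h.1]
  have hd : DiffContOnCl ℂ stirlingRemainder (Metric.ball z (1 / 2)) :=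
    (differentiableOn_stirlingRemainder.mono (by
      rwa [closure_ball _ (by norm_num)])).diffContOnCl
  have := norm_deriv_le_of_forall_mem_sphere_norm_le (C := 2 / ‖z‖) (by norm_num) hd
    (fun w hw => by
      have hw' := Metric.sphere_subset_closedBall hw
      have h3 : ‖z‖ - 1 / 2 ≤ ‖w‖ := by
        have h4 := norm_sub_norm_le z w
        rw [norm_sub_rev, mem_sphere_iff_norm.1 hw] at h4
        linarith
      refine (norm_stirlingRemainder_le (hsub hw') (by linarith)).trans ?_
      rw [div_le_div_iff₀ (by linarith) (by linarith)]
      linarith)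
  refine this.trans (le_of_eq ?_)
  ring

lemma hasDerivAt_Gamma {z : ℂ} (hz : 1 / 8 < z.re) :
    HasDerivAt Gamma (Gamma z * (log z - 1 / (2 * z) + deriv stirlingRemainder z)) z := by
  have hz0 : z ≠ 0 := by rintro rfl; norm_num at hz
  have hsl : z ∈ slitPlane := Or.inl (by linarith)
  have hopen : {s : ℂ | 1 / 8 < s.re} ∈ nhds z := (isOpen_re_gt (1 / 8)).mem_nhds hz
  have hρ := (differentiableOn_stirlingRemainder.differentiableAt hopen).hasDerivAt
  have h1 := (((((hasDerivAt_id z).sub_const (1 / 2)).mul (hasDerivAt_log hsl)).sub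
    (hasDerivAt_id z)).add hρ).cexp.const_mul ((√(2 * Real.pi) : ℝ) : ℂ)
  have h2 : Gamma =ᶠ[nhds z] fun s =>
      (√(2 * Real.pi) : ℝ) * exp ((s - 1 / 2) * log s - s + stirlingRemainder s) := by
    filter_upwards [hopen] with w hw using Gamma_eq_exp_stirling hw
  refine (h1.congr_of_eventuallyEq h2).congr_deriv ?_
  rw [Gamma_eq_exp_stirling hz]
  simp only [id, Pi.add_apply, Pi.sub_apply, Pi.mul_apply]
  field_simp
  ring

variable {b t : ℝ}

lemma log_sub_mul_I (ht : 0 < t) :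
    log (b - t * I) = Real.log t - Real.pi / 2 * I + log (1 + (b / t : ℝ) * I) := by
  have ht0 : (t : ℂ) ≠ 0 := ofReal_ne_zero.2 ht.ne'
  set w : ℂ := 1 + (b / t : ℝ) * I with hw
  have hwre : w.re = 1 := by simp [hw, div_re]
  have hw0 : w ≠ 0 := by intro h; rw [h] at hwre; simp at hwre
  have e : (b : ℂ) - t * I = t * (-I * w) := by
    rw [hw]
    push_cast
    field_simp
    linear_combination (b : ℂ) * I_sq
  have harg := abs_lt.1 (abs_arg_lt_pi_div_two_iff.2 (Or.inl (by rw [hwre]; exact one_pos)) :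
    |w.arg| < Real.pi / 2)
  rw [e, log_ofReal_mul ht (mul_ne_zero (neg_ne_zero.2 I_ne_zero) hw0),
    log_mul (neg_ne_zero.2 I_ne_zero) hw0 (by
      rw [arg_neg_I]; constructor <;> linarith [Real.pi_pos]), log_neg_I]
  ring

lemma norm_log_one_add_div_sub_le (hb : 1 ≤ b) (hb2 : b ≤ 2) (ht : 4 ≤ t) :
    ‖log (1 + (b / t : ℝ) * I) - (b / t : ℝ) * I‖ ≤ 4 / t ^ 2 := by
  have ht0 : 0 < t := by linarith
  have hu : ‖((b / t : ℝ) : ℂ) * I‖ = b / t := by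
    rw [norm_mul, norm_I, mul_one, norm_real, Real.norm_of_nonneg (by positivity)]
  have h1 : b / t ≤ 2 / t := by gcongr
  have h2 : 2 / t ≤ 1 / 2 := by rw [div_le_iff₀ ht0]; linarith
  have hp : 0 ≤ b / t := by positivity
  have := norm_log_one_add_sub_self_le (z := ((b / t : ℝ) : ℂ) * I) (by rw [hu]; linarith)
  rw [hu] at this
  have h3 : (1 - b / t)⁻¹ ≤ 2 := by
    rw [inv_le_comm₀ (by linarith) two_pos]; linarith
  have h4 : (b / t) ^ 2 ≤ 4 / t ^ 2 := by
    calc (b / t) ^ 2 ≤ (2 / t) ^ 2 := pow_le_pow_left₀ hp h1 2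
      _ = _ := by ring
  have h5 : (b / t) ^ 2 * (1 - b / t)⁻¹ ≤ (b / t) ^ 2 * 2 :=
    mul_le_mul_of_nonneg_left h3 (by positivity)
  linarith

lemma norm_log_one_add_div_le (hb : 1 ≤ b) (hb2 : b ≤ 2) (ht : 4 ≤ t) :
    ‖log (1 + (b / t : ℝ) * I)‖ ≤ 3 / t := by
  have ht0 : 0 < t := by linarith
  have hu : ‖((b / t : ℝ) : ℂ) * I‖ = b / t := by
    rw [norm_mul, norm_I, mul_one, norm_real, Real.norm_of_nonneg (by positivity)]
  have h1 := norm_le_norm_add_norm_sub' (log (1 + (b / t : ℝ) * I)) ((b / t : ℝ) * I)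
  have h2 := norm_log_one_add_div_sub_le hb hb2 ht
  have h3 : b / t ≤ 2 / t := by gcongr
  have h4 : 4 / t ^ 2 ≤ 1 / t := by
    rw [div_le_div_iff₀ (by positivity) ht0]; nlinarith
  have h5 : 3 / t = 2 / t + 1 / t := by ring
  rw [hu] at h1
  linarith

lemma le_norm_sub_mul_I : t ≤ ‖(b : ℂ) - t * I‖ := by
  have := abs_im_le_norm ((b : ℂ) - t * I)
  simp only [sub_im, ofReal_im, mul_im, ofReal_re, I_im, mul_one, I_re, mul_zero, add_zero,
    zero_sub, abs_neg] at this
  exact (le_abs_self t).trans this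

lemma exists_norm_Gamma_eq (hb : 1 ≤ b) (hb2 : b ≤ 2) (ht : 4 ≤ t) :
    ∃ ε : ℝ, |ε| ≤ 12 / t ∧ ‖Gamma (b - t * I)‖ =
      √(2 * Real.pi) * (t ^ (b - 1 / 2) * Real.exp (-(Real.pi * t / 2)) * Real.exp ε) := by
  have ht0 : 0 < t := by linarith
  have htc : (t : ℂ) ≠ 0 := ofReal_ne_zero.2 ht0.ne'
  have hre : ((b : ℂ) - t * I).re = b := by simp
  have hn := le_norm_sub_mul_I (b := b) (t := t)
  set z : ℂ := b - t * I with hz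
  set l := log (1 + (b / t : ℝ) * I)
  set u : ℂ := (b / t : ℝ) * I with hu
  refine ⟨((z - 1 / 2) * (l - u) + (b - 1 / 2) * u + stirlingRemainder z).re, ?_, ?_⟩
  · refine (abs_re_le_norm _).trans ?_
    have h1 : ‖z - 1 / 2‖ ≤ 2 * t := by
      have e : z - 1 / 2 = ((b - 1 / 2 : ℝ) : ℂ) - t * I := by rw [hz]; push_cast; ring
      rw [e]
      refine (norm_sub_le _ _).trans ?_
      rw [norm_mul, norm_I, mul_one, norm_real, norm_real, Real.norm_of_nonneg (by linarith),
        Real.norm_of_nonneg ht0.le]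
      linarith
    have h2 : ‖(z - 1 / 2) * (l - u)‖ ≤ 8 / t := by
      rw [norm_mul]
      refine (mul_le_mul h1 (norm_log_one_add_div_sub_le hb hb2 ht) (norm_nonneg _)
        (by positivity)).trans (le_of_eq ?_)
      field_simp
      norm_num
    have h3 : ‖((b : ℂ) - 1 / 2) * u‖ ≤ 3 / t := by
      rw [show (b : ℂ) - 1 / 2 = ((b - 1 / 2 : ℝ) : ℂ) by push_cast; ring, hu, norm_mul, norm_mul,
        norm_I, mul_one, norm_real, norm_real, Real.norm_of_nonneg (by linarith),
        Real.norm_of_nonneg (by positivity), ← mul_div_assoc]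
      gcongr
      nlinarith
    have h4 : ‖stirlingRemainder z‖ ≤ 1 / t :=
      (norm_stirlingRemainder_le (by rw [hre]; linarith) (by linarith)).trans
        (one_div_le_one_div_of_le ht0 hn)
    have h5 : 12 / t = 8 / t + 3 / t + 1 / t := by ring
    rw [h5]
    exact (norm_add₃_le).trans (add_le_add (add_le_add h2 h3) h4)
  · have e : (z - 1 / 2) * log z - z + stirlingRemainder z =
        ((b - 1 / 2 : ℝ) - t * I) * (Real.log t - Real.pi / 2 * I) + t * I +
        ((z - 1 / 2) * (l - u) + (b - 1 / 2) * u + stirlingRemainder z) := by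
      rw [log_sub_mul_I ht0]
      have : (z - 1 / 2) * u = (b - 1 / 2) * u + b := by
        rw [hz, hu]; push_cast; field_simp; linear_combination (-2 * b : ℂ) * t * I_sq
      rw [show ((b - 1 / 2 : ℝ) : ℂ) = b - 1 / 2 by push_cast; ring]
      change (z - 1 / 2) * (_ + l) - z + _ = _
      clear_value l u
      rw [hz] at this ⊢
      linear_combination this
    rw [Gamma_eq_exp_stirling (by rw [hre]; linarith), norm_mul, norm_real,
      Real.norm_of_nonneg (Real.sqrt_nonneg _), norm_exp, e,
      Real.rpow_def_of_pos ht0, ← Real.exp_add, ← Real.exp_add]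
    congr 2
    simp
    ring

end stirling

section chi

/-- The factor relating the two sides of the approximate functional equation at `σ + it`. -/
noncomputable def chi (σ t : ℝ) : ℂ :=
  ((2 * Real.pi : ℝ) : ℂ) ^ ((σ : ℂ) + t * I - 1) * I ^ (1 - ((σ : ℂ) + t * I)) *
    Gamma (1 - ((σ : ℂ) + t * I))

variable {σ t : ℝ}

lemma one_sub_ne_zero (ht : 0 < t) : 1 - ((σ : ℂ) + t * I) ≠ 0 := by
  intro h
  have := congrArg im h
  simp at this
  linarith

lemma Gamma_one_sub (ht : 0 < t) : Gamma (1 - ((σ : ℂ) + t * I)) =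
    Gamma (((2 - σ : ℝ) : ℂ) - t * I) / (1 - ((σ : ℂ) + t * I)) := by
  rw [eq_div_iff (one_sub_ne_zero ht), mul_comm, ← Gamma_add_one _ (one_sub_ne_zero ht)]
  congr 1
  push_cast
  ring

lemma norm_chi_sq (hσ : 0 ≤ σ) (hσ1 : σ ≤ 1) (ht : 4 ≤ t) :
    ∃ ε : ℝ, |ε| ≤ 24 / t ∧ ‖chi σ t‖ ^ 2 = (t / (2 * Real.pi)) ^ (1 - 2 * σ) *
      (Real.exp ε * (t ^ 2 / (t ^ 2 + (1 - σ) ^ 2))) := by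
  have ht0 : 0 < t := by linarith
  have hp : 0 < 2 * Real.pi := by positivity
  obtain ⟨ε, hε, h⟩ := exists_norm_Gamma_eq (b := 2 - σ) (t := t) (by linarith) (by linarith) ht
  refine ⟨2 * ε, ?_, ?_⟩
  · rw [abs_mul, abs_two, show 24 / t = 2 * (12 / t) by ring]
    linarith
  · have h1 : ‖(1 : ℂ) - ((σ : ℂ) + t * I)‖ ^ 2 = t ^ 2 + (1 - σ) ^ 2 := by
      rw [← normSq_eq_norm_sq, normSq_apply]
      simp
      ring
    have h2 : ‖I ^ (1 - ((σ : ℂ) + t * I))‖ = Real.exp (Real.pi * t / 2) := by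
      rw [cpow_def_of_ne_zero I_ne_zero, norm_exp, log_I]
      congr 1
      simp
      ring
    have h3 : ‖((2 * Real.pi : ℝ) : ℂ) ^ ((σ : ℂ) + t * I - 1)‖ = (2 * Real.pi) ^ (σ - 1) := by
      rw [norm_cpow_eq_rpow_re_of_pos hp]
      simp
    rw [chi, Gamma_one_sub ht0, norm_mul, norm_mul, norm_div, h, h2, h3]
    rw [mul_pow, mul_pow, div_pow, h1, mul_pow, mul_pow, mul_pow, Real.sq_sqrt hp.le,
      Real.div_rpow ht0.le hp.le, Real.exp_neg, two_mul ε, Real.exp_add, ← Real.rpow_natCast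
      (t ^ (2 - σ - 1 / 2)), ← Real.rpow_natCast ((2 * Real.pi) ^ (σ - 1)), ← Real.rpow_mul ht0.le,
      ← Real.rpow_mul hp.le]
    have e1 : t ^ ((2 - σ - 1 / 2) * ((2 : ℕ) : ℝ)) = t ^ (1 - 2 * σ) * t ^ 2 := by
      rw [← Real.rpow_natCast t 2, ← Real.rpow_add ht0]
      congr 1
      push_cast
      ring
    have e2 : (2 * Real.pi) ^ ((σ - 1) * ((2 : ℕ) : ℝ)) * (2 * Real.pi) =
        ((2 * Real.pi) ^ (1 - 2 * σ))⁻¹ := by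
      rw [← Real.rpow_add_one hp.ne', ← Real.rpow_neg hp.le]
      congr 1
      push_cast
      ring
    rw [e1]
    have h4 : t ^ 2 + (1 - σ) ^ 2 ≠ 0 := by positivity
    have e3 := Real.exp_ne_zero (Real.pi * t / 2)
    calc _ = ((2 * Real.pi) ^ ((σ - 1) * ((2 : ℕ) : ℝ)) * (2 * Real.pi)) *
          (t ^ (1 - 2 * σ) * (Real.exp ε * Real.exp ε * (t ^ 2 / (t ^ 2 + (1 - σ) ^ 2)))) := by
          field_simp
      _ = _ := by rw [e2]; ring

lemma abs_norm_chi_sq_sub_le (hσ : 0 ≤ σ) (hσ1 : σ ≤ 1) (ht : 48 ≤ t) :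
    |‖chi σ t‖ ^ 2 - (t / (2 * Real.pi)) ^ (1 - 2 * σ)| ≤
      50 / t * (t / (2 * Real.pi)) ^ (1 - 2 * σ) := by
  have ht0 : 0 < t := by linarith
  obtain ⟨ε, hε, h⟩ := norm_chi_sq hσ hσ1 (by linarith : 4 ≤ t)
  have hq : 0 ≤ (t / (2 * Real.pi)) ^ (1 - 2 * σ) := by positivity
  rw [h, show ∀ q r : ℝ, q * r - q = q * (r - 1) by intros; ring, abs_mul, abs_of_nonneg hq,
    mul_comm]
  refine mul_le_mul_of_nonneg_right ?_ hq
  have h24 : 24 / t ≤ 1 / 2 := by rw [div_le_iff₀ ht0]; linarith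
  have he : |Real.exp ε - 1| ≤ 48 / t := by
    refine (Real.abs_exp_sub_one_le (by linarith)).trans ?_
    rw [show 48 / t = 2 * (24 / t) by ring]
    linarith
  set q := t ^ 2 / (t ^ 2 + (1 - σ) ^ 2) with hqd
  have hd : 0 < t ^ 2 + (1 - σ) ^ 2 := by positivity
  have hq1 : q ≤ 1 := by rw [hqd, div_le_one hd]; nlinarith [sq_nonneg (1 - σ)]
  have hq0 : 0 ≤ q := by positivity
  have hq2 : 1 - q ≤ 1 / t := by
    have : 1 - q = (1 - σ) ^ 2 / (t ^ 2 + (1 - σ) ^ 2) := by rw [hqd]; field_simp; ring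
    rw [this, div_le_div_iff₀ hd ht0]
    have : (1 - σ) ^ 2 ≤ 1 := by nlinarith
    nlinarith [mul_le_mul_of_nonneg_right this ht0.le]
  have e : Real.exp ε * q - 1 = (Real.exp ε - 1) * q - (1 - q) := by ring
  have h50 : 50 / t = 48 / t + 2 * (1 / t) := by ring
  have hit : 0 < 1 / t := by positivity
  rw [e]
  refine (abs_sub _ _).trans ?_
  rw [abs_mul, abs_of_nonneg hq0, abs_of_nonneg (by linarith : 0 ≤ 1 - q)]
  have : |Real.exp ε - 1| * q ≤ |Real.exp ε - 1| * 1 :=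
    mul_le_mul_of_nonneg_left hq1 (abs_nonneg _)
  linarith

lemma norm_chi_sq_le (hσ : 0 ≤ σ) (hσ1 : σ ≤ 1) (ht : 48 ≤ t) :
    ‖chi σ t‖ ^ 2 ≤ 3 * (t / (2 * Real.pi)) ^ (1 - 2 * σ) := by
  have h := (abs_le.1 (abs_norm_chi_sq_sub_le hσ hσ1 ht)).2
  have hq : 0 ≤ (t / (2 * Real.pi)) ^ (1 - 2 * σ) := by positivity
  have h2 : 50 / t ≤ 2 := by rw [div_le_iff₀ (by linarith)]; linarith
  have := mul_le_mul_of_nonneg_right h2 hq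
  linarith

/-- The relative deviation of the logarithmic derivative of `chi σ` from `-I * log (t / (2π))`. -/
noncomputable def chiError (σ t : ℝ) : ℂ :=
  I * (1 / (1 - ((σ : ℂ) + t * I)) + 1 / (2 * (((2 - σ : ℝ) : ℂ) - t * I)) -
    deriv stirlingRemainder (((2 - σ : ℝ) : ℂ) - t * I) - log (1 + ((2 - σ) / t : ℝ) * I))

lemma hasDerivAt_chi (hσ1 : σ ≤ 1) (ht : 0 < t) :
    HasDerivAt (chi σ)
      ((-(I * Real.log (t / (2 * Real.pi))) + chiError σ t) * chi σ t) t := by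
  have hp : 0 < 2 * Real.pi := by positivity
  have hs0 := one_sub_ne_zero (σ := σ) ht
  have hz0 : ((2 - σ : ℝ) : ℂ) - t * I ≠ 0 := by
    intro h
    have := congrArg im h
    simp at this
    linarith
  have hline : HasDerivAt (fun t : ℝ => (σ : ℂ) + t * I) I t := by
    simpa using ((hasDerivAt_id t).ofReal_comp.mul_const I).const_add (σ : ℂ)
  have h1 := ((hasDerivAt_id ((σ : ℂ) + t * I - 1)).const_cpow (c := ((2 * Real.pi : ℝ) : ℂ))
    (Or.inl (ofReal_ne_zero.2 hp.ne'))).comp t (hline.sub_const 1)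
  have h2 := ((hasDerivAt_id (1 - ((σ : ℂ) + t * I))).const_cpow (c := I)
    (Or.inl I_ne_zero)).comp t (hline.const_sub 1)
  have h3 : HasDerivAt (fun t : ℝ => ((2 - σ : ℝ) : ℂ) - t * I) (-I) t := by
    simpa using ((hasDerivAt_id t).ofReal_comp.mul_const I).const_sub (((2 - σ : ℝ) : ℂ))
  have hre : (((2 - σ : ℝ) : ℂ) - t * I).re = 2 - σ := by simp
  have h4 := (hasDerivAt_Gamma (by rw [hre]; linarith)).comp t h3
  have h5 := (h1.mul h2).mul (h4.div (hline.const_sub 1) hs0)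
  refine (h5.congr_of_eventuallyEq ?_).congr_deriv ?_
  · filter_upwards [lt_mem_nhds ht] with x hx
    rw [chi, Gamma_one_sub hx]
    rfl
  · rw [chi, Gamma_one_sub ht, chiError, log_sub_mul_I ht, log_I, ← ofReal_log hp.le,
      Real.log_div ht.ne' hp.ne', ofReal_sub (Real.log t)]
    simp only [Function.comp_apply, Pi.mul_apply, Pi.div_apply, id]
    generalize Gamma (((2 - σ : ℝ) : ℂ) - t * I) = g
    generalize deriv stirlingRemainder (((2 - σ : ℝ) : ℂ) - t * I) = d
    generalize log (1 + ((2 - σ) / t : ℝ) * I) = l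
    generalize ((2 * Real.pi : ℝ) : ℂ) ^ ((σ : ℂ) + t * I - 1) = p
    generalize I ^ (1 - ((σ : ℂ) + t * I)) = q
    generalize ((2 - σ : ℝ) : ℂ) - t * I = z at hz0 ⊢
    generalize 1 - ((σ : ℂ) + t * I) = w at hs0 ⊢
    generalize ((Real.log t : ℝ) : ℂ) = L
    generalize ((Real.log (2 * Real.pi) : ℝ) : ℂ) = M
    field_simp
    ring_nf

lemma norm_chiError_le (hσ : 0 ≤ σ) (hσ1 : σ ≤ 1) (ht : 4 ≤ t) : ‖chiError σ t‖ ≤ 9 / t := by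
  have ht0 : 0 < t := by linarith
  have hre : (((2 - σ : ℝ) : ℂ) - t * I).re = 2 - σ := by simp
  have hn := le_norm_sub_mul_I (b := 2 - σ) (t := t)
  have hn1 := le_norm_sub_mul_I (b := 1 - σ) (t := t)
  rw [show ((1 - σ : ℝ) : ℂ) - t * I = 1 - ((σ : ℂ) + t * I) by push_cast; ring] at hn1
  have b1 : ‖1 / (1 - ((σ : ℂ) + t * I))‖ ≤ 1 / t := by
    rw [norm_div, norm_one]
    exact one_div_le_one_div_of_le ht0 hn1
  have b2 : ‖1 / (2 * (((2 - σ : ℝ) : ℂ) - t * I))‖ ≤ 1 / t := by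
    rw [norm_div, norm_one, norm_mul, norm_ofNat]
    exact one_div_le_one_div_of_le ht0 (by linarith)
  have b3 := (norm_deriv_stirlingRemainder_le (z := ((2 - σ : ℝ) : ℂ) - t * I)
    (by rw [hre]; linarith) (by linarith)).trans (div_le_div_of_nonneg_left (by norm_num) ht0 hn)
  have b4 := norm_log_one_add_div_le (b := 2 - σ) (t := t) (by linarith) (by linarith) ht
  rw [chiError, norm_mul, norm_I, one_mul]
  have e : 9 / t = 1 / t + 1 / t + 4 / t + 3 / t := by ring
  rw [e]
  exact (norm_sub_le _ _).trans (add_le_add ((norm_sub_le _ _).trans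
    (add_le_add ((norm_add_le _ _).trans (add_le_add b1 b2)) b3)) b4)

end chi

section dual

variable {a lam σ t : ℝ}

/-- The summand of the dual sum in the approximate functional equation. -/
noncomputable def dualCoeff (a lam σ t : ℝ) (k : ℕ) : ℂ :=
  chi σ t * (exp (-(2 * Real.pi * I * (k + lam) * a)) *
    ((k + lam : ℝ) : ℂ) ^ ((σ : ℂ) + t * I - 1))

lemma norm_dualCoeff (h0 : 0 < lam) (k : ℕ) :
    ‖dualCoeff a lam σ t k‖ = ‖chi σ t‖ * (k + lam) ^ (σ - 1) := by
  have hν : 0 < (k : ℝ) + lam := by positivity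
  rw [dualCoeff, norm_mul, norm_mul, norm_cpow_eq_rpow_re_of_pos hν,
    show -(2 * (Real.pi : ℂ) * I * (k + lam) * a) =
      2 * Real.pi * I * ((-((k + lam) * a) : ℝ) : ℂ) by
      push_cast; ring, norm_exp_two_pi_mul]
  simp

lemma dualCoeff_eq (h0 : 0 < lam) (k : ℕ) : dualCoeff a lam σ t k =
    exp (-(2 * Real.pi * I * (k + lam) * a)) *
      (((2 * Real.pi * (k + lam) : ℝ) : ℂ) ^ ((σ : ℂ) + t * I - 2) * (2 * Real.pi * (k + lam) : ℝ) *
      (I * (I ^ (-((σ : ℂ) + t * I)) * Gamma (1 - ((σ : ℂ) + t * I))))) := by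
  have hν : 0 < (k : ℝ) + lam := by positivity
  have hp : 0 < 2 * Real.pi := by positivity
  have hq : ((2 * Real.pi * (k + lam) : ℝ) : ℂ) ≠ 0 := ofReal_ne_zero.2 (by positivity)
  have e1 : ((2 * Real.pi * (k + lam) : ℝ) : ℂ) ^ ((σ : ℂ) + t * I - 2) *
      (2 * Real.pi * (k + lam) : ℝ) = ((2 * Real.pi : ℝ) : ℂ) ^ ((σ : ℂ) + t * I - 1) *
      ((k + lam : ℝ) : ℂ) ^ ((σ : ℂ) + t * I - 1) := by
    rw [← mul_cpow_ofReal_nonneg hp.le hν.le, ← ofReal_mul,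
      show (σ : ℂ) + t * I - 1 = (σ : ℂ) + t * I - 2 + 1 by ring, cpow_add _ _ hq, cpow_one]
  rw [e1, dualCoeff, chi, show 1 - ((σ : ℂ) + t * I) = -((σ : ℂ) + t * I) + 1 by ring,
    cpow_add _ _ I_ne_zero, cpow_one]
  ring

lemma norm_dualStat_sub_le (h0 : 0 < lam) (hσ : 0 ≤ σ) (hσ1 : σ ≤ 1) (ht : 0 < t) {c : ℝ}
    (hc : 0 < c) (k : ℕ) :
    ‖exp (-(2 * Real.pi * I * lam * a)) * dualStat a lam (σ + t * I) c (k : ℕ) -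
      ((1 - cut c (t / (2 * Real.pi * (k + lam))) : ℝ) : ℂ) * dualCoeff a lam σ t k‖ ≤
      2 / t * ‖dualCoeff a lam σ t k‖ := by
  have hν : 0 < (k : ℝ) + lam := by positivity
  have him : ((σ : ℂ) + t * I).im = t := by simp
  have e1 : exp (-(2 * Real.pi * I * lam * a)) * exp (-(2 * Real.pi * I * ((k : ℤ) : ℂ) * a)) =
      exp (-(2 * Real.pi * I * (k + lam) * a)) := by
    rw [← exp_add]; push_cast; congr 1; ring
  have hcc : (c : ℂ) ≠ 0 := ofReal_ne_zero.2 hc.ne'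
  set p : ℝ := 2 * Real.pi * (k + lam) with hp
  have hp0 : 0 < p := by positivity
  have hpc : (p : ℂ) ≠ 0 := ofReal_ne_zero.2 hp0.ne'
  set E := exp (-(2 * Real.pi * I * (k + lam) * a)) with hE
  set P := (p : ℂ) ^ ((σ : ℂ) + t * I - 2) with hP
  set G := I ^ (-((σ : ℂ) + t * I)) * Gamma (1 - ((σ : ℂ) + t * I)) with hG
  have hD : dualCoeff a lam σ t k = E * (P * p * (I * G)) := dualCoeff_eq h0 k
  have hphase : ∀ x, phaseStat (σ + t * I) (((k : ℤ) : ℝ) + lam) x =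
      if p * x < t then P * (-(G * (1 - (σ + t * I) + (p * x : ℝ) * I))) else 0 := by
    intro x
    rw [phaseStat, Int.cast_natCast, if_pos hν, oscStat, him, oscMain, mul_ite, mul_zero]
  have hL : exp (-(2 * Real.pi * I * lam * a)) * dualStat a lam (σ + t * I) c (k : ℕ) =
      E * (((if p * c < t then P * (-(G * (1 - (σ + t * I) + (p * c : ℝ) * I))) else 0) -
        (if p * (2 * c) < t then P * (-(G * (1 - (σ + t * I) + (p * (2 * c) : ℝ) * I))) else 0))
        / c) := by
    rw [dualStat, hphase, hphase, ← mul_assoc, e1]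
  rw [hL]
  have hn : 0 ≤ 2 / t * ‖dualCoeff a lam σ t k‖ := by positivity
  rcases le_or_gt t (p * c) with h1 | h1
  · have h2 : t ≤ p * (2 * c) := h1.trans (by nlinarith [mul_pos hp0 hc])
    rw [if_neg h1.not_gt, if_neg h2.not_gt, cut_eq_one hc (by rwa [div_le_iff₀ hp0, mul_comm])]
    simpa using hn
  rw [if_pos h1]
  rcases le_or_gt t (p * (2 * c)) with h2 | h2
  · rw [if_neg h2.not_gt, cut_eq_sub hc (by rw [le_div_iff₀ hp0, mul_comm]; exact h1.le)
      (by rwa [div_le_iff₀ hp0, mul_comm])]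
    have e : E * ((P * (-(G * (1 - (σ + t * I) + (p * c : ℝ) * I))) - 0) / c) -
        ((1 - (2 - t / p / c) : ℝ) : ℂ) * dualCoeff a lam σ t k =
        (((1 - σ) / (p * c) : ℝ) : ℂ) * (I * dualCoeff a lam σ t k) := by
      rw [hD]
      push_cast
      field_simp
      linear_combination (- E * P * G * (1 - σ)) * I_sq
    rw [e, norm_mul, norm_mul, norm_I, one_mul, norm_real,
      Real.norm_of_nonneg (div_nonneg (by linarith) (by positivity))]
    refine mul_le_mul_of_nonneg_right ?_ (norm_nonneg _)
    rw [div_le_div_iff₀ (by positivity) ht]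
    nlinarith
  · rw [if_pos h2, cut_eq_zero hc (by rw [le_div_iff₀ hp0, mul_comm]; exact h2.le)]
    have e : E * ((P * (-(G * (1 - (σ + t * I) + (p * c : ℝ) * I))) -
        P * (-(G * (1 - (σ + t * I) + (p * (2 * c) : ℝ) * I)))) / c) -
        ((1 - 0 : ℝ) : ℂ) * dualCoeff a lam σ t k = 0 := by
      rw [hD]
      push_cast
      field_simp
      ring
    rw [e, norm_zero]
    exact hn

/-- The main terms of the approximate functional equation. -/
noncomputable def mainSum (a lam σ c : ℝ) (N : ℕ) (t : ℝ) : ℂ :=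
  ∑ m ∈ range N, (cut c (m + a) : ℂ) * lerchTerm a lam (σ + t * I) m

/-- The dual terms of the approximate functional equation. -/
noncomputable def dualSum (a lam σ c : ℝ) (N : ℕ) (t : ℝ) : ℂ :=
  ∑ k ∈ range N, ((1 - cut c (t / (2 * Real.pi * (k + lam))) : ℝ) : ℂ) * dualCoeff a lam σ t k

lemma exists_norm_zetaL_sub_sums_le (ha : 0 < a) (ha1 : a ≤ 1) (h0 : 0 < lam) (h1 : lam < 1)
    (hσ : 1 / 2 ≤ σ) (hσ1 : σ < 1) :
    ∃ C, 0 < C ∧ ∀ (t c : ℝ) (N : ℕ), 1 ≤ t → 0 < c → 2 * c ≤ N → t / (2 * Real.pi * c) ≤ N →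
      ‖zetaL a lam (σ + t * I) - (mainSum a lam σ c N t + dualSum a lam σ c N t)‖ ≤
        C * (c ^ (-σ - 1) * (1 + c ^ 2 / t)) +
          2 / t * (‖chi σ t‖ * ∑ k ∈ range N, ((k : ℝ) + lam) ^ (σ - 1)) := by
  obtain ⟨C, hC, h⟩ := exists_norm_zetaL_sub_le ha ha1 h0 h1 hσ hσ1
  refine ⟨C, hC, fun t c N ht hc hN hN2 => ?_⟩
  have him : ((σ : ℂ) + t * I).im = t := by simp
  have b1 := h (σ + t * I) c N (by simp) (by rw [him]; exact ht) hc hN (by rw [him]; exact hN2)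
  rw [him] at b1
  have b2 : ‖exp (-(2 * Real.pi * I * lam * a)) *
      ∑ k ∈ range N, dualStat a lam (σ + t * I) c (k : ℕ) - dualSum a lam σ c N t‖ ≤
      2 / t * (‖chi σ t‖ * ∑ k ∈ range N, ((k : ℝ) + lam) ^ (σ - 1)) := by
    rw [dualSum, mul_sum, ← sum_sub_distrib, mul_sum, mul_sum]
    refine norm_sum_le_of_le _ fun k _ => ?_
    rw [← norm_dualCoeff (a := a) h0]
    exact norm_dualStat_sub_le h0 (by linarith) hσ1.le (by linarith) hc k
  refine le_trans (le_of_eq ?_) ((norm_add_le _ _).trans (add_le_add b1 b2))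
  rw [mainSum]
  congr 1
  ring

end dual

section oscillatory

lemma norm_integral_le_of_hasDerivAt {F r : ℝ → ℂ} {θ θ' : ℝ → ℝ} {x q M δ R κ : ℝ} (hx : 0 < x)
    (hxq : x ≤ q) (hδ : 0 < δ) (hR : 0 ≤ R)
    (hF : ∀ t, 0 < t → HasDerivAt F ((I * θ t + r t) * F t) t)
    (hθ : ∀ t ∈ Set.Icc x q, HasDerivAt θ (θ' t) t) (hM : ∀ t ∈ Set.Icc x q, ‖F t‖ ≤ M)
    (hlow : ∀ t ∈ Set.Icc x q, δ ≤ |θ t|) (hr : ∀ t ∈ Set.Icc x q, ‖r t‖ ≤ R)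
    (hθ' : ∀ t ∈ Set.Icc x q, |θ' t| ≤ κ) :
    ‖∫ t in x..q, F t‖ ≤ M * (2 / δ + (q - x) * (R / δ + κ / δ ^ 2)) := by
  have hcont : ContinuousOn F (Set.Ioi 0) :=
    fun t ht => (hF t ht).continuousAt.continuousWithinAt
  have hsub : ∀ u, 0 < u → IntervalIntegrable F volume x u := fun u hu =>
    (hcont.mono fun y hy => lt_of_lt_of_le (lt_min hx hu) hy.1).intervalIntegrable
  have hM0 : 0 ≤ M := (norm_nonneg _).trans (hM x (Set.left_mem_Icc.2 hxq))
  have hκ : 0 ≤ κ := (abs_nonneg _).trans (hθ' x (Set.left_mem_Icc.2 hxq))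
  have hθ0 : ∀ t ∈ Set.Icc x q, (θ t : ℂ) ≠ 0 := fun t ht =>
    ofReal_ne_zero.2 (abs_pos.1 (hδ.trans_le (hlow t ht)))
  have hbd : ∀ t ∈ Set.Icc x q, ‖F t / (I * θ t)‖ ≤ M / δ := fun t ht => by
    rw [norm_div, norm_mul, norm_I, one_mul, norm_real]
    exact div_le_div₀ hM0 (hM t ht) hδ (hlow t ht)
  have key := norm_sub_le_of_hasDerivAt (f := fun u => (∫ t in x..u, F t) - F u / (I * θ u))
    (f' := fun u => -(r u * F u / (I * θ u)) + F u * θ' u / (I * θ u ^ 2))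
    (B := fun u => M * (R / δ + κ / δ ^ 2) * u) (B' := fun _ => M * (R / δ + κ / δ ^ 2)) hxq
    (fun u hu => ?_) (fun u _ => ?_) (fun u hu => ?_)
  · simp only [intervalIntegral.integral_same] at key
    have e : ∫ t in x..q, F t = ((∫ t in x..q, F t) - F q / (I * θ q) - (0 - F x / (I * θ x))) +
        (F q / (I * θ q) - F x / (I * θ x)) := by ring
    rw [e]
    refine (norm_add_le _ _).trans ?_
    have h1 := (norm_sub_le (F q / (I * θ q)) (F x / (I * θ x))).trans
      (add_le_add (hbd q (Set.right_mem_Icc.2 hxq)) (hbd x (Set.left_mem_Icc.2 hxq)))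
    refine (add_le_add key h1).trans (le_of_eq ?_)
    ring
  · have hu0 : 0 < u := hx.trans_le hu.1
    have h1 := intervalIntegral.integral_hasDerivAt_right (hsub u hu0)
      (hcont.stronglyMeasurableAtFilter isOpen_Ioi u hu0) (hF u hu0).continuousAt
    have h2 := (hF u hu0).div ((hθ u hu).ofReal_comp.const_mul I)
      (mul_ne_zero I_ne_zero (hθ0 u hu))
    refine (h1.sub h2).congr_deriv ?_
    have := hθ0 u hu
    field_simp
    ring
  · simpa using (hasDerivAt_id u).const_mul (M * (R / δ + κ / δ ^ 2))
  · have h1 := hM u hu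
    have h2 := hlow u hu
    have h3 : ‖r u * F u / (I * θ u)‖ ≤ R * M / δ := by
      rw [norm_div, norm_mul, norm_mul, norm_I, one_mul, norm_real]
      exact div_le_div₀ (by positivity)
        (mul_le_mul (hr u hu) h1 (norm_nonneg _) hR) hδ h2
    have h4 : ‖F u * θ' u / (I * θ u ^ 2)‖ ≤ M * κ / δ ^ 2 := by
      rw [norm_div, norm_mul, norm_mul, norm_I, one_mul, norm_pow, norm_real, norm_real]
      exact div_le_div₀ (by positivity)
        (mul_le_mul h1 (hθ' u hu) (norm_nonneg _) hM0) (by positivity)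
        (pow_le_pow_left₀ hδ.le h2 2)
    refine (norm_add_le _ _).trans ?_
    rw [norm_neg]
    refine (add_le_add h3 h4).trans (le_of_eq ?_)
    ring

lemma norm_integral_ite_mul_le {S : Set ℝ} (hS : IsUpperSet S) [DecidablePred (· ∈ S)] {F : ℝ → ℂ}
    {p q B : ℝ} (hpq : p ≤ q) (hF : ContinuousOn F (Set.Icc p q)) (hB0 : 0 ≤ B)
    (hB : ∀ x ∈ Set.Icc p q, Set.Ioi x ⊆ S → ‖∫ t in x..q, F t‖ ≤ B) :
    ‖∫ t in p..q, (if t ∈ S then F t else 0)‖ ≤ B := by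
  by_cases hq : q ∈ S
  · set A := S ∩ Set.Icc p q with hA
    have hne : A.Nonempty := ⟨q, hq, Set.right_mem_Icc.2 hpq⟩
    have hbdd : BddBelow A := ⟨p, fun y hy => hy.2.1⟩
    set x := sInf A with hx
    have hxI : x ∈ Set.Icc p q :=
      ⟨le_csInf hne fun y hy => hy.2.1, csInf_le hbdd ⟨hq, Set.right_mem_Icc.2 hpq⟩⟩
    have hgt : Set.Ioi x ⊆ S := fun t ht => by
      obtain ⟨y, hy, hyt⟩ := exists_lt_of_csInf_lt hne ht
      exact hS hyt.le hy.1
    have h1 : ∫ t in p..x, (if t ∈ S then F t else 0) = 0 := by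
      rw [intervalIntegral.integral_congr_Ioo_of_le hxI.1 (g := fun _ => 0),
        intervalIntegral.integral_zero]
      intro t ht
      refine if_neg fun h => ?_
      exact (csInf_le hbdd ⟨h, ht.1.le, (ht.2.le.trans hxI.2)⟩).not_gt ht.2
    have hcong : Set.EqOn F (fun t => if t ∈ S then F t else 0) (Set.Ioo x q) := fun t ht => by
      simp only []
      rw [if_pos (hgt ht.1)]
    have hcong0 : Set.EqOn (fun _ => (0 : ℂ)) (fun t => if t ∈ S then F t else 0)
        (Set.Ioo p x) := fun t ht => by
      simp only []
      rw [if_neg fun h => ?_]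
      exact (csInf_le hbdd ⟨h, ht.1.le, (ht.2.le.trans hxI.2)⟩).not_gt ht.2
    have hi1 : IntervalIntegrable (fun t => if t ∈ S then F t else 0) volume x q :=
      (hF.mono (by
        rw [Set.uIcc_of_le hxI.2]
        exact Set.Icc_subset_Icc_left hxI.1)).intervalIntegrable.congr_uIoo
        (by rwa [Set.uIoo_of_le hxI.2])
    have hi0 : IntervalIntegrable (fun t => if t ∈ S then F t else 0) volume p x :=
      (intervalIntegrable_const (c := (0 : ℂ))).congr_uIoo (by rwa [Set.uIoo_of_le hxI.1])
    rw [← intervalIntegral.integral_add_adjacent_intervals hi0 hi1, h1, zero_add,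
      ← intervalIntegral.integral_congr_Ioo_of_le hxI.2 hcong]
    exact hB x hxI hgt
  · have : ∫ t in p..q, (if t ∈ S then F t else 0) = ∫ t in p..q, (0 : ℂ) := by
      refine intervalIntegral.integral_congr_Ioo_of_le hpq fun t ht => ?_
      exact if_neg fun h => hq (hS ht.2.le h)
    rw [this]
    simpa using hB0

lemma norm_integral_monotone_mul_le {w : ℝ → ℝ} (hw : Monotone w) (h0 : ∀ t, 0 ≤ w t)
    (h1 : ∀ t, w t ≤ 1) {F : ℝ → ℂ} {p q B : ℝ} (hpq : p ≤ q) (hF : ContinuousOn F (Set.Icc p q))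
    (hB0 : 0 ≤ B)
    (hB : ∀ x ∈ Set.Icc p q, (∀ t, x < t → 0 < w t) → ‖∫ t in x..q, F t‖ ≤ B) :
    ‖∫ t in p..q, (w t : ℂ) * F t‖ ≤ B := by
  classical
  have e : ∀ t, (w t : ℂ) * F t = ∫ u in (0 : ℝ)..1, (if 1 - w t < u then F t else 0) := by
    intro t
    have h := integral_ite_lt (x := 1 - w t) zero_le_one
    rw [sub_zero, sub_sub_cancel, min_eq_right (h1 t), max_eq_right (h0 t)] at h
    nth_rewrite 1 [← h]
    rw [← intervalIntegral.integral_ofReal, ← intervalIntegral.integral_mul_const]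
    refine intervalIntegral.integral_congr fun u _ => ?_
    split_ifs <;> simp
  have hmeas : MeasurableSet {z : ℝ × ℝ | 1 - w z.1 < z.2} :=
    measurableSet_lt ((measurable_const.sub hw.measurable).comp measurable_fst) measurable_snd
  have hswap : ∫ t in p..q, ∫ u in (0 : ℝ)..1, (if 1 - w t < u then F t else 0) =
      ∫ u in (0 : ℝ)..1, ∫ t in p..q, (if 1 - w t < u then F t else 0) := by
    have h_int : Integrable (Function.uncurry fun t u : ℝ => if 1 - w t < u then F t else 0)
        ((volume.restrict (Set.uIoc p q)).prod (volume.restrict (Set.Ioc (0 : ℝ) 1))) := by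
      have hF1 : Integrable F (volume.restrict (Set.uIoc p q)) := by
        have := (hF.mono (by rw [Set.uIcc_of_le hpq])).intervalIntegrable (μ := volume)
          (a := p) (b := q)
        rwa [intervalIntegrable_iff] at this
      have hF2 := hF1.comp_fst (volume.restrict (Set.Ioc (0 : ℝ) 1))
      have := hF2.indicator hmeas
      refine this.congr (Eventually.of_forall fun z => ?_)
      simp [Set.indicator_apply, Function.uncurry]
    simp_rw [intervalIntegral.integral_of_le (zero_le_one (α := ℝ))]
    exact intervalIntegral_integral_swap h_int
  have hin : ∀ u ∈ Set.uIoc (0 : ℝ) 1, ‖∫ t in p..q, (if 1 - w t < u then F t else 0)‖ ≤ B := by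
    intro u hu
    rw [Set.uIoc_of_le zero_le_one] at hu
    refine norm_integral_ite_mul_le (S := {t | 1 - w t < u}) ?_ hpq hF hB0 fun x hx hxS => ?_
    · intro y z hyz hy
      have := hw hyz
      change 1 - w z < u
      have hy' : 1 - w y < u := hy
      linarith
    · refine hB x hx fun t ht => ?_
      have : 1 - w t < u := hxS ht
      linarith [hu.2]
  have := intervalIntegral.norm_integral_le_of_norm_le_const hin
  simp_rw [e]
  rw [hswap]
  simpa using this

end oscillatory

section hurwitz

variable {lam : ℝ}

/-- The error of approximating `∫ u in k+λ..k+1+λ, u^(-s)` by the left endpoint. -/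
noncomputable def hurwitzDiff (lam : ℝ) (k : ℕ) (s : ℂ) : ℂ :=
  ((k + lam : ℝ) : ℂ) ^ (-s) -
    (((k + 1 + lam : ℝ) : ℂ) ^ (1 - s) - ((k + lam : ℝ) : ℂ) ^ (1 - s)) / (1 - s)

lemma hasDerivAt_ofReal_cpow_div {s : ℂ} (hs : s ≠ 1) {u : ℝ} (hu : 0 < u) :
    HasDerivAt (fun y : ℝ => (y : ℂ) ^ (1 - s) / (1 - s)) ((u : ℂ) ^ (-s)) u := by
  have := hasDerivAt_ofReal_cpow_const' hu.ne' (r := -s) (by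
    intro h; exact hs (by linear_combination -h))
  simpa only [show -s + 1 = 1 - s by ring] using this

lemma norm_hurwitzDiff_le (h0 : 0 < lam) {s : ℂ} (hs : 0 < s.re) (hs1 : s ≠ 1) (k : ℕ) :
    ‖hurwitzDiff lam k s‖ ≤ ‖s‖ * (k + lam) ^ (-s.re - 1) := by
  set v : ℝ := k + lam with hv
  have hv0 : 0 < v := by positivity
  have hs0 : s ≠ 0 := by rintro rfl; simp at hs
  have hd : ∀ u ∈ Set.Icc v (v + 1), ‖(v : ℂ) ^ (-s) - (u : ℂ) ^ (-s)‖ ≤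
      ‖s‖ * v ^ (-s.re - 1) := by
    intro u hu
    have := norm_sub_le_of_hasDerivAt (f := fun y : ℝ => (y : ℂ) ^ (-s))
      (f' := fun y => -s * (y : ℂ) ^ (-s - 1)) (B := fun y => ‖s‖ * v ^ (-s.re - 1) * y)
      (B' := fun _ => ‖s‖ * v ^ (-s.re - 1)) hu.1 (fun y hy => ?_) (fun y _ => ?_)
      (fun y hy => ?_)
    · rw [norm_sub_rev]
      refine this.trans ?_
      rw [← mul_sub]
      refine mul_le_of_le_one_right (by positivity) (by linarith [hu.2])
    · have h1 := (hasDerivAt_id (y : ℂ)).cpow_const (c := -s)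
        (Or.inl (by simpa using hv0.trans_le hy.1))
      simpa using h1.comp_ofReal
    · simpa using (hasDerivAt_id y).const_mul (‖s‖ * v ^ (-s.re - 1))
    · have hy0 : 0 < y := hv0.trans_le hy.1
      rw [norm_mul, norm_neg, norm_cpow_eq_rpow_re_of_pos hy0, sub_re, neg_re, one_re]
      exact mul_le_mul_of_nonneg_left
        (Real.rpow_le_rpow_of_nonpos hv0 hy.1 (by linarith)) (norm_nonneg _)
  have := norm_sub_le_of_hasDerivAt
    (f := fun y : ℝ => (y : ℂ) * (v : ℂ) ^ (-s) - (y : ℂ) ^ (1 - s) / (1 - s))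
    (f' := fun y => (v : ℂ) ^ (-s) - (y : ℂ) ^ (-s)) (B := fun y => ‖s‖ * v ^ (-s.re - 1) * y)
    (B' := fun _ => ‖s‖ * v ^ (-s.re - 1)) (by linarith : v ≤ v + 1) (fun y hy => ?_)
    (fun y _ => ?_) hd
  · refine le_trans (le_of_eq ?_) (this.trans (le_of_eq (by ring)))
    congr 1
    simp only [hurwitzDiff]
    rw [show (k : ℝ) + 1 + lam = v + 1 by rw [hv]; ring, ← hv]
    push_cast
    ring
  · have h1 := ((hasDerivAt_id (y : ℂ)).mul_const ((v : ℂ) ^ (-s))).comp_ofReal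
    have h2 := hasDerivAt_ofReal_cpow_div hs1 (hv0.trans_le hy.1)
    refine (h1.sub h2).congr_deriv ?_
    simp
  · simpa using (hasDerivAt_id y).const_mul (‖s‖ * v ^ (-s.re - 1))

lemma sum_hurwitzDiff (s : ℂ) (n : ℕ) : ∑ k ∈ range n, hurwitzDiff lam k s =
    ∑ k ∈ range n, ((k + lam : ℝ) : ℂ) ^ (-s) - ((n + lam : ℝ) : ℂ) ^ (1 - s) / (1 - s) +
      (lam : ℂ) ^ (1 - s) / (1 - s) := by
  induction n with
  | zero => simp
  | succ n ih =>
    rw [sum_range_succ, sum_range_succ, ih, hurwitzDiff]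
    push_cast
    ring

lemma summable_hurwitzDiff (h0 : 0 < lam) {s : ℂ} (hs : 0 < s.re) (hs1 : s ≠ 1) :
    Summable fun k => hurwitzDiff lam k s :=
  Summable.of_norm_bounded ((summable_add_rpow h0 (by linarith)).mul_left ‖s‖)
    (norm_hurwitzDiff_le h0 hs hs1)

lemma differentiableAt_tsum_hurwitzDiff (h0 : 0 < lam) (h1 : lam ≤ 1) {s : ℂ} (hs : 0 < s.re)
    (hs1 : s ≠ 1) : DifferentiableAt ℂ (fun s => ∑' k, hurwitzDiff lam k s) s := by
  set δ := s.re / 2 with hδ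
  have hδ0 : 0 < δ := by positivity
  set R := ‖s‖ + 1 with hR
  set U : Set ℂ := {w | δ < w.re} ∩ Metric.ball 0 R ∩ {1}ᶜ with hU
  have hUo : IsOpen U := ((isOpen_lt continuous_const continuous_re).inter
    Metric.isOpen_ball).inter isOpen_compl_singleton
  have hsU : s ∈ U := ⟨⟨by simp [hδ]; linarith, by simp [hR]⟩, hs1⟩
  refine (differentiableOn_tsum_of_summable_norm (U := U)
    (u := fun k : ℕ => R * (lam ^ (-R) * ((k : ℝ) + lam) ^ (-δ - 1)))
    (((summable_add_rpow h0 (by linarith)).mul_left _).mul_left _) (fun k => ?_) hUo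
    fun k w hw => ?_).differentiableAt (hUo.mem_nhds hsU)
  · intro w hw
    have hk : ((k + lam : ℝ) : ℂ) ≠ 0 := ofReal_ne_zero.2 (by positivity)
    have hk1 : ((k + 1 + lam : ℝ) : ℂ) ≠ 0 := ofReal_ne_zero.2 (by positivity)
    have hw1 : 1 - w ≠ 0 := sub_ne_zero.2 (Ne.symm hw.2)
    have d1 : DifferentiableAt ℂ (fun s : ℂ => -s) w := by fun_prop
    have d2 : DifferentiableAt ℂ (fun s : ℂ => 1 - s) w := by fun_prop
    exact ((d1.const_cpow (Or.inl hk)).sub (((d2.const_cpow (Or.inl hk1)).sub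
      (d2.const_cpow (Or.inl hk))).div d2 hw1)).differentiableWithinAt
  · have hwδ : δ < w.re := hw.1.1
    have hwR : ‖w‖ < R := by simpa using hw.1.2
    have hk : 0 < (k : ℝ) + lam := by positivity
    refine (norm_hurwitzDiff_le h0 (hδ0.trans hwδ) hw.2 k).trans ?_
    refine mul_le_mul hwR.le ?_ (by positivity) (by positivity)
    rw [show -w.re - 1 = -(w.re - δ) + (-δ - 1) by ring, Real.rpow_add hk]
    refine mul_le_mul_of_nonneg_right ?_ (by positivity)
    refine (Real.rpow_le_rpow_of_nonpos h0 (by simp) (by linarith)).trans ?_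
    refine Real.rpow_le_rpow_of_exponent_ge h0 h1 ?_
    have := (re_le_norm w)
    linarith

lemma isPreconnected_re_pos_diff_one : IsPreconnected ({s : ℂ | 0 < s.re} ∩ {1}ᶜ) := by
  have hA : IsPreconnected ({s : ℂ | 0 < s.re} ∩ {s : ℂ | 0 < s.im}) :=
    ((convex_halfSpace_re_gt 0).inter (convex_halfSpace_im_gt 0)).isPreconnected
  have hB : IsPreconnected {s : ℂ | 1 < s.re} := (convex_halfSpace_re_gt 1).isPreconnected
  have hC : IsPreconnected ({s : ℂ | 0 < s.re} ∩ {s : ℂ | s.im < 0}) :=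
    ((convex_halfSpace_re_gt 0).inter (convex_halfSpace_im_lt 0)).isPreconnected
  have hD : IsPreconnected ({s : ℂ | 0 < s.re} ∩ {s : ℂ | s.re < 1}) :=
    ((convex_halfSpace_re_gt 0).inter (convex_halfSpace_re_lt 1)).isPreconnected
  have h1 := hA.union (2 + I) (by simp) (by simp) hB
  have h2 := h1.union (2 - I) (by simp) (by simp) hC
  have h3 := h2.union (1 / 2 + I) (by simp) (by norm_num) hD
  convert h3 using 1
  ext s
  simp only [Set.mem_inter_iff, Set.mem_ofPred_eq, Set.mem_compl_iff, Set.mem_singleton_iff,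
    Set.mem_union, Complex.ext_iff, one_re, one_im]
  constructor
  · rintro ⟨h, h'⟩
    rcases lt_trichotomy s.im 0 with hi | hi | hi
    · simp [h, hi]
    · rcases lt_trichotomy s.re 1 with hr | hr | hr
      · simp [h, hr]
      · exact absurd ⟨hr, hi⟩ h'
      · simp [hr]
    · simp [h, hi]
  · rintro (((h | h) | h) | h)
    · exact ⟨h.1, fun h' => by linarith [h.2, h'.2]⟩
    · exact ⟨by linarith, fun h' => by linarith [h'.1]⟩
    · exact ⟨h.1, fun h' => by linarith [h.2, h'.2]⟩
    · exact ⟨h.1, fun h' => by linarith [h.2, h'.1]⟩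

lemma tsum_hurwitzDiff (h0 : 0 < lam) (h1 : lam ≤ 1) {s : ℂ} (hs : 0 < s.re) (hs1 : s ≠ 1) :
    ∑' k, hurwitzDiff lam k s = hzeta lam s + (lam : ℂ) ^ (1 - s) / (1 - s) := by
  have hlam : (lam : ℂ) ≠ 0 := ofReal_ne_zero.2 h0.ne'
  have hUo : IsOpen ({s : ℂ | 0 < s.re} ∩ {1}ᶜ) :=
    (isOpen_lt continuous_const continuous_re).inter isOpen_compl_singleton
  have hf : AnalyticOnNhd ℂ (fun s => ∑' k, hurwitzDiff lam k s) ({s : ℂ | 0 < s.re} ∩ {1}ᶜ) :=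
    DifferentiableOn.analyticOnNhd (fun w hw =>
      (differentiableAt_tsum_hurwitzDiff h0 h1 hw.1 hw.2).differentiableWithinAt) hUo
  have hg : AnalyticOnNhd ℂ (fun s => hzeta lam s + (lam : ℂ) ^ (1 - s) / (1 - s))
      ({s : ℂ | 0 < s.re} ∩ {1}ᶜ) := by
    refine DifferentiableOn.analyticOnNhd (fun w hw => ?_) hUo
    have d2 : DifferentiableAt ℂ (fun s : ℂ => 1 - s) w := by fun_prop
    exact ((HurwitzZeta.differentiableAt_hurwitzZeta (lam : UnitAddCircle) hw.2).add
      ((d2.const_cpow (Or.inl hlam)).div d2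
        (sub_ne_zero.2 (Ne.symm hw.2)))).differentiableWithinAt
  refine hf.eqOn_of_preconnected_of_eventuallyEq hg isPreconnected_re_pos_diff_one (z₀ := 2)
    ⟨by simp, by norm_num⟩ ?_ ⟨hs, hs1⟩
  filter_upwards [(isOpen_lt continuous_const continuous_re).mem_nhds
    (show (1 : ℝ) < (2 : ℂ).re by norm_num)] with w hw
  have hw' : 1 < w.re := hw
  have hw1 : w ≠ 1 := by rintro rfl; simp at hw'
  have hH := (HurwitzZeta.hasSum_hurwitzZeta_of_one_lt_re ⟨h0.le, h1⟩ hw').tendsto_sum_nat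
  have ht : Tendsto (fun n : ℕ => ((n + lam : ℝ) : ℂ) ^ (1 - w) / (1 - w)) atTop (nhds 0) := by
    rw [tendsto_zero_iff_norm_tendsto_zero]
    have h2 : Tendsto (fun n : ℕ => ((n : ℝ) + lam) ^ (-(w.re - 1))) atTop (nhds 0) :=
      (tendsto_rpow_neg_atTop (by linarith)).comp
        (tendsto_atTop_add_const_right _ _ tendsto_natCast_atTop_atTop)
    have h3 := h2.div_const ‖1 - w‖
    rw [zero_div] at h3
    refine h3.congr fun n => ?_
    rw [norm_div, norm_cpow_eq_rpow_re_of_pos (by positivity), sub_re, one_re, neg_sub]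
  refine tendsto_nhds_unique
    (summable_hurwitzDiff h0 (by linarith) hw1).hasSum.tendsto_sum_nat ?_
  have := (hH.sub ht).add_const ((lam : ℂ) ^ (1 - w) / (1 - w))
  rw [sub_zero] at this
  refine this.congr fun n => ?_
  rw [sum_hurwitzDiff]
  congr 2
  refine sum_congr rfl fun k _ => ?_
  rw [cpow_neg, one_div]
  push_cast
  rfl

/-- Partial sums of the Hurwitz zeta function on the real axis. -/
lemma exists_abs_sum_rpow_sub_le (h0 : 0 < lam) (h1 : lam ≤ 1) {x : ℝ} (hx : 0 < x) (hx1 : x ≠ 1) :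
    ∃ Z : ℝ, hzeta lam x = Z ∧ ∀ (n : ℕ) (y : ℝ), 0 < y → n - 1 + lam ≤ y → y ≤ n + lam →
      |∑ k ∈ range n, ((k : ℝ) + lam) ^ (-x) - y ^ (1 - x) / (1 - x) - Z| ≤ y ^ (-x) := by
  have hx1' : (x : ℂ) ≠ 1 := by exact_mod_cast hx1
  set P : ℕ → ℝ := fun n => ∑ k ∈ range n, ((k : ℝ) + lam) ^ (-x) -
    ((n : ℝ) + lam) ^ (1 - x) / (1 - x) with hP
  have hPc : ∀ n, (P n : ℂ) = ∑ k ∈ range n, hurwitzDiff lam k x -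
      (lam : ℂ) ^ (1 - (x : ℂ)) / (1 - x) := by
    intro n
    rw [sum_hurwitzDiff, hP]
    have e : ∀ n : ℕ, (((n : ℝ) + lam : ℝ) : ℂ) ^ (-(x : ℂ)) = ((((n : ℝ) + lam) ^ (-x) : ℝ) : ℂ) :=
      fun n => by rw [ofReal_cpow (by positivity)]; push_cast; rfl
    have e' : ∀ n : ℕ, (((n : ℝ) + lam : ℝ) : ℂ) ^ (1 - (x : ℂ)) =
        ((((n : ℝ) + lam) ^ (1 - x) : ℝ) : ℂ) :=
      fun n => by rw [ofReal_cpow (by positivity)]; push_cast; rfl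
    simp only [e, e']
    push_cast
    ring
  have hlim : Tendsto (fun n => (P n : ℂ)) atTop (nhds (hzeta lam x)) := by
    have := ((summable_hurwitzDiff h0 (s := x) (by simpa using hx)
      hx1').hasSum.tendsto_sum_nat).sub_const ((lam : ℂ) ^ (1 - (x : ℂ)) / (1 - x))
    rw [tsum_hurwitzDiff h0 h1 (by simpa using hx) hx1', add_sub_cancel_right] at this
    exact this.congr fun n => (hPc n).symm
  set Z := (hzeta lam x).re with hZ
  have hlimr : Tendsto P atTop (nhds Z) :=
    ((continuous_re.tendsto _).comp hlim).congr fun n => ofReal_re _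
  have hZe : hzeta lam x = Z := by
    have := (continuous_ofReal.tendsto _).comp hlimr
    exact tendsto_nhds_unique hlim this
  have hder : ∀ u : ℝ, 0 < u → HasDerivAt (fun u : ℝ => u ^ (1 - x) / (1 - x)) (u ^ (-x)) u := by
    intro u hu
    have := ((hasDerivAt_id u).rpow_const (p := 1 - x) (Or.inl hu.ne')).div_const (1 - x)
    have hne : 1 - x ≠ 0 := sub_ne_zero.2 (Ne.symm hx1)
    refine this.congr_deriv ?_
    simp only [id]
    rw [show 1 - x - 1 = -x by ring]
    field_simp
  have h_int : ∀ p q : ℝ, 0 < p → p ≤ q → (q - p) * q ^ (-x) ≤ q ^ (1 - x) / (1 - x) -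
      p ^ (1 - x) / (1 - x) ∧ q ^ (1 - x) / (1 - x) - p ^ (1 - x) / (1 - x) ≤
      (q - p) * p ^ (-x) := by
    intro p q hp hpq
    rcases hpq.eq_or_lt with rfl | hpq
    · simp
    obtain ⟨c, hc, hce⟩ := exists_hasDerivAt_eq_slope (fun u : ℝ => u ^ (1 - x) / (1 - x))
      (fun u => u ^ (-x)) hpq (fun u hu =>
        (hder u (hp.trans_le hu.1)).continuousAt.continuousWithinAt)
      (fun u hu => hder u (hp.trans hu.1))
    have hqp : 0 < q - p := by linarith
    rw [eq_div_iff hqp.ne'] at hce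
    rw [← hce, mul_comm]
    exact ⟨mul_le_mul_of_nonneg_right (Real.rpow_le_rpow_of_nonpos (hp.trans hc.1) hc.2.le
      (by linarith)) hqp.le, by
      rw [mul_comm (q - p)]
      exact mul_le_mul_of_nonneg_right (Real.rpow_le_rpow_of_nonpos hp hc.1.le (by linarith))
        hqp.le⟩
  have hstep : ∀ n : ℕ, P n ≤ P (n + 1) ∧
      P (n + 1) + ((n + 1 : ℕ) + lam) ^ (-x) ≤ P n + ((n : ℝ) + lam) ^ (-x) := by
    intro n
    have h := h_int (n + lam) ((n + 1 : ℕ) + lam) (by positivity) (by push_cast; linarith)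
    have e : ((n + 1 : ℕ) : ℝ) + lam - (n + lam) = 1 := by push_cast; ring
    rw [e, one_mul, one_mul] at h
    simp only [hP, sum_range_succ]
    constructor <;> linarith [h.1, h.2]
  have hmono : Monotone P := monotone_nat_of_le_succ fun n => (hstep n).1
  have hanti : Antitone fun n : ℕ => P n + ((n : ℝ) + lam) ^ (-x) :=
    antitone_nat_of_succ_le fun n => (hstep n).2
  have hlow : ∀ n, P n ≤ Z := fun n => hmono.ge_of_tendsto hlimr n
  have hhigh : ∀ n : ℕ, Z ≤ P n + ((n : ℝ) + lam) ^ (-x) := by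
    intro n
    refine hanti.le_of_tendsto ?_ n
    have h2 : Tendsto (fun n : ℕ => ((n : ℝ) + lam) ^ (-x)) atTop (nhds 0) :=
      (tendsto_rpow_neg_atTop hx).comp
        (tendsto_atTop_add_const_right _ _ tendsto_natCast_atTop_atTop)
    simpa using hlimr.add h2
  refine ⟨Z, hZe, fun n y hy hny hyn => ?_⟩
  have h1 := h_int y (n + lam) hy hyn
  have h2 := hlow n
  have h3 := hhigh n
  have h4 : ((n : ℝ) + lam) ^ (-x) ≤ y ^ (-x) :=
    Real.rpow_le_rpow_of_nonpos hy hyn (by linarith)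
  have h5 : 0 ≤ (n + lam - y) * ((n : ℝ) + lam) ^ (-x) :=
    mul_nonneg (by linarith) (by positivity)
  have h6 : (n + lam - y) * y ^ (-x) ≤ y ^ (-x) :=
    mul_le_of_le_one_left (by positivity) (by linarith)
  simp only [hP] at h2 h3
  rw [abs_le]
  constructor <;> linarith [h1.1, h1.2]

end hurwitz

section diagonal

variable {a lam σ : ℝ}

/-- The diagonal contribution to the mean square. -/
noncomputable def diagSum (a lam σ c : ℝ) (N : ℕ) (t : ℝ) : ℝ :=
  ∑ m ∈ range N, cut c (m + a) * (m + a) ^ (-(2 * σ)) +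
    ‖chi σ t‖ ^ 2 * ∑ k ∈ range N,
      (1 - cut c (t / (2 * Real.pi * (k + lam)))) * (k + lam) ^ (-(2 - 2 * σ))

lemma sum_ite_lt_eq {N : ℕ} {u : ℝ} (hu : u ≤ N) (ha : 0 < a) (f : ℕ → ℝ) :
    ∑ m ∈ range N, (if (m : ℝ) + a < u then f m else 0) = ∑ m ∈ range ⌈u - a⌉₊, f m := by
  rw [← Finset.sum_filter]
  congr 1
  ext m
  rw [mem_filter, mem_range, mem_range, Nat.lt_ceil, ← lt_sub_iff_add_lt]
  refine and_iff_right_of_imp fun h => ?_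
  have : (m : ℝ) < N := by linarith
  exact_mod_cast this

lemma sum_ite_le_eq {N : ℕ} {y : ℝ} (hy : y ≤ N) (h0 : 0 < lam) (f : ℕ → ℝ) :
    ∑ k ∈ range N, (if (k : ℝ) + lam ≤ y then f k else 0) =
      ∑ k ∈ range ⌊y - lam + 1⌋₊, f k := by
  rw [← Finset.sum_filter]
  congr 1
  ext m
  rw [mem_filter, mem_range, mem_range, ← Nat.add_one_le_iff (n := m) (m := ⌊y - lam + 1⌋₊),
    Nat.le_floor_iff' (Nat.succ_ne_zero m)]
  push_cast
  rw [add_le_add_iff_right, le_sub_iff_add_le]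
  refine and_iff_right_of_imp fun h => ?_
  have : (m : ℝ) < N := by linarith
  exact_mod_cast this

lemma exists_abs_diagSum_sub_le (ha : 0 < a) (ha1 : a ≤ 1) (h0 : 0 < lam) (h1 : lam < 1)
    (hσ : 1 / 2 < σ) (hσ1 : σ < 1) :
    ∃ Z₁ Z₂ C : ℝ, hzeta a ((2 * σ : ℝ) : ℂ) = Z₁ ∧ hzeta lam ((2 - 2 * σ : ℝ) : ℂ) = Z₂ ∧ 0 < C ∧
      ∀ (t c : ℝ) (N : ℕ), 48 ≤ t → 1 ≤ c → 2 * c ≤ N → t / (2 * Real.pi * c) ≤ N →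
        |diagSum a lam σ c N t - (Z₁ + (t / (2 * Real.pi)) ^ (1 - 2 * σ) * Z₂)| ≤
          C * (c ^ (-(2 * σ)) + c ^ (2 - 2 * σ) / t + 1 / t) := by
  obtain ⟨Z₁, hZ₁, hS₁⟩ := exists_abs_sum_rpow_sub_le ha ha1 (x := 2 * σ) (by linarith)
    (by linarith)
  obtain ⟨Z₂, hZ₂, hS₂⟩ := exists_abs_sum_rpow_sub_le h0 h1.le (x := 2 - 2 * σ) (by linarith)
    (by linarith)
  have hσ' : 0 < 2 * σ - 1 := by linarith
  refine ⟨Z₁, Z₂, 10000 + 50 * (|Z₂| + 1 / (2 * σ - 1)), hZ₁, hZ₂, by positivity,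
    fun t c N ht hc hN hNt => ?_⟩
  have hc0 : 0 < c := by linarith
  have ht0 : 0 < t := by linarith
  set X : ℝ := (t / (2 * Real.pi)) ^ (1 - 2 * σ) with hX
  have htp : 0 < t / (2 * Real.pi) := by positivity
  have htp1 : 1 ≤ t / (2 * Real.pi) := by
    rw [le_div_iff₀ (by positivity)]
    linarith [Real.pi_lt_four]
  have hX0 : 0 < X := by positivity
  have hX1 : X ≤ 1 := Real.rpow_le_one_of_one_le_of_nonpos htp1 (by linarith)
  have hchi := abs_norm_chi_sq_sub_le (σ := σ) (by linarith) hσ1.le ht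
  rw [← hX] at hchi
  set V : ℝ := ∑ k ∈ range N, ((k : ℝ) + lam) ^ (-(2 - 2 * σ)) with hV
  set B : ℝ := (10000 + 50 * (|Z₂| + 1 / (2 * σ - 1))) *
    (c ^ (-(2 * σ)) + c ^ (2 - 2 * σ) / t + 1 / t) with hB
  have key := norm_sum_cut_sub_le ((range N).disjSum (range N))
    (Sum.elim (fun m : ℕ => (m : ℝ) + a) (fun k : ℕ => t / (2 * Real.pi * (k + lam))))
    (Sum.elim (fun m : ℕ => ((((m : ℝ) + a) ^ (-(2 * σ)) : ℝ) : ℂ))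
      (fun k : ℕ => ((-(‖chi σ t‖ ^ 2 * ((k : ℝ) + lam) ^ (-(2 - 2 * σ))) : ℝ) : ℂ)))
    ((Z₁ + X * Z₂ - ‖chi σ t‖ ^ 2 * V : ℝ) : ℂ) (B := B) hc0 ?_
  · rw [Finset.sum_disjSum] at key
    simp only [Sum.elim_inl, Sum.elim_inr] at key
    have e : ((diagSum a lam σ c N t - (Z₁ + X * Z₂) : ℝ) : ℂ) =
        ∑ m ∈ range N, (cut c (m + a) : ℂ) * ((((m : ℝ) + a) ^ (-(2 * σ)) : ℝ) : ℂ) +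
        ∑ k ∈ range N, (cut c (t / (2 * Real.pi * (k + lam))) : ℂ) *
          ((-(‖chi σ t‖ ^ 2 * ((k : ℝ) + lam) ^ (-(2 - 2 * σ))) : ℝ) : ℂ) -
        ((Z₁ + X * Z₂ - ‖chi σ t‖ ^ 2 * V : ℝ) : ℂ) := by
      norm_cast
      simp only [diagSum, hV, sub_mul, one_mul, Finset.sum_sub_distrib, mul_sub, Finset.mul_sum,
        mul_neg, Finset.sum_neg_distrib]
      rw [Finset.sum_congr rfl fun (k : ℕ) _ =>
          mul_left_comm (cut c (t / (2 * Real.pi * (k + lam))))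
        (‖chi σ t‖ ^ 2) _]
      ring
    rw [← e, norm_real, Real.norm_eq_abs] at key
    exact key
  · intro u hu
    have hu0 : 0 < u := hc0.trans_le hu.1
    set y : ℝ := t / (2 * Real.pi * u) with hy
    have hy0 : 0 < y := by positivity
    rw [Finset.sum_disjSum]
    have hyN : y ≤ N := le_trans (div_le_div_of_nonneg_left ht0.le (by positivity)
      (mul_le_mul_of_nonneg_left hu.1 (by positivity))) hNt
    have hs1 := sum_ite_lt_eq (a := a) (hu.2.trans hN) ha (fun m => ((m : ℝ) + a) ^ (-(2 * σ)))
    have hs2 := sum_ite_le_eq hyN h0 (fun k => ((k : ℝ) + lam) ^ (-(2 - 2 * σ)))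
    set S₁ := ∑ m ∈ range ⌈u - a⌉₊, ((m : ℝ) + a) ^ (-(2 * σ)) with hS₁e
    set S₂ := ∑ k ∈ range ⌊y - lam + 1⌋₊, ((k : ℝ) + lam) ^ (-(2 - 2 * σ)) with hS₂e
    have hsum2 : ∑ k ∈ range N, (if t / (2 * Real.pi * ((k : ℝ) + lam)) < u then
        -(‖chi σ t‖ ^ 2 * ((k : ℝ) + lam) ^ (-(2 - 2 * σ))) else 0) =
        ‖chi σ t‖ ^ 2 * S₂ - ‖chi σ t‖ ^ 2 * V := by
      rw [← hs2, hV, Finset.mul_sum, Finset.mul_sum, ← Finset.sum_sub_distrib]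
      refine Finset.sum_congr rfl fun k _ => ?_
      have hν : 0 < (k : ℝ) + lam := by positivity
      have : t / (2 * Real.pi * ((k : ℝ) + lam)) < u ↔ ¬ ((k : ℝ) + lam ≤ y) := by
        rw [not_le, hy, div_lt_iff₀ (by positivity), div_lt_iff₀ (by positivity)]
        constructor <;> intro h <;> linarith
      by_cases h : (k : ℝ) + lam ≤ y
      · rw [if_neg (by rw [this]; simpa using h), if_pos h]; ring
      · rw [if_pos (this.2 h), if_neg h]; ring
    have hcast : ∑ m ∈ range N, (if (m : ℝ) + a < u then
          ((((m : ℝ) + a) ^ (-(2 * σ)) : ℝ) : ℂ) else 0) +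
        ∑ k ∈ range N, (if t / (2 * Real.pi * ((k : ℝ) + lam)) < u then
          ((-(‖chi σ t‖ ^ 2 * ((k : ℝ) + lam) ^ (-(2 - 2 * σ))) : ℝ) : ℂ) else 0) -
        ((Z₁ + X * Z₂ - ‖chi σ t‖ ^ 2 * V : ℝ) : ℂ) =
        ((S₁ + ‖chi σ t‖ ^ 2 * S₂ - (Z₁ + X * Z₂) : ℝ) : ℂ) := by
      have : S₁ + ‖chi σ t‖ ^ 2 * S₂ - (Z₁ + X * Z₂) = S₁ +
        (‖chi σ t‖ ^ 2 * S₂ - ‖chi σ t‖ ^ 2 * V) - (Z₁ + X * Z₂ - ‖chi σ t‖ ^ 2 * V) := by ring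
      rw [this, ← hsum2, ← hs1]
      push_cast
      simp only [apply_ite ofReal, ofReal_zero]
      push_cast
      rfl
    refine (le_of_eq (congrArg norm hcast)).trans ?_
    rw [norm_real, Real.norm_eq_abs]
    have b1 := hS₁ ⌈u - a⌉₊ u hu0 (by
      linarith [Nat.ceil_lt_add_one (a := u - a) (by linarith [hu.1])])
      (by linarith [Nat.le_ceil (u - a)])
    have b2 := hS₂ ⌊y - lam + 1⌋₊ y hy0 (by
      linarith [Nat.floor_le (a := y - lam + 1) (by linarith)])
      (by linarith [Nat.lt_floor_add_one (y - lam + 1)])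
    rw [← hS₁e] at b1
    rw [← hS₂e, show 1 - (2 - 2 * σ) = 2 * σ - 1 by ring] at b2
    have hXy : X * y ^ (2 * σ - 1) = u ^ (1 - 2 * σ) := by
      have : y = t / (2 * Real.pi) / u := by rw [hy]; field_simp
      rw [this, Real.div_rpow htp.le hu0.le, hX, ← mul_div_assoc, ← Real.rpow_add htp,
        show 1 - 2 * σ + (2 * σ - 1) = 0 by ring, Real.rpow_zero, one_div, ← Real.rpow_neg hu0.le]
      congr 1; ring
    have hXy2 : X * y ^ (-(2 - 2 * σ)) = 2 * Real.pi * (u ^ (2 - 2 * σ) / t) := by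
      rw [show -(2 - 2 * σ) = 2 * σ - 1 - 1 by ring, Real.rpow_sub_one hy0.ne', ← mul_div_assoc,
        hXy, show 2 - 2 * σ = 1 - 2 * σ + 1 by ring, Real.rpow_add_one hu0.ne', hy]
      field_simp
    have hu1 : u ^ (1 - 2 * σ) ≤ 1 :=
      Real.rpow_le_one_of_one_le_of_nonpos (hc.trans hu.1) (by linarith)
    have hu2 : u ^ (-(2 * σ)) ≤ c ^ (-(2 * σ)) :=
      Real.rpow_le_rpow_of_nonpos hc0 hu.1 (by linarith)
    have hu3 : u ^ (2 - 2 * σ) ≤ 2 * c ^ (2 - 2 * σ) := by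
      refine (Real.rpow_le_rpow hu0.le hu.2 (by linarith)).trans ?_
      rw [Real.mul_rpow (by norm_num) hc0.le]
      refine mul_le_mul_of_nonneg_right ?_ (by positivity)
      refine (Real.rpow_le_rpow_of_exponent_le one_le_two (by linarith : 2 - 2 * σ ≤ 1)).trans ?_
      simp
    have hu4 : 2 * Real.pi * (u ^ (2 - 2 * σ) / t) ≤ 16 * (c ^ (2 - 2 * σ) / t) := by
      calc 2 * Real.pi * (u ^ (2 - 2 * σ) / t) ≤ 8 * (2 * c ^ (2 - 2 * σ) / t) := by
            refine mul_le_mul (by linarith [Real.pi_lt_four])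
              (div_le_div_of_nonneg_right hu3 ht0.le) (by positivity) (by norm_num)
        _ = _ := by ring
    set W := c ^ (2 - 2 * σ) / t with hW
    have hW0 : 0 ≤ W := by positivity
    -- split off the three sources of error
    have e : S₁ + ‖chi σ t‖ ^ 2 * S₂ - (Z₁ + X * Z₂) =
        (S₁ - u ^ (1 - 2 * σ) / (1 - 2 * σ) - Z₁) +
        X * (S₂ - y ^ (2 * σ - 1) / (2 * σ - 1) - Z₂) + (‖chi σ t‖ ^ 2 - X) * S₂ := by
      have : u ^ (1 - 2 * σ) / (1 - 2 * σ) = -(X * y ^ (2 * σ - 1) / (2 * σ - 1)) := by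
        rw [hXy, ← neg_sub (2 * σ) 1, div_neg]
      rw [this]
      ring
    have b3 : |X * S₂| ≤ |Z₂| + 1 / (2 * σ - 1) + 16 * W := by
      have e2 : X * S₂ = X * (S₂ - y ^ (2 * σ - 1) / (2 * σ - 1) - Z₂) + X * Z₂ +
          u ^ (1 - 2 * σ) / (2 * σ - 1) := by rw [← hXy]; ring
      rw [e2]
      refine (abs_add_three _ _ _).trans ?_
      rw [abs_mul, abs_mul, abs_of_pos hX0, abs_of_pos (div_pos (by positivity) hσ')]
      have i1 := mul_le_mul_of_nonneg_left b2 hX0.le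
      have i2 := mul_le_mul_of_nonneg_right hX1 (abs_nonneg Z₂)
      have i3 := div_le_div_of_nonneg_right hu1 hσ'.le
      rw [hXy2] at i1
      linarith
    have b4 : |(‖chi σ t‖ ^ 2 - X) * S₂| ≤ 50 / t * (|Z₂| + 1 / (2 * σ - 1) + 16 * W) := by
      rw [abs_mul]
      have hS0 : 0 ≤ |S₂| := abs_nonneg _
      refine (mul_le_mul_of_nonneg_right hchi hS0).trans ?_
      rw [mul_assoc]
      nth_rewrite 1 [← abs_of_pos hX0]
      rw [← abs_mul]
      exact mul_le_mul_of_nonneg_left b3 (by positivity)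
    rw [e]
    refine (abs_add_three _ _ _).trans ?_
    rw [abs_mul X, abs_of_pos hX0]
    have i1 := mul_le_mul_of_nonneg_left b2 hX0.le
    rw [hXy2] at i1
    have ht1 : 50 / t ≤ 50 := by
      rw [div_le_iff₀ ht0]; linarith
    have i2 : 50 / t * (16 * W) ≤ 50 * (16 * W) := mul_le_mul_of_nonneg_right ht1 (by positivity)
    have hc2 : 0 ≤ c ^ (-(2 * σ)) := by positivity
    have hK : 0 ≤ |Z₂| + 1 / (2 * σ - 1) := by positivity
    have i3 : (50 * (|Z₂| + 1 / (2 * σ - 1))) * (c ^ (-(2 * σ)) + W) ≥ 0 := by positivity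
    have i4 : 0 < 1 / t := by positivity
    have i5 : 50 / t * (|Z₂| + 1 / (2 * σ - 1)) = 50 * (|Z₂| + 1 / (2 * σ - 1)) * (1 / t) := by
      ring
    rw [hB]
    have e3 : (10000 + 50 * (|Z₂| + 1 / (2 * σ - 1))) * (c ^ (-(2 * σ)) + W + 1 / t) =
        10000 * (c ^ (-(2 * σ)) + W + 1 / t) +
        50 * (|Z₂| + 1 / (2 * σ - 1)) * (c ^ (-(2 * σ)) + W) +
        50 * (|Z₂| + 1 / (2 * σ - 1)) * (1 / t) := by ring
    rw [e3]
    have e4 : 50 / t * (|Z₂| + 1 / (2 * σ - 1) + 16 * W) =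
      50 / t * (|Z₂| + 1 / (2 * σ - 1)) + 50 / t * (16 * W) := by ring
    rw [e4, i5] at b4
    linarith

end diagonal

section sums

lemma exists_sum_rpow_le {α p : ℝ} (h0 : 0 < α) (h1 : α ≤ 1) (hp : 0 < p) (hp1 : p < 1) :
    ∃ C > 0, ∀ N : ℕ, 1 ≤ N → ∑ k ∈ range N, ((k : ℝ) + α) ^ (-p) ≤ C * (N : ℝ) ^ (1 - p) := by
  obtain ⟨Z, -, hZ⟩ := exists_abs_sum_rpow_sub_le h0 h1 hp hp1.ne
  have h1p : 0 < 1 - p := by linarith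
  refine ⟨1 / (1 - p) + |Z| + 1, by positivity, fun N hN => ?_⟩
  have hN1 : (1 : ℝ) ≤ N := by exact_mod_cast hN
  have h := (abs_le.1 (hZ N N (by linarith) (by linarith) (by linarith))).2
  have e1 : (N : ℝ) ^ (-p) ≤ 1 := Real.rpow_le_one_of_one_le_of_nonpos hN1 (by linarith)
  have e2 : 1 ≤ (N : ℝ) ^ (1 - p) := Real.one_le_rpow hN1 h1p.le
  have e3 : |Z| ≤ |Z| * (N : ℝ) ^ (1 - p) := le_mul_of_one_le_right (abs_nonneg _) e2
  have e4 : (1 / (1 - p) + |Z| + 1) * (N : ℝ) ^ (1 - p) =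
    (N : ℝ) ^ (1 - p) / (1 - p) + |Z| * (N : ℝ) ^ (1 - p) + (N : ℝ) ^ (1 - p) := by ring
  rw [e4]
  linarith [le_abs_self Z]

lemma sum_one_div_abs_sub_le (N k : ℕ) (hk : k < N) :
    ∑ m ∈ (range N).erase k, 1 / |(m : ℝ) - k| ≤ 2 * (1 + Real.log N) := by
  have hH : ∀ M : ℕ, M ≤ N → ∑ i ∈ range M, 1 / ((i : ℝ) + 1) ≤ 1 + Real.log N := by
    intro M hM
    have h := harmonic_le_one_add_log N
    have e : ((harmonic N : ℚ) : ℝ) = ∑ i ∈ range N, 1 / ((i : ℝ) + 1) := by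
      simp [harmonic, one_div]
    rw [e] at h
    refine le_trans (sum_le_sum_of_subset_of_nonneg (range_mono hM) fun i _ _ => ?_) h
    positivity
  have hsplit : (range N).erase k = range k ∪ Ico (k + 1) N := by
    ext m
    simp only [mem_erase, mem_range, mem_union, mem_Ico]
    omega
  have hdisj : Disjoint (range k) (Ico (k + 1) N) := by
    rw [Finset.disjoint_left]
    intro m hm hm'
    simp only [mem_range, mem_Ico] at hm hm'
    omega
  rw [hsplit, sum_union hdisj]
  have h1 : ∑ m ∈ range k, 1 / |(m : ℝ) - k| = ∑ i ∈ range k, 1 / ((i : ℝ) + 1) := by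
    rw [← sum_range_reflect]
    refine sum_congr rfl fun i hi => ?_
    have hi' : i < k := mem_range.1 hi
    have : ((k - 1 - i : ℕ) : ℝ) = (k : ℝ) - 1 - i := by
      rw [Nat.cast_sub (by omega), Nat.cast_sub (by omega), Nat.cast_one]
    rw [this, abs_of_nonpos (by
      have : (0 : ℝ) ≤ i := i.cast_nonneg
      linarith)]
    congr 1; ring
  have h2 : ∑ m ∈ Ico (k + 1) N, 1 / |(m : ℝ) - k| =
      ∑ i ∈ range (N - (k + 1)), 1 / ((i : ℝ) + 1) := by
    rw [sum_Ico_eq_sum_range]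
    refine sum_congr rfl fun i _ => ?_
    have : ((k + 1 + i : ℕ) : ℝ) - k = i + 1 := by push_cast; ring
    rw [this, abs_of_pos (by positivity)]
  rw [h1, h2]
  linarith [hH k hk.le, hH (N - (k + 1)) (by omega)]

lemma one_div_abs_log_sub_le {x y : ℝ} (hx : 0 < x) (hy : 0 < y) (hxy : x ≠ y) :
    1 / |Real.log x - Real.log y| ≤ max x y / |x - y| := by
  wlog h : y < x generalizing x y
  · have := this hy hx hxy.symm (lt_of_le_of_ne (not_lt.1 h) hxy)
    rwa [abs_sub_comm, max_comm, abs_sub_comm y x] at this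
  have hl : 0 < Real.log x - Real.log y := sub_pos.2 (Real.log_lt_log hy h)
  have hsub : 0 < x - y := sub_pos.2 h
  rw [max_eq_left h.le, abs_of_pos hl, abs_of_pos hsub, div_le_div_iff₀ hl hsub, one_mul]
  have h1 := Real.log_le_sub_one_of_pos (div_pos hy hx)
  rw [Real.log_div hy.ne' hx.ne'] at h1
  have h2 : x * (y / x - 1) = y - x := by field_simp
  nlinarith [mul_le_mul_of_nonneg_left h1 hx.le]

lemma exists_sum_sum_div_log_le {α p : ℝ} (h0 : 0 < α) (h1 : α ≤ 1) (hp : 0 < p) (hp1 : p < 1) :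
    ∃ C > 0, ∀ N : ℕ, 1 ≤ N → ∑ k ∈ range N, ∑ m ∈ (range N).erase k,
      ((m : ℝ) + α) ^ (-p) * ((k : ℝ) + α) ^ (-p) *
        (1 / |Real.log ((m : ℝ) + α) - Real.log ((k : ℝ) + α)|) ≤
      C * ((N : ℝ) ^ (2 - 2 * p) * (1 + Real.log N)) := by
  obtain ⟨C, hC, hS⟩ := exists_sum_rpow_le h0 h1 hp hp1
  refine ⟨4 * C, by positivity, fun N hN => ?_⟩
  have hN1 : (1 : ℝ) ≤ N := by exact_mod_cast hN
  have hN0 : (0 : ℝ) < N := by linarith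
  have hlog : 0 ≤ Real.log N := Real.log_nonneg hN1
  have hpos : ∀ k : ℕ, 0 < (k : ℝ) + α := fun k => by positivity
  have hterm : ∀ k ∈ range N, ∀ m ∈ (range N).erase k,
      ((m : ℝ) + α) ^ (-p) * ((k : ℝ) + α) ^ (-p) *
        (1 / |Real.log ((m : ℝ) + α) - Real.log ((k : ℝ) + α)|) ≤
      (N : ℝ) ^ (1 - p) * (((m : ℝ) + α) ^ (-p) * (1 / |(k : ℝ) - m|) +
        ((k : ℝ) + α) ^ (-p) * (1 / |(m : ℝ) - k|)) := by
    intro k hk m hm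
    have hmk : m ≠ k := (mem_erase.1 hm).1
    have hle : ∀ j ∈ range N, (j : ℝ) + α ≤ N := fun j hj => by
      have : ((j + 1 : ℕ) : ℝ) ≤ N := by exact_mod_cast mem_range.1 hj
      push_cast at this
      linarith
    have hxy : (m : ℝ) + α ≠ k + α := fun h => hmk (by exact_mod_cast add_right_cancel h)
    have hl := one_div_abs_log_sub_le (hpos m) (hpos k) hxy
    rw [add_sub_add_right_eq_sub] at hl
    set x : ℝ := m + α
    set y : ℝ := k + α
    have hx : 0 < x := hpos m
    have hy : 0 < y := hpos k
    have hd : 0 < |(m : ℝ) - k| := abs_pos.2 (sub_ne_zero.2 (by exact_mod_cast hmk))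
    have hmax : x ^ (-p) * y ^ (-p) * max x y ≤ (N : ℝ) ^ (1 - p) * (x ^ (-p) + y ^ (-p)) := by
      have e : ∀ z : ℝ, 0 < z → z ≤ N → z ^ (-p) * z ≤ (N : ℝ) ^ (1 - p) := fun z hz hzN => by
        rw [← Real.rpow_add_one hz.ne', show -p + 1 = 1 - p by ring]
        exact Real.rpow_le_rpow hz.le hzN (by linarith)
      have ex := e x hx (hle m (mem_of_mem_erase hm))
      have ey := e y hy (hle k hk)
      have px : 0 < x ^ (-p) := by positivity
      have py : 0 < y ^ (-p) := by positivity
      have pN : 0 < (N : ℝ) ^ (1 - p) := by positivity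
      rcases max_cases x y with ⟨h, -⟩ | ⟨h, -⟩ <;> rw [h]
      · calc x ^ (-p) * y ^ (-p) * x = x ^ (-p) * x * y ^ (-p) := by ring
          _ ≤ (N : ℝ) ^ (1 - p) * y ^ (-p) := mul_le_mul_of_nonneg_right ex py.le
          _ ≤ _ := mul_le_mul_of_nonneg_left (by linarith) pN.le
      · calc x ^ (-p) * y ^ (-p) * y = y ^ (-p) * y * x ^ (-p) := by ring
          _ ≤ (N : ℝ) ^ (1 - p) * x ^ (-p) := mul_le_mul_of_nonneg_right ey px.le
          _ ≤ _ := mul_le_mul_of_nonneg_left (by linarith) pN.le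
    calc x ^ (-p) * y ^ (-p) * (1 / |Real.log x - Real.log y|)
        ≤ x ^ (-p) * y ^ (-p) * (max x y / |(m : ℝ) - k|) :=
          mul_le_mul_of_nonneg_left hl (by positivity)
      _ = x ^ (-p) * y ^ (-p) * max x y / |(m : ℝ) - k| := by ring
      _ ≤ (N : ℝ) ^ (1 - p) * (x ^ (-p) + y ^ (-p)) / |(m : ℝ) - k| :=
          div_le_div_of_nonneg_right hmax hd.le
      _ = _ := by rw [abs_sub_comm (k : ℝ) m]; ring
  refine (sum_le_sum fun k hk => sum_le_sum (hterm k hk)).trans ?_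
  simp only [← mul_sum, sum_add_distrib]
  have hswap : ∑ k ∈ range N, ∑ m ∈ (range N).erase k, ((m : ℝ) + α) ^ (-p) * (1 / |(k : ℝ) - m|) =
      ∑ k ∈ range N, ∑ m ∈ (range N).erase k, ((k : ℝ) + α) ^ (-p) * (1 / |(m : ℝ) - k|) := by
    refine sum_comm' fun k m => ?_
    simp only [mem_erase, mem_range, ne_eq]
    constructor
    · rintro ⟨h1, h2, h3⟩; exact ⟨⟨fun h => h2 h.symm, h1⟩, h3⟩
    · rintro ⟨⟨h1, h2⟩, h3⟩; exact ⟨h2, fun h => h1 h.symm, h3⟩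
  have hB : ∑ k ∈ range N, ((k : ℝ) + α) ^ (-p) * ∑ m ∈ (range N).erase k, 1 / |(m : ℝ) - k| ≤
      C * (N : ℝ) ^ (1 - p) * (2 * (1 + Real.log N)) := by
    refine (sum_le_sum fun k hk => mul_le_mul_of_nonneg_left
      (sum_one_div_abs_sub_le N k (mem_range.1 hk)) (by have := hpos k; positivity)).trans ?_
    rw [← sum_mul]
    exact mul_le_mul_of_nonneg_right (hS N hN) (by positivity)
  rw [hswap]
  simp only [← mul_sum]
  have hN2 : (N : ℝ) ^ (2 - 2 * p) = (N : ℝ) ^ (1 - p) * (N : ℝ) ^ (1 - p) := by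
    rw [← Real.rpow_add hN0]; congr 1; ring
  rw [hN2]
  have pN : 0 ≤ (N : ℝ) ^ (1 - p) := by positivity
  nlinarith [mul_le_mul_of_nonneg_left hB pN]

end sums

section derivatives

variable {a lam σ t : ℝ}

lemma hasDerivAt_lerchTerm (ha : 0 < a) (m : ℕ) :
    HasDerivAt (fun t : ℝ => lerchTerm a lam (σ + t * I) m)
      ((I * (-Real.log (m + a) : ℝ) + 0) * lerchTerm a lam (σ + t * I) m) t := by
  have hx : 0 < (m : ℝ) + a := by positivity
  have hxc : (m : ℂ) + a ≠ 0 := by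
    have := ofReal_ne_zero.2 hx.ne'
    push_cast at this
    exact this
  have h1 : HasDerivAt (fun z : ℂ => -((σ : ℂ) + z * I)) (-I) (t : ℂ) :=
    (((hasDerivAt_id (t : ℂ)).mul_const I).const_add (σ : ℂ)).neg.congr_deriv (by simp)
  have h2 := ((h1.const_cpow (Or.inl hxc)).const_mul
    (exp (2 * Real.pi * I * lam * m))).comp_ofReal
  refine h2.congr_deriv ?_
  rw [lerchTerm, ofReal_neg, ofReal_log hx.le]
  push_cast
  ring

lemma hasDerivAt_dualCoeff (h0 : 0 < lam) (hσ1 : σ ≤ 1) (ht : 0 < t) (k : ℕ) :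
    HasDerivAt (fun t : ℝ => dualCoeff a lam σ t k)
      ((I * (-Real.log (t / (2 * Real.pi * (k + lam))) : ℝ) + chiError σ t) *
        dualCoeff a lam σ t k) t := by
  have hν : 0 < (k : ℝ) + lam := by positivity
  have hνc : ((k + lam : ℝ) : ℂ) ≠ 0 := ofReal_ne_zero.2 hν.ne'
  have h1 : HasDerivAt (fun z : ℂ => (σ : ℂ) + z * I - 1) I (t : ℂ) := by
    simpa using (((hasDerivAt_id (t : ℂ)).mul_const I).const_add (σ : ℂ)).sub_const 1
  have h2 := ((h1.const_cpow (Or.inl hνc)).const_mul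
    (exp (-(2 * Real.pi * I * (k + lam) * a)))).comp_ofReal
  have h3 := (hasDerivAt_chi hσ1 ht).mul h2
  refine h3.congr_deriv ?_
  have hlog : Real.log (t / (2 * Real.pi * (k + lam))) =
      Real.log (t / (2 * Real.pi)) - Real.log (k + lam) := by
    rw [← div_div, Real.log_div (by positivity) hν.ne']
  rw [dualCoeff, hlog, ← ofReal_log hν.le]
  push_cast
  ring

lemma hasDerivAt_mul_conj {f g : ℝ → ℂ} {r s : ℂ} {α β t : ℝ}
    (hf : HasDerivAt f ((I * α + r) * f t) t) (hg : HasDerivAt g ((I * β + s) * g t) t) :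
    HasDerivAt (fun t => f t * (starRingEnd ℂ) (g t))
      ((I * (α - β : ℝ) + (r + (starRingEnd ℂ) s)) * (f t * (starRingEnd ℂ) (g t))) t := by
  have h := hf.mul hg.star
  refine h.congr_deriv ?_
  simp only [star_def, map_mul, map_add, conj_I, conj_ofReal]
  push_cast
  ring

lemma norm_integral_weight_mul_le {F r : ℝ → ℂ} {θ θ' w : ℝ → ℝ} {p q M δ R κ : ℝ} (hp : 0 < p)
    (hpq : p ≤ q) (hw : Monotone w) (hw0 : ∀ t, 0 ≤ w t) (hw1 : ∀ t, w t ≤ 1)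
    (hδ : 0 < δ) (hR : 0 ≤ R)
    (hF : ∀ t, 0 < t → HasDerivAt F ((I * θ t + r t) * F t) t)
    (hθ : ∀ t ∈ Set.Icc p q, HasDerivAt θ (θ' t) t) (hM : ∀ t ∈ Set.Icc p q, ‖F t‖ ≤ M)
    (hlow : ∀ t ∈ Set.Icc p q, 0 < w t → δ ≤ |θ t|) (hr : ∀ t ∈ Set.Icc p q, ‖r t‖ ≤ R)
    (hθ' : ∀ t ∈ Set.Icc p q, |θ' t| ≤ κ) :
    ‖∫ t in p..q, (w t : ℂ) * F t‖ ≤ M * (2 / δ + (q - p) * (R / δ + κ / δ ^ 2)) := by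
  have hpI := Set.left_mem_Icc.2 hpq
  have hM0 : 0 ≤ M := (norm_nonneg _).trans (hM p hpI)
  have hκ : 0 ≤ κ := (abs_nonneg _).trans (hθ' p hpI)
  have hqp : 0 ≤ q - p := sub_nonneg.2 hpq
  refine norm_integral_monotone_mul_le hw hw0 hw1 hpq (fun t ht =>
    (hF t (hp.trans_le ht.1)).continuousAt.continuousWithinAt) (by positivity)
    fun x hx hxw => ?_
  rcases hx.2.eq_or_lt with rfl | hxq
  · rw [intervalIntegral.integral_same, norm_zero]
    positivity
  have hsub : ∀ t ∈ Set.Icc x q, t ∈ Set.Icc p q := fun t ht => ⟨hx.1.trans ht.1, ht.2⟩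
  have hlow' : ∀ t ∈ Set.Icc x q, δ ≤ |θ t| := by
    have hcl : Set.Icc x q ⊆ closure (Set.Ioc x q) := by rw [closure_Ioc hxq.ne]
    intro t ht
    have : (nhdsWithin t (Set.Ioc x q)).NeBot := mem_closure_iff_nhdsWithin_neBot.1 (hcl ht)
    refine ge_of_tendsto ((hθ t (hsub t ht)).continuousAt.abs.tendsto.mono_left
      (nhdsWithin_le_nhds (s := Set.Ioc x q))) ?_
    filter_upwards [self_mem_nhdsWithin] with y hy
    exact hlow y (hsub y ⟨hy.1.le, hy.2⟩) (hxw y hy.1)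
  refine (norm_integral_le_of_hasDerivAt (hp.trans_le hx.1) hx.2 hδ hR hF
    (fun t ht => hθ t (hsub t ht)) (fun t ht => hM t (hsub t ht)) hlow'
    (fun t ht => hr t (hsub t ht)) (fun t ht => hθ' t (hsub t ht))).trans ?_
  refine mul_le_mul_of_nonneg_left ?_ hM0
  have : (q - x) * (R / δ + κ / δ ^ 2) ≤ (q - p) * (R / δ + κ / δ ^ 2) :=
    mul_le_mul_of_nonneg_right (by linarith [hx.1]) (by positivity)
  linarith

end derivatives

section pairs

variable {a lam σ T : ℝ}

lemma norm_chi_sq_le_of_le (hσ : 1 / 2 ≤ σ) (hσ1 : σ ≤ 1) (hT : 48 ≤ T) {t : ℝ} (ht : T ≤ t) :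
    ‖chi σ t‖ ^ 2 ≤ 21 * T ^ (1 - 2 * σ) := by
  have hT0 : 0 < T := by linarith
  refine (norm_chi_sq_le (by linarith) hσ1 (hT.trans ht)).trans ?_
  have h1 : (t / (2 * Real.pi)) ^ (1 - 2 * σ) ≤ (T / (2 * Real.pi)) ^ (1 - 2 * σ) :=
    Real.rpow_le_rpow_of_nonpos (by positivity)
      (div_le_div_of_nonneg_right ht (by positivity)) (by linarith)
  have h2 : (T / (2 * Real.pi)) ^ (1 - 2 * σ) = (2 * Real.pi) ^ (2 * σ - 1) * T ^ (1 - 2 * σ) := by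
    rw [Real.div_rpow hT0.le (by positivity), div_eq_mul_inv, ← Real.rpow_neg (by positivity),
      neg_sub, mul_comm]
  have h3 : (2 * Real.pi) ^ (2 * σ - 1) ≤ 7 := by
    refine (Real.rpow_le_rpow_of_exponent_le (by linarith [Real.pi_gt_three])
      (by linarith : 2 * σ - 1 ≤ 1)).trans ?_
    rw [Real.rpow_one]
    linarith [Real.pi_lt_d2]
  have h4 : 0 < T ^ (1 - 2 * σ) := by positivity
  nlinarith

lemma norm_chi_le_of_le (hσ : 1 / 2 ≤ σ) (hσ1 : σ ≤ 1) (hT : 48 ≤ T) {t : ℝ} (ht : T ≤ t) :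
    ‖chi σ t‖ ≤ 5 * T ^ (1 / 2 - σ) := by
  have hT0 : 0 < T := by linarith
  have h := norm_chi_sq_le_of_le hσ hσ1 hT ht
  have e : T ^ (1 - 2 * σ) = (T ^ (1 / 2 - σ)) ^ 2 := by
    rw [← Real.rpow_natCast, ← Real.rpow_mul hT0.le]
    congr 1
    push_cast
    ring
  rw [e] at h
  have hp : 0 ≤ T ^ (1 / 2 - σ) := by positivity
  refine le_of_sq_le_sq ?_ (by positivity)
  nlinarith [sq_nonneg (T ^ (1 / 2 - σ))]

lemma monotone_one_sub_cut {c ν : ℝ} (hc : 0 < c) (hν : 0 < ν) :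
    Monotone fun t : ℝ => 1 - cut c (t / (2 * Real.pi * ν)) := by
  intro s t hst
  have h1 : s / (2 * Real.pi * ν) / c ≤ t / (2 * Real.pi * ν) / c :=
    div_le_div_of_nonneg_right (div_le_div_of_nonneg_right hst (by positivity)) hc.le
  have h2 : cut c (t / (2 * Real.pi * ν)) ≤ cut c (s / (2 * Real.pi * ν)) :=
    max_le_max le_rfl (min_le_min le_rfl (by linarith))
  simp only
  linarith

lemma norm_integral_main_main_le (ha : 0 < a) (hT : 0 < T) {w : ℝ} (hw0 : 0 ≤ w) (hw1 : w ≤ 1)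
    {m k : ℕ} (hmk : m ≠ k) :
    ‖∫ t in T..2 * T, (w : ℂ) * (lerchTerm a lam (σ + t * I) m *
      (starRingEnd ℂ) (lerchTerm a lam (σ + t * I) k))‖ ≤
      2 * (((m : ℝ) + a) ^ (-σ) * ((k : ℝ) + a) ^ (-σ) *
        (1 / |Real.log (m + a) - Real.log (k + a)|)) := by
  have hx : 0 < (m : ℝ) + a := by positivity
  have hy : 0 < (k : ℝ) + a := by positivity
  have hδ : 0 < |Real.log (m + a) - Real.log (k + a)| := by
    refine abs_pos.2 (sub_ne_zero.2 fun h => hmk ?_)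
    have := Real.log_injOn_pos hx hy h
    exact_mod_cast add_right_cancel this
  refine (norm_integral_weight_mul_le (w := fun _ => w) (r := fun _ => 0 + (starRingEnd ℂ) 0)
    (θ := fun _ => -Real.log (m + a) - -Real.log (k + a)) (θ' := fun _ => 0) (κ := 0) (R := 0)
    (δ := |Real.log (m + a) - Real.log (k + a)|) (M := ((m : ℝ) + a) ^ (-σ) * ((k : ℝ) + a) ^ (-σ))
    hT (by linarith) monotone_const (fun _ => hw0) (fun _ => hw1) hδ le_rfl
    (fun t _ => hasDerivAt_mul_conj (hasDerivAt_lerchTerm ha m) (hasDerivAt_lerchTerm ha k))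
    (fun t _ => hasDerivAt_const _ _) (fun t _ => ?_) (fun t _ _ => ?_) (by simp) (by simp)).trans
    (le_of_eq ?_)
  · rw [norm_mul, RCLike.norm_conj, norm_lerchTerm ha, norm_lerchTerm ha]
    simp
  · rw [← neg_sub', abs_neg]
  · simp only [zero_div, add_zero, mul_zero]
    ring

lemma norm_integral_dual_dual_le (h0 : 0 < lam) (hσ : 1 / 2 ≤ σ) (hσ1 : σ ≤ 1) (hT : 48 ≤ T)
    {w : ℝ → ℝ} (hw : Monotone w) (hw0 : ∀ t, 0 ≤ w t) (hw1 : ∀ t, w t ≤ 1) {m k : ℕ}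
    (hmk : m ≠ k) :
    ‖∫ t in T..2 * T, (w t : ℂ) * (dualCoeff a lam σ t m *
      (starRingEnd ℂ) (dualCoeff a lam σ t k))‖ ≤
      420 * T ^ (1 - 2 * σ) * (((m : ℝ) + lam) ^ (-(1 - σ)) * ((k : ℝ) + lam) ^ (-(1 - σ)) *
        (1 / |Real.log (m + lam) - Real.log (k + lam)|)) := by
  have hx : 0 < (m : ℝ) + lam := by positivity
  have hy : 0 < (k : ℝ) + lam := by positivity
  have hT0 : 0 < T := by linarith
  have hδ : 0 < |Real.log (m + lam) - Real.log (k + lam)| := by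
    refine abs_pos.2 (sub_ne_zero.2 fun h => hmk ?_)
    have := Real.log_injOn_pos hx hy h
    exact_mod_cast add_right_cancel this
  refine (norm_integral_weight_mul_le
    (r := fun t => chiError σ t + (starRingEnd ℂ) (chiError σ t))
    (θ := fun _ => Real.log (m + lam) - Real.log (k + lam)) (θ' := fun _ => 0) (κ := 0)
    (R := 18 / T) (δ := |Real.log (m + lam) - Real.log (k + lam)|)
    (M := 21 * T ^ (1 - 2 * σ) * (((m : ℝ) + lam) ^ (-(1 - σ)) * ((k : ℝ) + lam) ^ (-(1 - σ))))
    hT0 (by linarith) hw hw0 hw1 hδ (by positivity) (fun t ht => ?_)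
    (fun t _ => hasDerivAt_const _ _) (fun t ht => ?_) (fun t _ _ => le_rfl) (fun t ht => ?_)
    (by simp)).trans (le_of_eq ?_)
  · have h := hasDerivAt_mul_conj (hasDerivAt_dualCoeff (a := a) h0 hσ1 ht m)
      (hasDerivAt_dualCoeff (a := a) h0 hσ1 ht k)
    have e : -Real.log (t / (2 * Real.pi * (m + lam))) - -Real.log (t / (2 * Real.pi * (k + lam))) =
        Real.log (m + lam) - Real.log (k + lam) := by
      rw [Real.log_div ht.ne' (by positivity), Real.log_div ht.ne' (by positivity),
        Real.log_mul (by positivity) hx.ne', Real.log_mul (by positivity) hy.ne']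
      ring
    rwa [e] at h
  · rw [norm_mul, RCLike.norm_conj, norm_dualCoeff h0, norm_dualCoeff h0, neg_sub,
      mul_mul_mul_comm, ← sq]
    exact mul_le_mul_of_nonneg_right (norm_chi_sq_le_of_le hσ hσ1 hT ht.1) (by positivity)
  · have h := norm_chiError_le (σ := σ) (by linarith) hσ1 (t := t) (by linarith [ht.1])
    refine (norm_add_le _ _).trans ?_
    rw [RCLike.norm_conj]
    have h2 : 9 / t ≤ 9 / T := div_le_div_of_nonneg_left (by norm_num) hT0 ht.1
    have h3 : 18 / T = 9 / T + 9 / T := by ring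
    linarith
  · field_simp
    ring

lemma norm_integral_main_dual_le (ha : 0 < a) (h0 : 0 < lam) (hσ : 1 / 2 ≤ σ) (hσ1 : σ ≤ 1)
    (hT : 48 ≤ T) {w : ℝ → ℝ} (hw : Monotone w) (hw0 : ∀ t, 0 ≤ w t) (hw1 : ∀ t, w t ≤ 1)
    {m k : ℕ} (hlow : ∀ t, 0 < w t → 3 / 2 * (m + a) ≤ t / (2 * Real.pi * (k + lam))) :
    ‖∫ t in T..2 * T, (w t : ℂ) * (lerchTerm a lam (σ + t * I) m *
      (starRingEnd ℂ) (dualCoeff a lam σ t k))‖ ≤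
      210 * T ^ (1 / 2 - σ) * (((m : ℝ) + a) ^ (-σ) * ((k : ℝ) + lam) ^ (-(1 - σ))) := by
  have hx : 0 < (m : ℝ) + a := by positivity
  have hy : 0 < (k : ℝ) + lam := by positivity
  have hT0 : 0 < T := by linarith
  refine (norm_integral_weight_mul_le
    (r := fun t => 0 + (starRingEnd ℂ) (chiError σ t))
    (θ := fun t => -Real.log (m + a) - -Real.log (t / (2 * Real.pi * (k + lam))))
    (θ' := fun t => 1 / t) (κ := 1 / T) (R := 9 / T) (δ := 1 / 3)
    (M := 5 * T ^ (1 / 2 - σ) * (((m : ℝ) + a) ^ (-σ) * ((k : ℝ) + lam) ^ (-(1 - σ))))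
    hT0 (by linarith) hw hw0 hw1 (by norm_num) (by positivity) (fun t ht =>
      hasDerivAt_mul_conj (hasDerivAt_lerchTerm ha m) (hasDerivAt_dualCoeff h0 hσ1 ht k))
    (fun t ht => ?_) (fun t ht => ?_) (fun t ht hwt => ?_) (fun t ht => ?_)
    (fun t ht => ?_)).trans (le_of_eq ?_)
  · have ht0 : 0 < t := hT0.trans_le ht.1
    have h := (((hasDerivAt_id t).div_const (2 * Real.pi * (k + lam))).log
      (by simp only [id]; positivity)).neg.const_sub (-Real.log (m + a))
    refine h.congr_deriv ?_
    simp only [id]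
    field_simp
  · rw [norm_mul, RCLike.norm_conj, norm_lerchTerm ha, norm_dualCoeff h0, neg_sub]
    have h := norm_chi_le_of_le hσ hσ1 hT ht.1
    simp only [add_re, ofReal_re, mul_re, I_re, mul_zero, ofReal_im, I_im, mul_one, sub_self,
      add_zero]
    calc ((m : ℝ) + a) ^ (-σ) * (‖chi σ t‖ * ((k : ℝ) + lam) ^ (σ - 1))
        = ‖chi σ t‖ * (((m : ℝ) + a) ^ (-σ) * ((k : ℝ) + lam) ^ (σ - 1)) := by ring
      _ ≤ _ := mul_le_mul_of_nonneg_right h (by positivity)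
  · have h := hlow t hwt
    have h1 := Real.log_le_log (by positivity) h
    rw [Real.log_mul (by norm_num) hx.ne'] at h1
    have h2 := Real.one_sub_inv_le_log_of_pos (show (0 : ℝ) < 3 / 2 by norm_num)
    norm_num at h2
    refine le_trans ?_ (le_abs_self _)
    linarith
  · have h := norm_chiError_le (σ := σ) (by linarith) hσ1 (t := t) (by linarith [ht.1])
    rw [zero_add, RCLike.norm_conj]
    exact h.trans (div_le_div_of_nonneg_left (by norm_num) hT0 ht.1)
  · rw [abs_of_pos (one_div_pos.2 (hT0.trans_le ht.1))]
    exact one_div_le_one_div_of_le hT0 ht.1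
  · field_simp
    ring

end pairs

section sums

variable {a lam σ T : ℝ}

lemma cut_mul_cut {c c' : ℝ} (hc : 0 < c) (hcc : 2 * c ≤ c') (x : ℝ) :
    cut c x * cut c' x = cut c x := by
  rcases le_total x (2 * c) with h | h
  · rw [cut_eq_one (by linarith) (h.trans hcc), mul_one]
  · rw [cut_eq_zero hc h, zero_mul]

lemma one_sub_cut_mul_one_sub_cut {c c' : ℝ} (hc : 0 < c') (hcc : 2 * c' ≤ c) (x : ℝ) :
    (1 - cut c x) * (1 - cut c' x) = 1 - cut c x := by
  rcases le_total x c with h | h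
  · rw [cut_eq_one (by linarith) h, sub_self, zero_mul]
  · rw [cut_eq_zero hc (hcc.trans h), sub_zero, mul_one]

lemma sum_mul_conj_sum (N : ℕ) (u v : ℕ → ℝ) (x y : ℕ → ℂ) :
    (∑ m ∈ range N, (u m : ℂ) * x m) * (starRingEnd ℂ) (∑ k ∈ range N, (v k : ℂ) * y k) =
      ∑ k ∈ range N, ∑ m ∈ range N, ((u m * v k : ℝ) : ℂ) * (x m * (starRingEnd ℂ) (y k)) := by
  rw [map_sum, Finset.sum_mul_sum, Finset.sum_comm]
  refine Finset.sum_congr rfl fun k _ => Finset.sum_congr rfl fun m _ => ?_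
  rw [map_mul, conj_ofReal]
  push_cast
  ring

lemma norm_integral_sum_sum_le {x y : ℝ} {N : ℕ} {s : ℕ → Finset ℕ} {F : ℕ → ℕ → ℝ → ℂ}
    {B : ℕ → ℕ → ℝ}
    (hF : ∀ k, ∀ m, IntervalIntegrable (F k m) volume x y)
    (hB : ∀ k ∈ range N, ∀ m ∈ s k, ‖∫ t in x..y, F k m t‖ ≤ B k m) :
    ‖∫ t in x..y, ∑ k ∈ range N, ∑ m ∈ s k, F k m t‖ ≤ ∑ k ∈ range N, ∑ m ∈ s k, B k m := by
  have hi : ∀ k, IntervalIntegrable (fun t => ∑ m ∈ s k, F k m t) volume x y := fun k => by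
    have h := IntervalIntegrable.sum (s k) (f := fun m => F k m) (μ := volume) (a := x) (b := y)
      fun m _ => hF k m
    simpa only [Finset.sum_fn] using h
  rw [intervalIntegral.integral_finsetSum fun k _ => hi k]
  refine (norm_sum_le _ _).trans (Finset.sum_le_sum fun k hk => ?_)
  rw [intervalIntegral.integral_finsetSum fun m _ => hF k m]
  exact (norm_sum_le _ _).trans (Finset.sum_le_sum fun m hm => hB k hk m hm)

lemma continuous_lerchTerm (ha : 0 < a) (m : ℕ) :
    Continuous fun t : ℝ => lerchTerm a lam (σ + t * I) m :=
  continuous_iff_continuousAt.2 fun _ => (hasDerivAt_lerchTerm ha m).continuousAt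

lemma continuousOn_dualCoeff (h0 : 0 < lam) (hσ1 : σ ≤ 1) (k : ℕ) :
    ContinuousOn (fun t : ℝ => dualCoeff a lam σ t k) (Set.Ioi 0) :=
  fun _ ht => (hasDerivAt_dualCoeff h0 hσ1 ht k).continuousAt.continuousWithinAt

lemma continuous_mainSum (ha : 0 < a) (c : ℝ) (N : ℕ) :
    Continuous (mainSum a lam σ c N) :=
  continuous_finsetSum _ fun m _ => continuous_const.mul (continuous_lerchTerm ha m)

lemma continuousOn_dualSum (h0 : 0 < lam) (hσ1 : σ ≤ 1) (c : ℝ) (N : ℕ) :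
    ContinuousOn (dualSum a lam σ c N) (Set.Ioi 0) := by
  refine continuousOn_finsetSum _ fun k _ => ContinuousOn.mul ?_ (continuousOn_dualCoeff h0 hσ1 k)
  have := continuous_cut c
  exact Continuous.continuousOn (by fun_prop)

lemma uIcc_subset_Ioi (hT : 0 < T) : Set.uIcc T (2 * T) ⊆ Set.Ioi 0 := by
  rw [Set.uIcc_of_le (by linarith)]
  exact fun t ht => hT.trans_le ht.1

lemma exists_norm_integral_mainSum_le (ha : 0 < a) (ha1 : a ≤ 1) (hσ : 0 < σ) (hσ1 : σ < 1) :
    ∃ C > 0, ∀ (T c c' : ℝ) (N : ℕ), 0 < T → 0 < c → 2 * c ≤ c' → 1 ≤ N →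
      ‖∫ t in T..2 * T, (mainSum a lam σ c N t * (starRingEnd ℂ) (mainSum a lam σ c' N t) -
        ((∑ m ∈ range N, cut c (m + a) * ((m : ℝ) + a) ^ (-(2 * σ)) : ℝ) : ℂ))‖ ≤
        C * ((N : ℝ) ^ (2 - 2 * σ) * (1 + Real.log N)) := by
  obtain ⟨C, hC, hS⟩ := exists_sum_sum_div_log_le ha ha1 hσ hσ1
  refine ⟨2 * C, by positivity, fun T c c' N hT hc hcc hN => ?_⟩
  have e : ∀ t : ℝ, mainSum a lam σ c N t * (starRingEnd ℂ) (mainSum a lam σ c' N t) -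
      ((∑ m ∈ range N, cut c (m + a) * ((m : ℝ) + a) ^ (-(2 * σ)) : ℝ) : ℂ) =
      ∑ k ∈ range N, ∑ m ∈ (range N).erase k, ((cut c (m + a) * cut c' (k + a) : ℝ) : ℂ) *
        (lerchTerm a lam (σ + t * I) m * (starRingEnd ℂ) (lerchTerm a lam (σ + t * I) k)) := by
    intro t
    rw [mainSum, mainSum, sum_mul_conj_sum N (fun m => cut c (m + a)) (fun k => cut c' (k + a)),
      sub_eq_iff_eq_add, ofReal_sum, ← Finset.sum_add_distrib]
    refine Finset.sum_congr rfl fun k hk => ?_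
    rw [← Finset.sum_erase_add _ _ hk, cut_mul_cut hc hcc, mul_conj, normSq_eq_norm_sq,
      norm_lerchTerm ha, ← ofReal_mul]
    congr 3
    rw [← Real.rpow_natCast, ← Real.rpow_mul (by positivity)]
    congr 1
    simp
    ring
  simp_rw [e]
  refine (norm_integral_sum_sum_le (s := fun k => (range N).erase k) (fun k m => ?_) fun k _ m hm =>
    norm_integral_main_main_le ha hT (mul_nonneg (cut_nonneg _ _) (cut_nonneg _ _))
      (mul_le_one₀ (cut_le_one _ _) (cut_nonneg _ _) (cut_le_one _ _))
      (Finset.ne_of_mem_erase hm)).trans ?_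
  · exact (continuous_const.mul ((continuous_lerchTerm ha m).mul
      (continuous_conj.comp (continuous_lerchTerm ha k)))).intervalIntegrable _ _
  · simp_rw [← Finset.mul_sum]
    rw [mul_assoc]
    exact mul_le_mul_of_nonneg_left (hS N hN) (by norm_num)

lemma exists_norm_integral_dualSum_le (h0 : 0 < lam) (h1 : lam ≤ 1) (hσ : 1 / 2 ≤ σ)
    (hσ1 : σ < 1) :
    ∃ C > 0, ∀ (T c c' : ℝ) (N : ℕ), 48 ≤ T → 0 < c' → 2 * c' ≤ c → 1 ≤ N →
      ‖∫ t in T..2 * T, (dualSum a lam σ c N t * (starRingEnd ℂ) (dualSum a lam σ c' N t) -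
        ((‖chi σ t‖ ^ 2 * ∑ k ∈ range N, (1 - cut c (t / (2 * Real.pi * (k + lam)))) *
          ((k : ℝ) + lam) ^ (-(2 - 2 * σ)) : ℝ) : ℂ))‖ ≤
        C * (T ^ (1 - 2 * σ) * ((N : ℝ) ^ (2 * σ) * (1 + Real.log N))) := by
  obtain ⟨C, hC, hS⟩ := exists_sum_sum_div_log_le h0 h1 (by linarith : 0 < 1 - σ)
    (by linarith : 1 - σ < 1)
  refine ⟨420 * C, by positivity, fun T c c' N hT hc hcc hN => ?_⟩
  have hT0 : 0 < T := by linarith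
  have e : ∀ t : ℝ, dualSum a lam σ c N t * (starRingEnd ℂ) (dualSum a lam σ c' N t) -
      ((‖chi σ t‖ ^ 2 * ∑ k ∈ range N, (1 - cut c (t / (2 * Real.pi * (k + lam)))) *
          ((k : ℝ) + lam) ^ (-(2 - 2 * σ)) : ℝ) : ℂ) =
      ∑ k ∈ range N, ∑ m ∈ (range N).erase k,
        (((1 - cut c (t / (2 * Real.pi * (m + lam)))) *
          (1 - cut c' (t / (2 * Real.pi * (k + lam)))) : ℝ) : ℂ) *
        (dualCoeff a lam σ t m * (starRingEnd ℂ) (dualCoeff a lam σ t k)) := by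
    intro t
    rw [dualSum, dualSum, sum_mul_conj_sum N (fun m => 1 - cut c (t / (2 * Real.pi * (m + lam))))
      (fun k => 1 - cut c' (t / (2 * Real.pi * (k + lam)))), sub_eq_iff_eq_add, Finset.mul_sum,
      ofReal_sum, ← Finset.sum_add_distrib]
    refine Finset.sum_congr rfl fun k hk => ?_
    rw [← Finset.sum_erase_add _ _ hk, one_sub_cut_mul_one_sub_cut hc hcc, mul_conj,
      normSq_eq_norm_sq, norm_dualCoeff h0, ← ofReal_mul]
    congr 2
    rw [mul_pow, ← Real.rpow_natCast (((k : ℝ) + lam) ^ (σ - 1)), ← Real.rpow_mul (by positivity),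
      show (σ - 1) * ((2 : ℕ) : ℝ) = -(2 - 2 * σ) by push_cast; ring]
    ring
  simp_rw [e]
  refine (norm_integral_sum_sum_le (s := fun k => (range N).erase k) (fun k m => ?_) fun k _ m hm =>
    norm_integral_dual_dual_le h0 hσ hσ1.le hT
      ((monotone_one_sub_cut (c := c) (ν := m + lam) (by linarith) (by positivity)).mul
        (monotone_one_sub_cut (c := c') (ν := k + lam) hc (by positivity))
        (fun t => sub_nonneg.2 (cut_le_one _ _)) (fun t => sub_nonneg.2 (cut_le_one _ _)))
      (fun t => mul_nonneg (sub_nonneg.2 (cut_le_one _ _)) (sub_nonneg.2 (cut_le_one _ _)))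
      (fun t => mul_le_one₀ (sub_le_self _ (cut_nonneg _ _)) (sub_nonneg.2 (cut_le_one _ _))
        (sub_le_self _ (cut_nonneg _ _)))
      (Finset.ne_of_mem_erase hm)).trans ?_
  · refine ContinuousOn.intervalIntegrable (ContinuousOn.mono ?_ (uIcc_subset_Ioi hT0))
    have := continuous_cut c
    have := continuous_cut c'
    exact ContinuousOn.mul (Continuous.continuousOn (by fun_prop))
      ((continuousOn_dualCoeff h0 hσ1.le m).mul
        (continuous_conj.comp_continuousOn (continuousOn_dualCoeff h0 hσ1.le k)))
  · simp_rw [← Finset.mul_sum]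
    have h := hS N hN
    rw [show 2 - 2 * (1 - σ) = 2 * σ by ring] at h
    refine (mul_le_mul_of_nonneg_left h (by positivity)).trans (le_of_eq ?_)
    ring

lemma exists_norm_integral_cross_le (ha : 0 < a) (ha1 : a ≤ 1) (h0 : 0 < lam) (h1 : lam ≤ 1)
    (hσ : 1 / 2 ≤ σ) (hσ1 : σ < 1) :
    ∃ C > 0, ∀ (T c c' : ℝ) (N : ℕ), 48 ≤ T → 0 < c → 3 * c ≤ c' → 1 ≤ N →
      ‖∫ t in T..2 * T, mainSum a lam σ c N t * (starRingEnd ℂ) (dualSum a lam σ c' N t)‖ ≤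
        C * (T ^ (1 / 2 - σ) * N) := by
  obtain ⟨C₁, hC₁, hS₁⟩ := exists_sum_rpow_le ha ha1 (by linarith : 0 < σ) hσ1
  obtain ⟨C₂, hC₂, hS₂⟩ := exists_sum_rpow_le h0 h1 (by linarith : 0 < 1 - σ)
    (by linarith : 1 - σ < 1)
  refine ⟨210 * (C₁ * C₂), by positivity, fun T c c' N hT hc hcc hN => ?_⟩
  have hT0 : 0 < T := by linarith
  have hN0 : (0 : ℝ) < N := by exact_mod_cast hN
  have e : ∀ t : ℝ, mainSum a lam σ c N t * (starRingEnd ℂ) (dualSum a lam σ c' N t) =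
      ∑ k ∈ range N, ∑ m ∈ range N,
        ((cut c (m + a) * (1 - cut c' (t / (2 * Real.pi * (k + lam)))) : ℝ) : ℂ) *
        (lerchTerm a lam (σ + t * I) m * (starRingEnd ℂ) (dualCoeff a lam σ t k)) := fun t =>
    sum_mul_conj_sum N (fun m => cut c (m + a))
      (fun k => 1 - cut c' (t / (2 * Real.pi * (k + lam)))) _ _
  simp_rw [e]
  refine (norm_integral_sum_sum_le (s := fun _ => range N) (fun k m => ?_) fun k _ m hm =>
    norm_integral_main_dual_le ha h0 hσ hσ1.le hT
      ((monotone_one_sub_cut (c := c') (ν := k + lam) (by linarith) (by positivity)).const_mul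
        (cut_nonneg _ _))
      (fun t => mul_nonneg (cut_nonneg _ _) (sub_nonneg.2 (cut_le_one _ _)))
      (fun t => mul_le_one₀ (cut_le_one _ _) (sub_nonneg.2 (cut_le_one _ _))
        (sub_le_self _ (cut_nonneg _ _))) fun t ht => ?_).trans ?_
  · refine ContinuousOn.intervalIntegrable (ContinuousOn.mono ?_ (uIcc_subset_Ioi hT0))
    have := continuous_cut c'
    exact ContinuousOn.mul (Continuous.continuousOn (by fun_prop))
      ((continuous_lerchTerm ha m).continuousOn.mul
        (continuous_conj.comp_continuousOn (continuousOn_dualCoeff h0 hσ1.le k)))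
  · have p1 : (m : ℝ) + a < 2 * c := by
      by_contra! h
      rw [cut_eq_zero hc h, zero_mul] at ht
      exact lt_irrefl _ ht
    have p2 : c' < t / (2 * Real.pi * (k + lam)) := by
      by_contra! h
      rw [cut_eq_one (by linarith) h, sub_self, mul_zero] at ht
      exact lt_irrefl _ ht
    linarith
  · simp_rw [← Finset.mul_sum, ← Finset.sum_mul, ← Finset.mul_sum]
    have h := mul_le_mul (hS₁ N hN) (hS₂ N hN)
      (Finset.sum_nonneg fun k _ => by positivity) (by positivity)
    have e2 : (N : ℝ) ^ (1 - σ) * (N : ℝ) ^ (1 - (1 - σ)) = N := by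
      rw [← Real.rpow_add hN0, show 1 - σ + (1 - (1 - σ)) = 1 by ring, Real.rpow_one]
    calc _ ≤ 210 * T ^ (1 / 2 - σ) * (C₁ * (N : ℝ) ^ (1 - σ) * (C₂ * (N : ℝ) ^ (1 - (1 - σ)))) :=
          mul_le_mul_of_nonneg_left h (by positivity)
      _ = 210 * T ^ (1 / 2 - σ) * (C₁ * C₂ * ((N : ℝ) ^ (1 - σ) * (N : ℝ) ^ (1 - (1 - σ)))) := by
          ring
      _ = _ := by rw [e2]; ring

end sums

section dyadic

variable {a lam σ T : ℝ}

lemma norm_mainSum_le (ha : 0 < a) (c : ℝ) (N : ℕ) (t : ℝ) :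
    ‖mainSum a lam σ c N t‖ ≤ ∑ m ∈ range N, ((m : ℝ) + a) ^ (-σ) := by
  refine (norm_sum_le _ _).trans (Finset.sum_le_sum fun m _ => ?_)
  rw [norm_mul, norm_real, Real.norm_of_nonneg (cut_nonneg _ _), norm_lerchTerm ha]
  simp only [add_re, ofReal_re, mul_re, I_re, mul_zero, ofReal_im, I_im, mul_one, sub_self,
    add_zero]
  exact mul_le_of_le_one_left (by positivity) (cut_le_one _ _)

lemma norm_dualSum_le (h0 : 0 < lam) (c : ℝ) (N : ℕ) (t : ℝ) :
    ‖dualSum a lam σ c N t‖ ≤ ‖chi σ t‖ * ∑ k ∈ range N, ((k : ℝ) + lam) ^ (σ - 1) := by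
  rw [Finset.mul_sum]
  refine (norm_sum_le _ _).trans (Finset.sum_le_sum fun k _ => ?_)
  rw [norm_mul, norm_real, Real.norm_of_nonneg (sub_nonneg.2 (cut_le_one _ _)), norm_dualCoeff h0]
  exact mul_le_of_le_one_left (by positivity) (sub_le_self _ (cut_nonneg _ _))

lemma rpow_le_of_le_mul_sqrt {x κ p : ℝ} (hx : 0 ≤ x) (hT : 0 < T) (hκ : 1 ≤ κ) (hp : 0 ≤ p)
    (hp2 : p ≤ 2) (hxT : x ≤ κ * √T) : x ^ p ≤ κ ^ 2 * T ^ (p / 2) := by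
  refine (Real.rpow_le_rpow hx hxT hp).trans ?_
  rw [Real.mul_rpow (by linarith) (by positivity), Real.sqrt_eq_rpow, ← Real.rpow_mul hT.le,
    show 1 / 2 * p = p / 2 by ring, ← Real.rpow_natCast κ]
  exact mul_le_mul_of_nonneg_right (Real.rpow_le_rpow_of_exponent_le hκ (by exact_mod_cast hp2))
    (by positivity)

lemma rpow_le_of_sqrt_le {x p : ℝ} (hT : 0 < T) (hp : p ≤ 0) (hxT : √T ≤ x) :
    x ^ p ≤ T ^ (p / 2) := by
  refine (Real.rpow_le_rpow_of_nonpos (Real.sqrt_pos.2 hT) hxT hp).trans (le_of_eq ?_)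
  rw [Real.sqrt_eq_rpow, ← Real.rpow_mul hT.le, show 1 / 2 * p = p / 2 by ring]

lemma exists_norm_sums_le (ha : 0 < a) (ha1 : a ≤ 1) (h0 : 0 < lam) (h1 : lam < 1)
    (hσ : 1 / 2 ≤ σ) (hσ1 : σ < 1) :
    ∃ K > 0, ∀ (T t c : ℝ) (N : ℕ), 48 ≤ T → T ≤ t → t ≤ 2 * T → √T ≤ c → c ≤ 9 * √T →
      18 * √T ≤ N → (N : ℝ) ≤ 19 * √T →
      ‖mainSum a lam σ c N t‖ ≤ K * T ^ ((1 - σ) / 2) ∧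
      ‖dualSum a lam σ c N t‖ ≤ K * T ^ ((1 - σ) / 2) ∧
      ‖zetaL a lam (σ + t * I) - (mainSum a lam σ c N t + dualSum a lam σ c N t)‖ ≤
        K * T ^ ((1 - σ) / 2) / T := by
  obtain ⟨C₁, hC₁, hS₁⟩ := exists_sum_rpow_le ha ha1 (by linarith : 0 < σ) hσ1
  obtain ⟨C₂, hC₂, hS₂⟩ := exists_sum_rpow_le h0 h1.le (by linarith : 0 < 1 - σ)
    (by linarith : 1 - σ < 1)
  obtain ⟨C₃, hC₃, hS₃⟩ := exists_norm_zetaL_sub_sums_le ha ha1 h0 h1 hσ hσ1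
  refine ⟨C₁ * 361 + 2 * (5 * (C₂ * 361)) + C₃ * 82, by positivity,
    fun T t c N hT hTt ht2 hc hc9 hN hN19 => ?_⟩
  have hT0 : 0 < T := by linarith
  have hs : 0 < √T := Real.sqrt_pos.2 hT0
  have hss : √T * √T = T := Real.mul_self_sqrt hT0.le
  have hs1 : 1 ≤ √T := Real.one_le_sqrt.2 (by linarith)
  have hN1 : 1 ≤ N := by
    have : (1 : ℝ) ≤ N := by linarith
    exact_mod_cast this
  have hc0 : 0 < c := hs.trans_le hc
  have ht0 : 0 < t := hT0.trans_le hTt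
  set X := T ^ ((1 - σ) / 2) with hX
  have hX0 : 0 < X := by positivity
  have b1 : ∑ m ∈ range N, ((m : ℝ) + a) ^ (-σ) ≤ C₁ * 361 * X := by
    refine (hS₁ N hN1).trans ?_
    have h := rpow_le_of_le_mul_sqrt (by positivity) hT0 (by norm_num) (by linarith : 0 ≤ 1 - σ)
      (by linarith) hN19
    rw [mul_assoc]
    exact mul_le_mul_of_nonneg_left (h.trans_eq (by rw [hX]; norm_num)) hC₁.le
  have b2 : ‖chi σ t‖ * ∑ k ∈ range N, ((k : ℝ) + lam) ^ (σ - 1) ≤ 5 * (C₂ * 361) * X := by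
    have h := rpow_le_of_le_mul_sqrt (by positivity) hT0 (by norm_num)
      (by linarith : 0 ≤ 1 - (1 - σ)) (by linarith) hN19
    have h2 := hS₂ N hN1
    rw [neg_sub] at h2
    calc ‖chi σ t‖ * ∑ k ∈ range N, ((k : ℝ) + lam) ^ (σ - 1)
        ≤ 5 * T ^ (1 / 2 - σ) * (C₂ * (19 ^ 2 * T ^ ((1 - (1 - σ)) / 2))) :=
          mul_le_mul (norm_chi_le_of_le hσ hσ1.le hT hTt)
            (h2.trans (mul_le_mul_of_nonneg_left h hC₂.le))
            (Finset.sum_nonneg fun k _ => by positivity) (by positivity)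
      _ = 5 * (C₂ * 361) * (T ^ (1 / 2 - σ) * T ^ ((1 - (1 - σ)) / 2)) := by ring
      _ = 5 * (C₂ * 361) * X := by
          rw [← Real.rpow_add hT0, hX]
          congr 2
          ring
  refine ⟨(norm_mainSum_le ha c N t).trans (b1.trans ?_),
    (norm_dualSum_le h0 c N t).trans (b2.trans ?_), (hS₃ t c N (by linarith) hc0 (by linarith)
      ?_).trans ?_⟩
  · exact mul_le_mul_of_nonneg_right (by nlinarith) hX0.le
  · exact mul_le_mul_of_nonneg_right (by nlinarith) hX0.le
  · rw [div_le_iff₀ (by positivity)]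
    have p1 : √T * √T ≤ (N : ℝ) * c := mul_le_mul (by linarith) hc hs.le (by positivity)
    have p2 : 0 < (N : ℝ) * c := by nlinarith
    nlinarith [Real.pi_gt_three]
  · have p1 : c ^ (-σ - 1) ≤ X / T := by
      refine (rpow_le_of_sqrt_le hT0 (by linarith) hc).trans (le_of_eq ?_)
      rw [hX, ← Real.rpow_sub_one hT0.ne']
      congr 1
      ring
    have p2 : c ^ 2 / t ≤ 81 := by
      rw [div_le_iff₀ (by linarith)]
      nlinarith
    have p3 : c ^ (-σ - 1) * (1 + c ^ 2 / t) ≤ X / T * 82 :=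
      mul_le_mul p1 (by linarith) (by positivity) (by positivity)
    have p4 : 2 / t * (‖chi σ t‖ * ∑ k ∈ range N, ((k : ℝ) + lam) ^ (σ - 1)) ≤
        2 / T * (5 * (C₂ * 361) * X) :=
      mul_le_mul (div_le_div_of_nonneg_left (by norm_num) hT0 hTt) b2
        (mul_nonneg (norm_nonneg _) (Finset.sum_nonneg fun k _ => by positivity)) (by positivity)
    have p5 : 0 ≤ C₁ * 361 * X / T := by positivity
    calc _ ≤ C₃ * (X / T * 82) + 2 / T * (5 * (C₂ * 361) * X) :=
          add_le_add (mul_le_mul_of_nonneg_left p3 hC₃.le) p4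
      _ ≤ C₃ * (X / T * 82) + 2 / T * (5 * (C₂ * 361) * X) + C₁ * 361 * X / T :=
          le_add_of_nonneg_right p5
      _ = _ := by ring

lemma continuousOn_chi (hσ1 : σ ≤ 1) : ContinuousOn (chi σ) (Set.Ioi 0) :=
  fun _ ht => (hasDerivAt_chi hσ1 ht).continuousAt.continuousWithinAt

lemma continuousOn_diagSum (hσ1 : σ ≤ 1) (c : ℝ) (N : ℕ) :
    ContinuousOn (diagSum a lam σ c N) (Set.Ioi 0) := by
  refine continuousOn_const.add (((continuousOn_chi hσ1).norm.pow 2).mul ?_)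
  have := continuous_cut c
  exact Continuous.continuousOn (by fun_prop)

lemma norm_integral_le_of_decomp {f g₁ g₂ g₃ g₄ r : ℝ → ℂ} {R : ℝ} (hT : 0 < T)
    (hf : ContinuousOn f (Set.Ioi 0)) (h₁ : ContinuousOn g₁ (Set.Ioi 0))
    (h₂ : ContinuousOn g₂ (Set.Ioi 0)) (h₃ : ContinuousOn g₃ (Set.Ioi 0))
    (h₄ : ContinuousOn g₄ (Set.Ioi 0)) (hr : ∀ t ∈ Set.Icc T (2 * T), ‖r t‖ ≤ R)
    (hd : ∀ t, f t = g₁ t + g₂ t + g₃ t + (starRingEnd ℂ) (g₄ t) + r t) :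
    ‖∫ t in T..2 * T, f t‖ ≤ ‖∫ t in T..2 * T, g₁ t‖ + ‖∫ t in T..2 * T, g₂ t‖ +
      ‖∫ t in T..2 * T, g₃ t‖ + ‖∫ t in T..2 * T, g₄ t‖ + T * R := by
  have hi : ∀ {g : ℝ → ℂ}, ContinuousOn g (Set.Ioi 0) → IntervalIntegrable g volume T (2 * T) :=
    fun hg => (hg.mono (uIcc_subset_Ioi hT)).intervalIntegrable
  have h₄' : ContinuousOn (fun t => (starRingEnd ℂ) (g₄ t)) (Set.Ioi 0) :=
    continuous_conj.comp_continuousOn h₄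
  have er : r = fun t => f t - (g₁ t + g₂ t + g₃ t + (starRingEnd ℂ) (g₄ t)) := by
    funext t
    rw [hd t]
    ring
  have hrc : ContinuousOn r (Set.Ioi 0) := by
    rw [er]
    exact hf.sub (((h₁.add h₂).add h₃).add h₄')
  have e : ∫ t in T..2 * T, f t = (∫ t in T..2 * T, g₁ t) + (∫ t in T..2 * T, g₂ t) +
      (∫ t in T..2 * T, g₃ t) + (starRingEnd ℂ) (∫ t in T..2 * T, g₄ t) +
      ∫ t in T..2 * T, r t := by
    have k₂ : ContinuousOn (fun t => g₁ t + g₂ t) (Set.Ioi 0) := h₁.add h₂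
    have k₃ : ContinuousOn (fun t => g₁ t + g₂ t + g₃ t) (Set.Ioi 0) := k₂.add h₃
    have k₄ : ContinuousOn (fun t => g₁ t + g₂ t + g₃ t + (starRingEnd ℂ) (g₄ t)) (Set.Ioi 0) :=
      k₃.add h₄'
    rw [intervalIntegral.integral_congr fun t _ => hd t,
      intervalIntegral.integral_add (hi k₄) (hi hrc),
      intervalIntegral.integral_add (hi k₃) (hi h₄'),
      intervalIntegral.integral_add (hi k₂) (hi h₃),
      intervalIntegral.integral_add (hi h₁) (hi h₂), intervalIntegral.intervalIntegral_conj]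
  have b : ‖∫ t in T..2 * T, r t‖ ≤ T * R := by
    refine (intervalIntegral.norm_integral_le_of_norm_le_const (C := R) fun t ht => hr t ?_).trans
      (le_of_eq ?_)
    · rw [Set.uIoc_of_le (by linarith)] at ht
      exact ⟨ht.1.le, ht.2⟩
    · rw [show 2 * T - T = T by ring, abs_of_pos hT, mul_comm]
  rw [e]
  refine (norm_add_le _ _).trans (add_le_add ((norm_add_le _ _).trans (add_le_add
    ((norm_add_le _ _).trans (add_le_add (norm_add_le _ _) le_rfl)) ?_)) b)
  rw [RCLike.norm_conj]

end dyadic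

section dyadicMoment

variable {a lam σ T : ℝ}

lemma one_le_log_of_le (hT : 48 ≤ T) : 1 ≤ Real.log T := by
  rw [Real.le_log_iff_exp_le (by linarith)]
  linarith [Real.exp_one_lt_d9]

lemma exists_norm_integral_sub_diagSum_le (ha : 0 < a) (ha1 : a ≤ 1) (h0 : 0 < lam)
    (h1 : lam < 1) (hσ : 1 / 2 ≤ σ) (hσ1 : σ < 1) :
    ∃ C > 0, ∀ (T : ℝ) (N : ℕ), 48 ≤ T → 18 * √T ≤ N → (N : ℝ) ≤ 19 * √T →
      ‖∫ t in T..2 * T, ((‖zetaL a lam (σ + t * I)‖ ^ 2 - diagSum a lam σ (3 * √T) N t : ℝ) : ℂ)‖ ≤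
        C * (T ^ (1 - σ) * Real.log T) := by
  have hσ0 : 0 < σ := by linarith
  obtain ⟨C₁, hC₁, hS₁⟩ := exists_norm_integral_mainSum_le (lam := lam) ha ha1 hσ0 hσ1
  obtain ⟨C₂, hC₂, hS₂⟩ := exists_norm_integral_dualSum_le (a := a) h0 h1.le hσ hσ1
  obtain ⟨C₃, hC₃, hS₃⟩ := exists_norm_integral_cross_le ha ha1 h0 h1.le hσ hσ1
  obtain ⟨K, hK, hB⟩ := exists_norm_sums_le ha ha1 h0 h1 hσ hσ1
  refine ⟨C₁ * (361 * 3) + C₂ * (361 * 3) + C₃ * 361 + C₃ * 361 + 5 * K ^ 2, by positivity,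
    fun T N hT hN hN19 => ?_⟩
  have hT0 : 0 < T := by linarith
  have hs : 0 < √T := Real.sqrt_pos.2 hT0
  have hss : √T * √T = T := Real.mul_self_sqrt hT0.le
  have hs1 : 1 ≤ √T := Real.one_le_sqrt.2 (by linarith)
  have hN1 : 1 ≤ N := by
    have : (1 : ℝ) ≤ N := by linarith
    exact_mod_cast this
  have hN0 : (0 : ℝ) < N := by exact_mod_cast hN1
  have hL := one_le_log_of_le hT
  have hlogN : 1 + Real.log N ≤ 3 * Real.log T := by
    have h := Real.log_le_log hN0 (show (N : ℝ) ≤ T ^ 2 by nlinarith)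
    rw [Real.log_pow] at h
    push_cast at h
    linarith
  have hlogN0 : 0 ≤ 1 + Real.log N := by
    have := Real.log_nonneg (show (1 : ℝ) ≤ N by exact_mod_cast hN1)
    linarith
  set L := Real.log T with hLdef
  set X := T ^ ((1 - σ) / 2) with hX
  have hX0 : 0 < X := by positivity
  have hXX : X * X = T ^ (1 - σ) := by
    rw [hX, ← Real.rpow_add hT0, add_halves]
  have hY : 0 < T ^ (1 - σ) := by positivity
  have hc : Continuous fun t : ℝ => zetaL a lam (σ + t * I) := continuous_zetaL ha h0 h1 hσ0
  have hA := fun c =>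
    (continuous_mainSum (lam := lam) (σ := σ) ha c N).continuousOn (s := Set.Ioi 0)
  have hQ := fun c => continuousOn_dualSum (a := a) h0 hσ1.le c N
  have hD₂ : ContinuousOn (fun t : ℝ => ‖chi σ t‖ ^ 2 * ∑ k ∈ range N,
      (1 - cut (3 * √T) (t / (2 * Real.pi * (k + lam)))) * ((k : ℝ) + lam) ^ (-(2 - 2 * σ)))
      (Set.Ioi 0) := by
    refine ((continuousOn_chi hσ1.le).norm.pow 2).mul ?_
    have := continuous_cut (3 * √T)
    exact Continuous.continuousOn (by fun_prop)
  have hconj : ∀ {f : ℝ → ℂ}, ContinuousOn f (Set.Ioi 0) →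
      ContinuousOn (fun t => (starRingEnd ℂ) (f t)) (Set.Ioi 0) :=
    fun hf => continuous_conj.comp_continuousOn hf
  have key := norm_integral_le_of_decomp (T := T) (R := 5 * K ^ 2 * (X * X) / T)
    (f := fun t => ((‖zetaL a lam (σ + t * I)‖ ^ 2 - diagSum a lam σ (3 * √T) N t : ℝ) : ℂ))
    (g₁ := fun t => mainSum a lam σ (3 * √T) N t *
      (starRingEnd ℂ) (mainSum a lam σ (9 * √T) N t) -
        ((∑ m ∈ range N, cut (3 * √T) (m + a) * ((m : ℝ) + a) ^ (-(2 * σ)) : ℝ) : ℂ))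
    (g₂ := fun t => dualSum a lam σ (3 * √T) N t *
      (starRingEnd ℂ) (dualSum a lam σ (1 * √T) N t) -
        ((‖chi σ t‖ ^ 2 * ∑ k ∈ range N, (1 - cut (3 * √T) (t / (2 * Real.pi * (k + lam)))) *
          ((k : ℝ) + lam) ^ (-(2 - 2 * σ)) : ℝ) : ℂ))
    (g₃ := fun t => mainSum a lam σ (3 * √T) N t * (starRingEnd ℂ) (dualSum a lam σ (9 * √T) N t))
    (g₄ := fun t => mainSum a lam σ (1 * √T) N t * (starRingEnd ℂ) (dualSum a lam σ (3 * √T) N t))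
    (r := fun t => mainSum a lam σ (3 * √T) N t * (starRingEnd ℂ) (zetaL a lam (σ + t * I) -
        (mainSum a lam σ (9 * √T) N t + dualSum a lam σ (9 * √T) N t)) +
      dualSum a lam σ (3 * √T) N t * (starRingEnd ℂ) (zetaL a lam (σ + t * I) -
        (mainSum a lam σ (1 * √T) N t + dualSum a lam σ (1 * √T) N t)) +
      (zetaL a lam (σ + t * I) - (mainSum a lam σ (3 * √T) N t + dualSum a lam σ (3 * √T) N t)) *
        (starRingEnd ℂ) (zetaL a lam (σ + t * I))) hT0
    (continuous_ofReal.comp_continuousOn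
      ((hc.norm.pow 2).continuousOn.sub (continuousOn_diagSum hσ1.le _ N)))
    (((hA _).mul (hconj (hA _))).sub continuousOn_const)
    (((hQ _).mul (hconj (hQ _))).sub (continuous_ofReal.comp_continuousOn hD₂))
    ((hA _).mul (hconj (hQ _))) ((hA _).mul (hconj (hQ _))) (fun t ht => ?_) (fun t => ?_)
  · refine key.trans ?_
    have k₁ := hS₁ T (3 * √T) (9 * √T) N hT0 (by positivity) (by linarith) hN1
    have k₂ := hS₂ T (3 * √T) (1 * √T) N hT (by positivity) (by linarith) hN1
    have k₃ := hS₃ T (3 * √T) (9 * √T) N hT (by positivity) (by linarith) hN1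
    have k₄ := hS₃ T (1 * √T) (3 * √T) N hT (by positivity) (by linarith) hN1
    have n₁ := rpow_le_of_le_mul_sqrt hN0.le hT0 (by norm_num) (by linarith : 0 ≤ 2 - 2 * σ)
      (by linarith) hN19
    have n₂ := rpow_le_of_le_mul_sqrt hN0.le hT0 (by norm_num) (by linarith : 0 ≤ 2 * σ)
      (by linarith) hN19
    have n₃ := rpow_le_of_le_mul_sqrt hN0.le hT0 (by norm_num) zero_le_one
      (by norm_num) hN19
    rw [Real.rpow_one] at n₃
    rw [show (2 - 2 * σ) / 2 = 1 - σ by ring] at n₁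
    rw [show 2 * σ / 2 = σ by ring] at n₂
    have m₁ : (N : ℝ) ^ (2 - 2 * σ) * (1 + Real.log N) ≤ 361 * 3 * (T ^ (1 - σ) * L) :=
      (mul_le_mul n₁ hlogN hlogN0 (by positivity)).trans_eq (by ring)
    have m₂ : T ^ (1 - 2 * σ) * ((N : ℝ) ^ (2 * σ) * (1 + Real.log N)) ≤
        361 * 3 * (T ^ (1 - σ) * L) := by
      refine (mul_le_mul_of_nonneg_left (mul_le_mul n₂ hlogN hlogN0 (by positivity))
        (by positivity)).trans_eq ?_
      rw [show (1 - σ) = (1 - 2 * σ) + σ by ring, Real.rpow_add hT0]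
      ring
    have m₃ : T ^ (1 / 2 - σ) * N ≤ 361 * (T ^ (1 - σ) * L) := by
      calc T ^ (1 / 2 - σ) * N ≤ T ^ (1 / 2 - σ) * (19 ^ 2 * T ^ ((1 : ℝ) / 2)) :=
            mul_le_mul_of_nonneg_left n₃ (by positivity)
        _ = 361 * (T ^ (1 / 2 - σ) * T ^ ((1 : ℝ) / 2)) := by ring
        _ = 361 * T ^ (1 - σ) := by
            rw [← Real.rpow_add hT0]
            congr 2
            ring
        _ ≤ 361 * (T ^ (1 - σ) * L) :=
            mul_le_mul_of_nonneg_left (le_mul_of_one_le_right hY.le hL) (by norm_num)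
    have m₅ : T * (5 * K ^ 2 * (X * X) / T) ≤ 5 * K ^ 2 * (T ^ (1 - σ) * L) := by
      rw [mul_div_cancel₀ _ hT0.ne', hXX]
      exact mul_le_mul_of_nonneg_left (le_mul_of_one_le_right hY.le hL) (by positivity)
    have q₁ := k₁.trans (mul_le_mul_of_nonneg_left m₁ hC₁.le)
    have q₂ := k₂.trans (mul_le_mul_of_nonneg_left m₂ hC₂.le)
    have q₃ := k₃.trans (mul_le_mul_of_nonneg_left m₃ hC₃.le)
    have q₄ := k₄.trans (mul_le_mul_of_nonneg_left m₃ hC₃.le)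
    refine (add_le_add (add_le_add (add_le_add (add_le_add q₁ q₂) q₃) q₄) m₅).trans_eq ?_
    ring
  · obtain ⟨-, -, r₁⟩ := hB T t (1 * √T) N hT ht.1 ht.2 (by linarith) (by linarith) hN hN19
    obtain ⟨a₂, q₂, r₂⟩ := hB T t (3 * √T) N hT ht.1 ht.2 (by linarith) (by linarith) hN hN19
    obtain ⟨-, -, r₃⟩ := hB T t (9 * √T) N hT ht.1 ht.2 (by linarith) (by linarith) hN hN19
    have hXT : K * X / T ≤ K * X := div_le_self (by positivity) (by linarith)
    have hz : ‖zetaL a lam (σ + t * I)‖ ≤ 3 * (K * X) := by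
      have h := norm_add₃_le (a := mainSum a lam σ (3 * √T) N t)
        (b := dualSum a lam σ (3 * √T) N t) (c := zetaL a lam (σ + t * I) -
          (mainSum a lam σ (3 * √T) N t + dualSum a lam σ (3 * √T) N t))
      rw [add_sub_cancel] at h
      linarith
    refine (norm_add₃_le).trans ?_
    simp only [norm_mul, RCLike.norm_conj]
    have s₁ := mul_le_mul a₂ r₃ (norm_nonneg _) (by positivity)
    have s₂ := mul_le_mul q₂ r₁ (norm_nonneg _) (by positivity)
    have s₃ := mul_le_mul r₂ hz (norm_nonneg _) (by positivity)
    refine (add_le_add (add_le_add s₁ s₂) s₃).trans_eq ?_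
    ring
  · simp only [map_sub, map_add, map_mul, conj_conj]
    rw [diagSum, ofReal_sub, ofReal_add, ← normSq_eq_norm_sq, ← mul_conj]
    ring

lemma exists_abs_integral_dyadic_le (ha : 0 < a) (ha1 : a ≤ 1) (h0 : 0 < lam)
    (h1 : lam < 1) (hσ : 1 / 2 < σ) (hσ1 : σ < 1) :
    ∃ Z₁ Z₂ C : ℝ, hzeta a ((2 * σ : ℝ) : ℂ) = Z₁ ∧ hzeta lam ((2 - 2 * σ : ℝ) : ℂ) = Z₂ ∧
      0 < C ∧ ∀ T : ℝ, 48 ≤ T →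
      |∫ t in T..2 * T, (‖zetaL a lam (σ + t * I)‖ ^ 2 -
        (Z₁ + (t / (2 * Real.pi)) ^ (1 - 2 * σ) * Z₂))| ≤ C * (T ^ (1 - σ) * Real.log T) := by
  obtain ⟨Z₁, Z₂, C₁, hZ₁, hZ₂, hC₁, hD⟩ := exists_abs_diagSum_sub_le ha ha1 h0 h1 hσ hσ1
  obtain ⟨C₂, hC₂, hM⟩ := exists_norm_integral_sub_diagSum_le ha ha1 h0 h1 hσ.le hσ1
  refine ⟨Z₁, Z₂, C₂ + C₁ * 11, hZ₁, hZ₂, by positivity, fun T hT => ?_⟩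
  have hT0 : 0 < T := by linarith
  have hs : 0 < √T := Real.sqrt_pos.2 hT0
  have hss : √T * √T = T := Real.mul_self_sqrt hT0.le
  have hs1 : 1 ≤ √T := Real.one_le_sqrt.2 (by linarith)
  have hL := one_le_log_of_le hT
  set N := ⌈18 * √T⌉₊ with hNdef
  have hN : 18 * √T ≤ N := Nat.le_ceil _
  have hN19 : (N : ℝ) ≤ 19 * √T := by
    have := (Nat.ceil_lt_add_one (show 0 ≤ 18 * √T by positivity)).le
    linarith
  have hY : 0 < T ^ (1 - σ) := by positivity
  have hm := hM T N hT hN hN19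
  rw [intervalIntegral.integral_ofReal, norm_real, Real.norm_eq_abs] at hm
  have hc : Continuous fun t : ℝ => zetaL a lam (σ + t * I) :=
    continuous_zetaL ha h0 h1 (by linarith)
  have hd := (continuousOn_diagSum (a := a) (lam := lam) hσ1.le (3 * √T) N)
  have hmain : ContinuousOn (fun t : ℝ => Z₁ + (t / (2 * Real.pi)) ^ (1 - 2 * σ) * Z₂)
      (Set.Ioi 0) := by
    refine continuousOn_const.add (ContinuousOn.mul ?_ continuousOn_const)
    refine ContinuousOn.rpow_const (by fun_prop) fun t ht => Or.inl ?_
    have : 0 < t := ht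
    positivity
  have i₁ : IntervalIntegrable (fun t : ℝ => ‖zetaL a lam (σ + t * I)‖ ^ 2 -
      diagSum a lam σ (3 * √T) N t) volume T (2 * T) :=
    (((hc.norm.pow 2).continuousOn.sub hd).mono (uIcc_subset_Ioi hT0)).intervalIntegrable
  have i₂ : IntervalIntegrable (fun t : ℝ => diagSum a lam σ (3 * √T) N t -
      (Z₁ + (t / (2 * Real.pi)) ^ (1 - 2 * σ) * Z₂)) volume T (2 * T) :=
    ((hd.sub hmain).mono (uIcc_subset_Ioi hT0)).intervalIntegrable
  have e : ∀ t : ℝ, ‖zetaL a lam (σ + t * I)‖ ^ 2 -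
      (Z₁ + (t / (2 * Real.pi)) ^ (1 - 2 * σ) * Z₂) = (‖zetaL a lam (σ + t * I)‖ ^ 2 -
      diagSum a lam σ (3 * √T) N t) + (diagSum a lam σ (3 * √T) N t -
      (Z₁ + (t / (2 * Real.pi)) ^ (1 - 2 * σ) * Z₂)) := fun t => by ring
  rw [intervalIntegral.integral_congr fun t _ => e t, intervalIntegral.integral_add i₁ i₂]
  have hb : |∫ t in T..2 * T, (diagSum a lam σ (3 * √T) N t -
      (Z₁ + (t / (2 * Real.pi)) ^ (1 - 2 * σ) * Z₂))| ≤ C₁ * 11 * T ^ (1 - σ) := by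
    have h := intervalIntegral.norm_integral_le_of_norm_le_const (a := T) (b := 2 * T)
      (C := C₁ * (11 * (T ^ (1 - σ) / T)))
      (f := fun t => diagSum a lam σ (3 * √T) N t -
      (Z₁ + (t / (2 * Real.pi)) ^ (1 - 2 * σ) * Z₂)) fun t ht => ?_
    · rw [show 2 * T - T = T by ring, abs_of_pos hT0, Real.norm_eq_abs] at h
      refine h.trans_eq ?_
      field_simp
    · rw [Set.uIoc_of_le (by linarith)] at ht
      have ht0 : 0 < t := hT0.trans ht.1
      refine (hD t (3 * √T) N (by linarith [ht.1]) (by linarith) (by linarith) ?_).trans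
        (mul_le_mul_of_nonneg_left ?_ hC₁.le)
      · rw [div_le_iff₀ (by positivity)]
        have p1 : (18 * √T) * (3 * √T) ≤ (N : ℝ) * (3 * √T) :=
          mul_le_mul_of_nonneg_right hN (by positivity)
        have p2 : 0 < (N : ℝ) * (3 * √T) := by nlinarith
        nlinarith [Real.pi_gt_three, ht.2]
      · have p1 := rpow_le_of_sqrt_le (x := 3 * √T) (p := -(2 * σ)) hT0 (by linarith) (by linarith)
        have p2 := rpow_le_of_le_mul_sqrt (x := 3 * √T) (κ := 3) (by positivity) hT0 (by norm_num)
          (by linarith : 0 ≤ 2 - 2 * σ) (by linarith) le_rfl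
        rw [show -(2 * σ) / 2 = 1 - σ - 1 by ring, Real.rpow_sub_one hT0.ne'] at p1
        rw [show (2 - 2 * σ) / 2 = 1 - σ by ring] at p2
        have p3 : (3 * √T) ^ (2 - 2 * σ) / t ≤ 3 ^ 2 * T ^ (1 - σ) / T :=
          div_le_div₀ (by positivity) p2 hT0 ht.1.le
        have p4 : 1 / t ≤ T ^ (1 - σ) / T :=
          div_le_div₀ hY.le (Real.one_le_rpow (by linarith) (by linarith)) hT0 ht.1.le
        refine (add_le_add (add_le_add p1 p3) p4).trans_eq ?_
        ring
  refine (abs_add_le _ _).trans ((add_le_add hm hb).trans ?_)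
  have h3 : C₁ * 11 * T ^ (1 - σ) ≤ C₁ * 11 * (T ^ (1 - σ) * Real.log T) :=
    mul_le_mul_of_nonneg_left (le_mul_of_one_le_right hY.le hL) (by positivity)
  linarith

end dyadicMoment

lemma exists_abs_le_of_dyadic {G : ℝ → ℝ} {α C M : ℝ} (hα : 0 < α) (hC : 0 < C)
    (hG : ∀ T, 48 ≤ T → |G (2 * T) - G T| ≤ C * (T ^ α * Real.log T))
    (hM : ∀ T ∈ Set.Icc (48 : ℝ) 96, |G T| ≤ M) :
    ∃ D, ∀ T, 48 ≤ T → |G T| ≤ D * (T ^ α * Real.log T) := by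
  have hM0 : 0 ≤ M := (abs_nonneg _).trans (hM 48 ⟨le_rfl, by norm_num⟩)
  have h2 : 1 < (2 : ℝ) ^ α := Real.one_lt_rpow (by norm_num) hα
  set D := M + C / ((2 : ℝ) ^ α - 1) with hD
  have hD0 : 0 ≤ D := by
    have : 0 < (2 : ℝ) ^ α - 1 := by linarith
    positivity
  have hDC : D + C ≤ D * 2 ^ α := by
    have h : C / ((2 : ℝ) ^ α - 1) * (2 ^ α - 1) = C := div_mul_cancel₀ _ (by linarith)
    nlinarith
  refine ⟨D, fun T hT => ?_⟩
  obtain ⟨n, hn⟩ := pow_unbounded_of_one_lt (T / 96) (show (1 : ℝ) < 2 by norm_num)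
  have hn' : T ≤ 96 * 2 ^ n := by
    rw [div_lt_iff₀ (by norm_num)] at hn
    linarith
  clear hn
  induction n generalizing T with
  | zero =>
    have h1 : 1 ≤ T ^ α * Real.log T := one_le_mul_of_one_le_of_one_le
      (Real.one_le_rpow (by linarith) hα.le) (one_le_log_of_le hT)
    have hMD : M ≤ D := le_add_of_nonneg_right (div_nonneg hC.le (by linarith))
    exact (hM T ⟨hT, by simpa using hn'⟩).trans (hMD.trans (le_mul_of_one_le_right hD0 h1))
  | succ n ih =>
    rcases le_total T (96 * 2 ^ n) with h | h
    · exact ih T hT h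
    · have h96 : 96 ≤ T := by
        have : (1 : ℝ) ≤ 2 ^ n := one_le_pow₀ (by norm_num)
        linarith
      have i₁ := ih (T / 2) (by linarith) (by rw [pow_succ] at hn'; linarith)
      have i₂ := hG (T / 2) (by linarith)
      rw [mul_div_cancel₀ T (two_ne_zero)] at i₂
      have hlog : Real.log (T / 2) ≤ Real.log T :=
        Real.log_le_log (by linarith) (by linarith)
      have hL := one_le_log_of_le hT
      have hp : 0 < (T / 2) ^ α := Real.rpow_pos_of_pos (by linarith) _
      have e : T ^ α = 2 ^ α * (T / 2) ^ α := by
        rw [← Real.mul_rpow (by norm_num) (by linarith), mul_div_cancel₀ T two_ne_zero]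
      calc |G T| ≤ |G T - G (T / 2)| + |G (T / 2)| := by
            simpa using abs_add_le (G T - G (T / 2)) (G (T / 2))
        _ ≤ (D + C) * ((T / 2) ^ α * Real.log (T / 2)) := by linarith
        _ ≤ (D + C) * ((T / 2) ^ α * Real.log T) :=
            mul_le_mul_of_nonneg_left (mul_le_mul_of_nonneg_left hlog hp.le) (by linarith)
        _ ≤ (D * 2 ^ α) * ((T / 2) ^ α * Real.log T) :=
            mul_le_mul_of_nonneg_right hDC (by positivity)
        _ = D * (T ^ α * Real.log T) := by
            rw [e]
            ring

lemma integral_const_add_rpow {T σ : ℝ} (hT : 0 < T) (hσ1 : σ < 1) (Z₁ Z₂ : ℝ) :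
    ∫ t in T..2 * T, (Z₁ + (t / (2 * Real.pi)) ^ (1 - 2 * σ) * Z₂) = Z₁ * T +
      (2 * Real.pi) ^ (2 * σ - 1) / (2 - 2 * σ) * Z₂ *
        ((2 * T) ^ (2 - 2 * σ) - T ^ (2 - 2 * σ)) := by
  have hm : Set.uIcc T (2 * T) ⊆ Set.Ioi 0 := uIcc_subset_Ioi hT
  have e : ∀ t ∈ Set.uIcc T (2 * T), Z₁ + (t / (2 * Real.pi)) ^ (1 - 2 * σ) * Z₂ =
      Z₁ + (2 * Real.pi) ^ (2 * σ - 1) * Z₂ * t ^ (1 - 2 * σ) := fun t ht => by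
    have ht0 : 0 < t := hm ht
    rw [Real.div_rpow ht0.le (by positivity), div_eq_mul_inv, ← Real.rpow_neg (by positivity),
      neg_sub]
    ring
  have hi : IntervalIntegrable (fun t : ℝ => t ^ (1 - 2 * σ)) volume T (2 * T) :=
    intervalIntegral.intervalIntegrable_rpow' (by linarith)
  rw [intervalIntegral.integral_congr e, intervalIntegral.integral_add
    intervalIntegrable_const (hi.const_mul _), intervalIntegral.integral_const,
    intervalIntegral.integral_const_mul, integral_rpow (Or.inl (by linarith)),
    show 1 - 2 * σ + 1 = 2 - 2 * σ by ring, smul_eq_mul]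
  ring

end LerchMeanSquare

theorem stmt8 (a lam : ℝ) (ha : 0 < a) (ha1 : a ≤ 1) (hl1 : 0 < lam) (hl2 : lam < 1)
    (σ : ℝ) (h1 : 1 / 2 < σ) (h2 : σ < 1) :
    (fun T : ℝ =>
        ((∫ t in (1 : ℝ)..T, ‖zetaL a lam (σ + t * I)‖ ^ 2 : ℝ) : ℂ)
        - hzeta a ((2 * σ : ℝ) : ℂ) * (T : ℂ)
        - ((2 * Real.pi : ℝ) : ℂ) ^ ((2 * σ - 1 : ℝ) : ℂ) / ((2 - 2 * σ : ℝ) : ℂ) *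
            hzeta lam ((2 - 2 * σ : ℝ) : ℂ) * (T : ℂ) ^ ((2 - 2 * σ : ℝ) : ℂ))
      =O[atTop] fun T : ℝ => T ^ (1 - σ) * Real.log T := by
  obtain ⟨Z₁, Z₂, C, hZ₁, hZ₂, hC, hd⟩ :=
    LerchMeanSquare.exists_abs_integral_dyadic_le ha ha1 hl1 hl2 h1 h2
  have hc : Continuous fun t : ℝ => ‖zetaL a lam (σ + t * I)‖ ^ 2 :=
    (LerchMeanSquare.continuous_zetaL ha hl1 hl2 (by linarith)).norm.pow 2
  have hi : ∀ x y : ℝ, IntervalIntegrable (fun t : ℝ => ‖zetaL a lam (σ + t * I)‖ ^ 2) volume x y :=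
    fun x y => hc.intervalIntegrable x y
  set P := (2 * Real.pi) ^ (2 * σ - 1) / (2 - 2 * σ) * Z₂ with hP
  set G : ℝ → ℝ := fun T => (∫ t in (1 : ℝ)..T, ‖zetaL a lam (σ + t * I)‖ ^ 2) - Z₁ * T -
    P * T ^ (2 - 2 * σ) with hG
  have hGc : ContinuousOn G (Set.Icc 48 96) := by
    have k₁ : Continuous fun T : ℝ => ∫ t in (1 : ℝ)..T, ‖zetaL a lam (σ + t * I)‖ ^ 2 :=
      intervalIntegral.continuous_primitive hi 1
    have k₂ : Continuous fun T : ℝ => T ^ (2 - 2 * σ) :=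
      Real.continuous_rpow_const (by linarith)
    exact Continuous.continuousOn (by fun_prop)
  obtain ⟨M, hM⟩ := isCompact_Icc.exists_bound_of_continuousOn hGc
  have hGd : ∀ T, 48 ≤ T → |G (2 * T) - G T| ≤ C * (T ^ (1 - σ) * Real.log T) := fun T hT => by
    have hT0 : 0 < T := by linarith
    refine le_trans (le_of_eq ?_) (hd T hT)
    have hj : IntervalIntegrable (fun t : ℝ => Z₁ + (t / (2 * Real.pi)) ^ (1 - 2 * σ) * Z₂)
        volume T (2 * T) := by
      refine ContinuousOn.intervalIntegrable (continuousOn_const.add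
        (ContinuousOn.mul (ContinuousOn.rpow_const (by fun_prop) fun t ht => Or.inl ?_)
          continuousOn_const))
      have : 0 < t := LerchMeanSquare.uIcc_subset_Ioi hT0 ht
      positivity
    rw [intervalIntegral.integral_sub (hi _ _) hj,
      LerchMeanSquare.integral_const_add_rpow hT0 h2, ← hP,
      ← intervalIntegral.integral_interval_sub_left (hi 1 (2 * T)) (hi 1 T)]
    congr 1
    simp only [hG]
    ring
  obtain ⟨D, hD⟩ := LerchMeanSquare.exists_abs_le_of_dyadic (by linarith : 0 < 1 - σ) hC hGd
    fun T hT => by simpa using hM T hT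
  refine Asymptotics.IsBigO.of_bound D ?_
  filter_upwards [eventually_ge_atTop 48] with T hT
  have hT0 : 0 < T := by linarith
  have e : ((∫ t in (1 : ℝ)..T, ‖zetaL a lam (σ + t * I)‖ ^ 2 : ℝ) : ℂ)
        - hzeta a ((2 * σ : ℝ) : ℂ) * (T : ℂ)
        - ((2 * Real.pi : ℝ) : ℂ) ^ ((2 * σ - 1 : ℝ) : ℂ) / ((2 - 2 * σ : ℝ) : ℂ) *
            hzeta lam ((2 - 2 * σ : ℝ) : ℂ) * (T : ℂ) ^ ((2 - 2 * σ : ℝ) : ℂ) = (G T : ℂ) := by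
    rw [hZ₁, hZ₂, ← ofReal_cpow (by positivity), ← ofReal_cpow hT0.le]
    simp only [hG, hP, ofReal_sub, ofReal_mul, ofReal_div]
  rw [e, norm_real, Real.norm_eq_abs, Real.norm_of_nonneg (mul_nonneg (by positivity)
    (zero_le_one.trans (LerchMeanSquare.one_le_log_of_le hT)))]
  exact hD T hT
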